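/- arXiv:1003.3578 — 3 statements merged into one kernel-verified Lean document; each statement's English description precedes it below -/
import Mathlib

section
/- Let N ≥ 1, let B be the open unit ball of ℝ^N, let p > 1 with 2/(p−1) ∉ ℕ, and let f(u) = u^p for u > 0. Then the unique positive boundary blow-up solution u of Δu = u^p in B is radial and satisfies, with d(r) = 1 − r: u(r) = d^{−2/(p−1)} Σ_{k=0}^{⌊2/(p−1)⌋} a_k d^k + o(1) as r → 1⁻, where each coefficient a_k ∈ ℝ depends only on N and p. -/
open MeasureTheory Filter Metric Set Topology

/-- The Euclidean Laplacian: sum of pure second partial derivatives. -/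
noncomputable def lap {N : ℕ} (u : EuclideanSpace ℝ (Fin N) → ℝ)
    (x : EuclideanSpace ℝ (Fin N)) : ℝ :=
  ∑ i, fderiv ℝ (fun y => fderiv ℝ u y (EuclideanSpace.single i 1)) x (EuclideanSpace.single i 1)

/-- A boundary blow-up solution of `Δu = f(u)` on the open unit ball. -/
def IsBlowUp {N : ℕ} (f : ℝ → ℝ) (u : EuclideanSpace ℝ (Fin N) → ℝ) : Prop :=
  ContDiffOn ℝ 2 u (ball 0 1) ∧
  (∀ x ∈ ball (0 : EuclideanSpace ℝ (Fin N)) 1, lap u x = f (u x)) ∧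
  ∀ x₀ : EuclideanSpace ℝ (Fin N), ‖x₀‖ = 1 →
    Tendsto u (𝓝[ball (0 : EuclideanSpace ℝ (Fin N)) 1] x₀) atTop

/-- second directional derivative -/
noncomputable def DD {N : ℕ} (u : EuclideanSpace ℝ (Fin N) → ℝ)
    (x e : EuclideanSpace ℝ (Fin N)) : ℝ :=
  fderiv ℝ (fun y => fderiv ℝ u y e) x e

lemma DD_line {N : ℕ} {u : EuclideanSpace ℝ (Fin N) → ℝ} {x : EuclideanSpace ℝ (Fin N)}
    (e : EuclideanSpace ℝ (Fin N)) (hu : ContDiffAt ℝ 2 u x) :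
    (∀ᶠ t : ℝ in 𝓝 0, HasDerivAt (fun t : ℝ => u (x + t • e)) (fderiv ℝ u (x + t • e) e) t) ∧
    HasDerivAt (fun t : ℝ => fderiv ℝ u (x + t • e) e) (DD u x e) 0 := by
  have hl : ∀ t : ℝ, HasDerivAt (fun t : ℝ => x + t • e) e t := by
    intro t
    simpa using ((hasDerivAt_id t).smul_const e).const_add x
  have hc : Tendsto (fun t : ℝ => x + t • e) (𝓝 0) (𝓝 x) := by
    have := (hl 0).continuousAt.tendsto
    simpa using this
  constructor
  · have h1 : ∀ᶠ y in 𝓝 x, ContDiffAt ℝ 2 u y := hu.eventually (by simp)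
    filter_upwards [hc.eventually h1] with t ht
    exact (ht.differentiableAt (by norm_num)).hasFDerivAt.comp_hasDerivAt t (hl t)
  · have h2 : DifferentiableAt ℝ (fun y => fderiv ℝ u y e) x := by
      have := (hu.fderiv_right (m := 1) (by norm_num)).differentiableAt (by norm_num)
      exact this.clm_apply (differentiableAt_const e)
    have h3 := h2.hasFDerivAt
    have hx : x + (0 : ℝ) • e = x := by simp
    rw [← hx] at h3
    have := h3.comp_hasDerivAt (0 : ℝ) (hl 0)
    simp only [hx] at this
    exact this

lemma DD_eq_of_line {N : ℕ} {u : EuclideanSpace ℝ (Fin N) → ℝ} {x : EuclideanSpace ℝ (Fin N)}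
    {e : EuclideanSpace ℝ (Fin N)} (hu : ContDiffAt ℝ 2 u x) {ψ : ℝ → ℝ} {c : ℝ}
    (h1 : ∀ᶠ t : ℝ in 𝓝 0, HasDerivAt (fun t : ℝ => u (x + t • e)) (ψ t) t)
    (h2 : HasDerivAt ψ c 0) : DD u x e = c := by
  obtain ⟨h3, h4⟩ := DD_line e hu
  have : (fun t : ℝ => fderiv ℝ u (x + t • e) e) =ᶠ[𝓝 0] ψ := by
    filter_upwards [h1, h3] with t a b
    exact b.unique a
  exact (h4.congr_of_eventuallyEq this.symm).unique h2

lemma second_nonneg {φ ψ : ℝ → ℝ} {c : ℝ} (hmin : IsLocalMin φ 0)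
    (h1 : ∀ᶠ t : ℝ in 𝓝 0, HasDerivAt φ (ψ t) t) (h2 : HasDerivAt ψ c 0) : 0 ≤ c := by
  by_contra hc
  push Not at hc
  have hd : deriv φ =ᶠ[𝓝 0] ψ := by
    filter_upwards [h1] with t ht using ht.deriv
  have hdd : deriv (deriv φ) 0 = c := by
    rw [hd.deriv_eq]; exact h2.deriv
  have hmax : IsLocalMax φ 0 := isLocalMax_of_deriv_deriv_neg (by rw [hdd]; exact hc)
    hmin.deriv_eq_zero h1.self_of_nhds.continuousAt
  have hconst : φ =ᶠ[𝓝 0] fun _ => φ 0 := by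
    filter_upwards [hmin, hmax] with t a b
    exact le_antisymm b a
  have h5 : deriv φ =ᶠ[𝓝 0] fun _ => 0 := by
    have := hconst.deriv
    simpa using this
  have : deriv (deriv φ) 0 = 0 := by
    rw [h5.deriv_eq]; simp
  linarith

lemma lap_le_of_localMin {N : ℕ} {f g : EuclideanSpace ℝ (Fin N) → ℝ}
    {x : EuclideanSpace ℝ (Fin N)} (hf : ContDiffAt ℝ 2 f x) (hg : ContDiffAt ℝ 2 g x)
    (hmin : IsLocalMin (fun y => f y - g y) x) : lap g x ≤ lap f x := by
  unfold lap
  apply Finset.sum_le_sum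
  intro i _
  set e : EuclideanSpace ℝ (Fin N) := EuclideanSpace.single i 1
  change DD g x e ≤ DD f x e
  obtain ⟨f1, f2⟩ := DD_line e hf
  obtain ⟨g1, g2⟩ := DD_line e hg
  have hc : Tendsto (fun t : ℝ => x + t • e) (𝓝 0) (𝓝 x) := by
    have : Continuous (fun t : ℝ => x + t • e) := by fun_prop
    simpa using this.tendsto 0
  have : 0 ≤ DD f x e - DD g x e := by
    refine second_nonneg (φ := fun t : ℝ => f (x + t • e) - g (x + t • e)) ?_ ?_ (f2.sub g2)
    · have := hc.eventually hmin
      unfold IsLocalMin IsMinFilter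
      simpa using this
    · filter_upwards [f1, g1] with t a b
      exact a.sub b
  linarith

lemma comparison {N : ℕ} {f g : EuclideanSpace ℝ (Fin N) → ℝ} {Ω : Set (EuclideanSpace ℝ (Fin N))}
    (hΩ : IsOpen Ω) (hb : Bornology.IsBounded Ω)
    (hf : ContDiffOn ℝ 2 f Ω) (hg : ContDiffOn ℝ 2 g Ω)
    (hbd : ∀ y ∈ closure Ω, y ∉ Ω → ∀ᶠ x in 𝓝[Ω] y, g x ≤ f x)
    (hlap : ∀ x ∈ Ω, f x < g x → lap f x < lap g x) : ∀ x ∈ Ω, g x ≤ f x := by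
  intro x0 hx0
  by_contra hlt
  push Not at hlt
  set h : EuclideanSpace ℝ (Fin N) → ℝ := fun y => f y - g y with hh
  have hcont : ∀ y ∈ Ω, ContinuousAt h y := fun y hy =>
    ((hf.continuousOn.continuousAt (hΩ.mem_nhds hy)).sub
      (hg.continuousOn.continuousAt (hΩ.mem_nhds hy)))
  set K : Set (EuclideanSpace ℝ (Fin N)) := {y | y ∈ Ω ∧ h y ≤ h x0} with hK
  have hKΩ : K ⊆ Ω := fun y hy => hy.1
  have hneg : h x0 < 0 := by simp only [hh]; linarith
  have hclosed : IsClosed K := by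
    rw [isClosed_iff_frequently]
    intro y hy
    by_cases hyΩ : y ∈ Ω
    · refine ⟨hyΩ, ?_⟩
      by_contra hlt2
      push Not at hlt2
      have := (hcont y hyΩ).eventually (lt_mem_nhds hlt2)
      obtain ⟨z, hz1, hz2⟩ := (hy.and_eventually this).exists
      exact absurd hz1.2 (not_le.mpr hz2)
    · have hycl : y ∈ closure Ω := by
        rw [mem_closure_iff_frequently]
        exact hy.mono fun z hz => hz.1
      have := eventually_nhdsWithin_iff.mp (hbd y hycl hyΩ)
      obtain ⟨z, hz1, hz2⟩ := (hy.and_eventually this).exists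
      have := hz2 hz1.1
      have h3 := hz1.2
      simp only [hh] at h3 hneg
      linarith
  have hcomp : IsCompact K := Metric.isCompact_of_isClosed_isBounded hclosed (hb.subset hKΩ)
  obtain ⟨x1, hx1, hmin⟩ := hcomp.exists_isMinOn ⟨x0, hx0, le_rfl⟩
    (fun y hy => (hcont y hy.1).continuousWithinAt)
  have hglob : ∀ y ∈ Ω, h x1 ≤ h y := by
    intro y hy
    by_cases hyK : h y ≤ h x0
    · exact hmin ⟨hy, hyK⟩
    · push Not at hyK
      exact hx1.2.trans hyK.le
  have hloc : IsLocalMin h x1 := by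
    filter_upwards [hΩ.mem_nhds hx1.1] with y hy using hglob y hy
  have h1 := lap_le_of_localMin (hf.contDiffAt (hΩ.mem_nhds hx1.1))
    (hg.contDiffAt (hΩ.mem_nhds hx1.1)) hloc
  have h2 := hlap x1 hx1.1 (by
    have := hx1.2
    simp only [hh] at this hneg
    linarith)
  linarith

lemma DD_comp {N : ℕ} {u : EuclideanSpace ℝ (Fin N) → ℝ} {x : EuclideanSpace ℝ (Fin N)}
    (T : EuclideanSpace ℝ (Fin N) →L[ℝ] EuclideanSpace ℝ (Fin N)) (c : ℝ)
    (e : EuclideanSpace ℝ (Fin N)) (hu : ContDiffAt ℝ 2 u (T x)) :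
    DD (fun y => c * u (T y)) x e = c * DD u (T x) (T e) := by
  obtain ⟨h1, h2⟩ := DD_line (T e) hu
  refine DD_eq_of_line (ψ := fun t : ℝ => c * fderiv ℝ u (T x + t • T e) (T e)) ?_ ?_
    (h2.const_mul c)
  · exact contDiffAt_const.mul (hu.comp x T.contDiff.contDiffAt)
  · filter_upwards [h1] with t ht
    simpa using ht.const_mul c

lemma lap_scale {N : ℕ} {u : EuclideanSpace ℝ (Fin N) → ℝ} {x : EuclideanSpace ℝ (Fin N)}
    (c l : ℝ) (hu : ContDiffAt ℝ 2 u (l • x)) :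
    lap (fun y => c * u (l • y)) x = c * l ^ 2 * lap u (l • x) := by
  unfold lap
  rw [Finset.mul_sum]
  apply Finset.sum_congr rfl
  intro i _
  set e : EuclideanSpace ℝ (Fin N) := EuclideanSpace.single i 1
  change DD _ x e = c * l ^ 2 * DD u (l • x) e
  have h := DD_comp (l • ContinuousLinearMap.id ℝ (EuclideanSpace ℝ (Fin N))) (x := x) c e
    (by simpa using hu)
  simp only [_root_.smul_apply, ContinuousLinearMap.id_apply] at h
  rw [h]
  simp only [DD]
  have hd : DifferentiableAt ℝ (fun y => fderiv ℝ u y e) (l • x) := by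
    have := (hu.fderiv_right (m := 1) (by norm_num)).differentiableAt (by norm_num)
    exact this.clm_apply (differentiableAt_const e)
  have : (fun y => fderiv ℝ u y (l • e)) = fun y => l • fderiv ℝ u y e := by
    ext y; simp
  rw [this, fderiv_fun_const_smul hd]
  simp
  ring

lemma lap_isometry {N : ℕ} {u : EuclideanSpace ℝ (Fin N) → ℝ} {x : EuclideanSpace ℝ (Fin N)}
    (R : EuclideanSpace ℝ (Fin N) ≃ₗᵢ[ℝ] EuclideanSpace ℝ (Fin N))
    (hu : ContDiffAt ℝ 2 u (R x)) :
    lap (fun y => u (R y)) x = lap u (R x) := by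
  have key : ∀ e, DD u (R x) e = iteratedFDeriv ℝ 2 u (R x) ![e, e] := by
    intro e
    rw [iteratedFDeriv_two_apply]
    have hd := (hu.fderiv_right (m := 1) (by norm_num)).differentiableAt (by norm_num)
    simp only [DD]
    rw [fderiv_clm_apply hd (differentiableAt_const e)]
    simp
  have h1 := InnerProductSpace.laplacian_eq_iteratedFDeriv_orthonormalBasis u
    (EuclideanSpace.basisFun (Fin N) ℝ)
  have h2 := InnerProductSpace.laplacian_eq_iteratedFDeriv_orthonormalBasis u
    ((EuclideanSpace.basisFun (Fin N) ℝ).map R)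
  have h3 := congrFun (h1.symm.trans h2) (R x)
  simp only [OrthonormalBasis.map_apply, EuclideanSpace.basisFun_apply, ← key] at h3
  unfold lap
  refine Eq.trans ?_ h3.symm
  apply Finset.sum_congr rfl
  intro i _
  have h := DD_comp (R.toContinuousLinearEquiv : _ →L[ℝ] _) (x := x) 1
    (EuclideanSpace.single i 1) (by simpa using hu)
  change DD _ x _ = _
  simpa using h

lemma lap_radial {N : ℕ} {F F1 : ℝ → ℝ} {c : ℝ} {x : EuclideanSpace ℝ (Fin N)}
    (hx : x ≠ 0) (hF : ContDiffAt ℝ 2 F (1 - ‖x‖))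
    (h1 : ∀ᶠ d in 𝓝 (1 - ‖x‖), HasDerivAt F (F1 d) d) (h2 : HasDerivAt F1 c (1 - ‖x‖)) :
    ContDiffAt ℝ 2 (fun y : EuclideanSpace ℝ (Fin N) => F (1 - ‖y‖)) x ∧
    lap (fun y : EuclideanSpace ℝ (Fin N) => F (1 - ‖y‖)) x
      = c - (N - 1) / ‖x‖ * F1 (1 - ‖x‖) := by
  have hcd : ContDiffAt ℝ 2 (fun y : EuclideanSpace ℝ (Fin N) => F (1 - ‖y‖)) x :=
    hF.comp x (contDiffAt_const.sub (contDiffAt_norm ℝ hx))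
  refine ⟨hcd, ?_⟩
  have hr : 0 < ‖x‖ := norm_pos_iff.mpr hx
  have key : ∀ i, DD (fun y : EuclideanSpace ℝ (Fin N) => F (1 - ‖y‖)) x
      (EuclideanSpace.single i 1) =
      c * (x i ^ 2 / ‖x‖ ^ 2) - F1 (1 - ‖x‖) * (1 / ‖x‖ - x i ^ 2 / ‖x‖ ^ 3) := by
    intro i
    set e : EuclideanSpace ℝ (Fin N) := EuclideanSpace.single i 1 with he
    have hc : Tendsto (fun t : ℝ => x + t • e) (𝓝 0) (𝓝 x) := by
      have : Continuous (fun t : ℝ => x + t • e) := by fun_prop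
      simpa using this.tendsto 0
    have hn : ∀ t : ℝ, ‖x + t • e‖ ^ 2 = ‖x‖ ^ 2 + 2 * t * x i + t ^ 2 := by
      intro t
      rw [norm_add_sq_real, inner_smul_right, norm_smul, he, EuclideanSpace.inner_single_right]
      simp
      ring
    have hn' : ∀ t : ℝ, ‖x + t • e‖ = Real.sqrt (‖x‖ ^ 2 + 2 * t * x i + t ^ 2) := by
      intro t
      rw [← hn, Real.sqrt_sq (norm_nonneg _)]
    have hder : ∀ t : ℝ, x + t • e ≠ 0 →
        HasDerivAt (fun t : ℝ => ‖x + t • e‖) ((x i + t) / ‖x + t • e‖) t := by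
      intro t ht
      have hp : 0 < ‖x + t • e‖ := norm_pos_iff.mpr ht
      have hpos : ‖x‖ ^ 2 + 2 * t * x i + t ^ 2 ≠ 0 := by rw [← hn]; positivity
      have hq : HasDerivAt (fun t : ℝ => ‖x‖ ^ 2 + 2 * t * x i + t ^ 2) (2 * x i + 2 * t) t := by
        have := (((hasDerivAt_id' t).const_mul 2).mul_const (x i)).const_add (‖x‖ ^ 2) |>.fun_add
          ((hasDerivAt_id' t).fun_pow 2)
        exact this.congr_deriv (by simp)
      have := hq.sqrt hpos
      rw [← hn'] at this
      have e1 : (fun t : ℝ => ‖x + t • e‖) = fun t => √(‖x‖ ^ 2 + 2 * t * x i + t ^ 2) :=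
        funext hn'
      rw [e1]
      refine this.congr_deriv ?_
      field_simp
    have hne : ∀ᶠ t : ℝ in 𝓝 0, x + t • e ≠ 0 := hc.eventually_ne hx
    have hx0 : x + (0 : ℝ) • e = x := by simp
    have hcn : Tendsto (fun t : ℝ => 1 - ‖x + t • e‖) (𝓝 0) (𝓝 (1 - ‖x‖)) :=
      tendsto_const_nhds.sub hc.norm
    have hder0 := hder 0 (by rw [hx0]; exact hx)
    refine DD_eq_of_line (ψ := fun t : ℝ => F1 (1 - ‖x + t • e‖) * (-((x i + t) / ‖x + t • e‖)))
      hcd ?_ ?_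
    · filter_upwards [hne, hcn.eventually h1] with t a b
      have := (hder t a).const_sub 1
      exact b.comp t this
    · have h2' : HasDerivAt F1 c (1 - ‖x + (0 : ℝ) • e‖) := by rw [hx0]; exact h2
      have a1 := h2'.comp (0 : ℝ) (hder0.const_sub 1)
      have a2 := (((hasDerivAt_id' (0 : ℝ)).const_add (x i)).fun_div hder0
        (by rw [hx0]; exact hr.ne')).fun_neg
      have := a1.fun_mul a2
      refine this.congr_deriv ?_
      simp only [hx0, Function.comp]
      simp
      field_simp
      ring
  have hs : ∑ i, x i ^ 2 = ‖x‖ ^ 2 := by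
    rw [EuclideanSpace.norm_sq_eq]; simp
  change ∑ i, DD (fun y : EuclideanSpace ℝ (Fin N) => F (1 - ‖y‖)) x
      (EuclideanSpace.single i 1) = _
  rw [Finset.sum_congr rfl (fun i _ => key i), Finset.sum_sub_distrib, ← Finset.mul_sum,
    ← Finset.mul_sum, Finset.sum_sub_distrib, ← Finset.sum_div, ← Finset.sum_div (a := ‖x‖ ^ 3), hs]
  simp
  field_simp

section sol

variable {N : ℕ} {p : ℝ} {u v : EuclideanSpace ℝ (Fin N) → ℝ}

lemma alpha_mul {p : ℝ} (hp : 1 < p) : 2 / (p - 1) * p = 2 / (p - 1) + 2 := by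
  have : p - 1 ≠ 0 := by linarith
  field_simp
  ring

lemma scaled_sol (hp : 1 < p) (hpos : ∀ x ∈ ball (0 : EuclideanSpace ℝ (Fin N)) 1, 0 < u x)
    (hu : IsBlowUp (fun t => t ^ p) u) {l : ℝ} (hl : 0 < l) {x : EuclideanSpace ℝ (Fin N)}
    (hx : l * ‖x‖ < 1) :
    0 < l ^ (2 / (p - 1)) * u (l • x) ∧
    ContDiffAt ℝ 2 (fun y => l ^ (2 / (p - 1)) * u (l • y)) x ∧
    lap (fun y => l ^ (2 / (p - 1)) * u (l • y)) x = (l ^ (2 / (p - 1)) * u (l • x)) ^ p := by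
  have hm : l • x ∈ ball (0 : EuclideanSpace ℝ (Fin N)) 1 := by
    simp [norm_smul, abs_of_pos hl, hx]
  have hc : ContDiffAt ℝ 2 u (l • x) := hu.1.contDiffAt (isOpen_ball.mem_nhds hm)
  have h0 : 0 < l ^ (2 / (p - 1)) := Real.rpow_pos_of_pos hl _
  refine ⟨mul_pos h0 (hpos _ hm), ?_, ?_⟩
  · exact contDiffAt_const.mul (hc.comp x (contDiff_const_smul l).contDiffAt)
  · rw [lap_scale _ _ hc, hu.2.1 _ hm, Real.mul_rpow h0.le (hpos _ hm).le, ← Real.rpow_mul hl.le,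
      alpha_mul hp, Real.rpow_add hl]
    norm_num

lemma scaled_tendsto (hu : IsBlowUp (fun t => t ^ p) u) {x : EuclideanSpace ℝ (Fin N)}
    (hx : x ∈ ball (0 : EuclideanSpace ℝ (Fin N)) 1) :
    Tendsto (fun l : ℝ => l ^ (2 / (p - 1)) * u (l • x)) (𝓝 1) (𝓝 (u x)) := by
  have hc : ContinuousAt u x := (hu.1.contDiffAt (isOpen_ball.mem_nhds hx)).continuousAt
  have h1 : Tendsto (fun l : ℝ => l • x) (𝓝 1) (𝓝 x) := by
    have : Continuous (fun l : ℝ => l • x) := by fun_prop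
    simpa using this.tendsto 1
  have h2 : Tendsto (fun l : ℝ => l ^ (2 / (p - 1))) (𝓝 1) (𝓝 1) := by
    have := (Real.continuousAt_rpow_const (1 : ℝ) (2 / (p - 1)) (Or.inl one_ne_zero)).tendsto
    simpa using this
  simpa using h2.mul (hc.tendsto.comp h1)

lemma sol_le (hp : 1 < p) (hpos : ∀ x ∈ ball (0 : EuclideanSpace ℝ (Fin N)) 1, 0 < u x)
    (hu : IsBlowUp (fun t => t ^ p) u)
    (hposv : ∀ x ∈ ball (0 : EuclideanSpace ℝ (Fin N)) 1, 0 < v x)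
    (hv : IsBlowUp (fun t => t ^ p) v) :
    ∀ x ∈ ball (0 : EuclideanSpace ℝ (Fin N)) 1, u x ≤ v x := by
  intro x hx
  have key : ∀ l : ℝ, 0 < l → l < 1 → l ^ (2 / (p - 1)) * u (l • x) ≤ v x := by
    intro l hl hl1
    have hin : ∀ y : EuclideanSpace ℝ (Fin N), ‖y‖ ≤ 1 → l * ‖y‖ < 1 := by
      intro y hy
      nlinarith [norm_nonneg y]
    refine comparison (f := v) (g := fun y => l ^ (2 / (p - 1)) * u (l • y)) isOpen_ball
      isBounded_ball hv.1 ?_ ?_ ?_ x hx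
    · intro y hy
      exact (scaled_sol hp hpos hu hl (hin y (by simpa using (mem_ball.mp hy).le))).2.1.contDiffWithinAt
    · intro y hy hy'
      have hy1 : ‖y‖ ≤ 1 := by
        have := closure_ball_subset_closedBall hy
        simpa using this
      have hy2 : ‖y‖ = 1 := by
        refine le_antisymm hy1 ?_
        simpa using hy'
      have h1 := hv.2.2 y hy2
      have h2 := (scaled_sol hp hpos hu hl (hin y hy1)).2.1.continuousAt
      have h3 := h2.eventually (gt_mem_nhds (lt_add_one _))
      filter_upwards [h1.eventually_ge_atTop _, nhdsWithin_le_nhds h3] with z a b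
      exact b.le.trans a
    · intro y hy hlt
      have h1 := scaled_sol hp hpos hu hl (hin y (by simpa using (mem_ball.mp hy).le))
      rw [h1.2.2, hv.2.1 y hy]
      exact Real.rpow_lt_rpow (hposv y hy).le hlt (by linarith)
  have h1 := (scaled_tendsto hu hx).mono_left (nhdsWithin_le_nhds (s := Iio 1))
  refine le_of_tendsto h1 ?_
  filter_upwards [Ioo_mem_nhdsLT (show (0 : ℝ) < 1 by norm_num)] with l hl
  exact key l hl.1 hl.2

lemma sol_radial (hp : 1 < p) (hpos : ∀ x ∈ ball (0 : EuclideanSpace ℝ (Fin N)) 1, 0 < u x)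
    (hu : IsBlowUp (fun t => t ^ p) u) :
    ∀ x ∈ ball (0 : EuclideanSpace ℝ (Fin N)) 1,
        ∀ y ∈ ball (0 : EuclideanSpace ℝ (Fin N)) 1, ‖x‖ = ‖y‖ → u x = u y := by
  have key : ∀ x ∈ ball (0 : EuclideanSpace ℝ (Fin N)) 1,
        ∀ y ∈ ball (0 : EuclideanSpace ℝ (Fin N)) 1, ‖x‖ = ‖y‖ → u x ≤ u y := by
    intro x hx y hy hxy
    obtain ⟨R, hR⟩ : ∃ R : EuclideanSpace ℝ (Fin N) ≃ₗᵢ[ℝ] EuclideanSpace ℝ (Fin N), R x = y :=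
      ⟨_, Submodule.reflection_sub hxy⟩
    have hm : ∀ z ∈ ball (0 : EuclideanSpace ℝ (Fin N)) 1,
        R z ∈ ball (0 : EuclideanSpace ℝ (Fin N)) 1 := by
      intro z hz; simpa using hz
    have hle := sol_le (v := fun z => u (R z)) hp hpos hu (fun z hz => hpos _ (hm z hz)) ?_ x hx
    · simpa [hR] using hle
    · refine ⟨?_, ?_, ?_⟩
      · exact hu.1.comp R.contDiff.contDiffOn hm
      · intro z hz
        rw [lap_isometry R (hu.1.contDiffAt (isOpen_ball.mem_nhds (hm z hz)))]
        exact hu.2.1 _ (hm z hz)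
      · intro z hz
        refine (hu.2.2 (R z) (by simpa using hz)).comp ?_
        exact tendsto_nhdsWithin_of_tendsto_nhds_of_eventually_within _
          (R.continuous.continuousAt.tendsto.mono_left nhdsWithin_le_nhds)
          (eventually_mem_nhdsWithin.mono hm)
  intro x hx y hy hxy
  exact le_antisymm (key x hx y hy hxy) (key y hy x hx hxy.symm)

end sol

open Polynomial in
/-- the reduced linear operator on the polynomial factor -/
noncomputable def LL (α n : ℝ) (Q : ℝ[X]) (d : ℝ) : ℝ :=
  α * (α + 1) * Q.eval d - 2 * α * d * Q.derivative.eval d + d ^ 2 * Q.derivative.derivative.eval d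
    - n * d * (-α * Q.eval d + d * Q.derivative.eval d) / (1 - d)

open Polynomial in
lemma LL_add (α n : ℝ) (Q : ℝ[X]) (a d : ℝ) (k : ℕ) (hd : d < 1) :
    LL α n (Q + C a * X ^ (k + 1)) d = LL α n Q d + d ^ (k + 1) * (a * (((k + 1 : ℝ) - α) *
      ((k + 1 : ℝ) - α - 1) - n * d * ((k + 1 : ℝ) - α) / (1 - d))) := by
  have h1 : 1 - d ≠ 0 := by linarith
  unfold LL
  rcases k with _ | k
  · simp
    field_simp
    ring
  · simp
    field_simp
    ring

lemma analyticAt_rpow_of_pos {f : ℝ → ℝ} {x p : ℝ} (hf : AnalyticAt ℝ f x) (h : 0 < f x) :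
    AnalyticAt ℝ (fun y => f y ^ p) x := by
  have h1 : AnalyticAt ℝ (fun t : ℝ => t ^ p) (f x) :=
    (Real.contDiffAt_rpow_const_of_ne (n := ⊤) h.ne').analyticAt
  exact AnalyticAt.comp h1 hf

lemma analyticAt_dslope {f : ℝ → ℝ} {x : ℝ} (hf : AnalyticAt ℝ f x) :
    AnalyticAt ℝ (dslope f x) x := by
  obtain ⟨q, hq⟩ := hf
  exact ⟨_, hq.has_fpower_series_dslope_fslope⟩

open Polynomial in
lemma analyticAt_eval (Q : ℝ[X]) (x : ℝ) : AnalyticAt ℝ (fun d => Q.eval d) x := by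
  simpa using (analyticAt_id (𝕜 := ℝ) (z := x)).aeval_polynomial Q

open Polynomial in
lemma formal_step {α n p a0 : ℝ} (hα : 0 < α) (hαp : α * p = α + 2) (ha0 : 0 < a0)
    (ha : a0 ^ p = α * (α + 1) * a0) (k : ℕ) (hk : (k : ℝ) + 1 ≤ α)
    {Q : ℝ[X]} (hQ0 : Q.eval 0 = a0)
    {g : ℝ → ℝ} (hg : AnalyticAt ℝ g 0)
    (hQ : ∀ᶠ d in 𝓝 (0 : ℝ), LL α n Q d - Q.eval d ^ p = d ^ (k + 1) * g d) :
    ∃ a : ℝ, ∃ g1 : ℝ → ℝ, AnalyticAt ℝ g1 0 ∧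
      ∀ᶠ d in 𝓝 (0 : ℝ), LL α n (Q + C a * X ^ (k + 1)) d -
        (Q + C a * X ^ (k + 1)).eval d ^ p = d ^ (k + 2) * g1 d := by
  set ind : ℝ := ((k + 1 : ℝ) - α) * ((k + 1 : ℝ) - α - 1) - (α + 1) * (α + 2) with hind
  have hind0 : ind ≠ 0 := by
    have : ind = ((k : ℝ) + 1 - 2 * α - 2) * (k + 2) := by rw [hind]; ring
    rw [this]
    have h1 : (k : ℝ) + 1 - 2 * α - 2 ≠ 0 := by linarith
    have h2 : (k : ℝ) + 2 ≠ 0 := by positivity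
    exact mul_ne_zero h1 h2
  set a : ℝ := -g 0 / ind with hadef
  set q : ℝ → ℝ := dslope (fun y => (1 + y) ^ p) 0 with hq
  have hpow : AnalyticAt ℝ (fun y : ℝ => (1 + y) ^ p) 0 :=
    analyticAt_rpow_of_pos (analyticAt_const.add analyticAt_id) (by simp)
  have hqa : AnalyticAt ℝ q 0 := analyticAt_dslope hpow
  have hq0 : q 0 = p := by
    rw [hq, dslope_same]
    have h1 : HasDerivAt (fun y : ℝ => (1 + y) ^ p) (1 * p * (1 + 0) ^ (p - 1)) 0 :=
      ((hasDerivAt_id' (0 : ℝ)).const_add 1).rpow_const (Or.inl (by norm_num))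
    rw [h1.deriv]
    simp
  have hqm : ∀ y : ℝ, (1 + y) ^ p = 1 + y * q y := by
    intro y
    have := sub_smul_dslope (fun y : ℝ => (1 + y) ^ p) 0 y
    simp only [sub_zero, smul_eq_mul, add_zero, Real.one_rpow] at this
    rw [hq, this]; ring
  have hQa := analyticAt_eval Q 0
  have hQne : Q.eval 0 ≠ 0 := by rw [hQ0]; exact ha0.ne'
  have hha : AnalyticAt ℝ (fun d : ℝ => a * d ^ (k + 1) / Q.eval d) 0 :=
    (analyticAt_const.mul (analyticAt_id.pow _)).div hQa hQne
  set G : ℝ → ℝ := fun d => g d + a * (((k + 1 : ℝ) - α) *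
      ((k + 1 : ℝ) - α - 1) - n * d * ((k + 1 : ℝ) - α) / (1 - d)) -
      a * (Q.eval d ^ p / Q.eval d * q (a * d ^ (k + 1) / Q.eval d)) with hG
  have hGa : AnalyticAt ℝ G 0 := by
    have b1 : AnalyticAt ℝ (fun d : ℝ => n * d * ((k + 1 : ℝ) - α) / (1 - d)) 0 :=
      ((analyticAt_const.mul analyticAt_id).mul analyticAt_const).div
        (analyticAt_const.sub analyticAt_id) (by simp)
    have b2 : AnalyticAt ℝ (fun d : ℝ => q (a * d ^ (k + 1) / Q.eval d)) 0 :=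
      AnalyticAt.comp (g := q) (by simpa using hqa) hha
    have b3 : AnalyticAt ℝ (fun d : ℝ => Q.eval d ^ p / Q.eval d) 0 :=
      (analyticAt_rpow_of_pos hQa (by rw [hQ0]; exact ha0)).div hQa hQne
    exact (hg.add (analyticAt_const.mul (analyticAt_const.sub b1))).sub
      (analyticAt_const.mul (b3.mul b2))
  have hG0 : G 0 = 0 := by
    have : G 0 = g 0 + a * ind := by
      simp only [hG, hQ0, ha]
      simp only [ne_eq, Nat.add_eq_zero_iff, one_ne_zero, and_false, not_false_eq_true, zero_pow,
        mul_zero, zero_div, hq0]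
      rw [hind]
      have h1 : α * (α + 1) * a0 / a0 * p = (α + 1) * (α + 2) := by
        rw [← hαp]; field_simp
      rw [h1]; ring
    rw [this, hadef]
    field_simp
    ring
  refine ⟨a, dslope G 0, analyticAt_dslope hGa, ?_⟩
  have e1 : ∀ᶠ d in 𝓝 (0 : ℝ), 0 < Q.eval d :=
    hQa.continuousAt.eventually (lt_mem_nhds (by simpa [hQ0] using ha0))
  have e2 : ∀ᶠ d in 𝓝 (0 : ℝ), -1 < a * d ^ (k + 1) / Q.eval d :=
    hha.continuousAt.eventually (lt_mem_nhds (by simp))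
  have e3 : ∀ᶠ d in 𝓝 (0 : ℝ), d < 1 := gt_mem_nhds (by norm_num)
  filter_upwards [hQ, e1, e2, e3] with d h1 h2 h3 h4
  have hGd : G d = d * dslope G 0 d := by
    have := sub_smul_dslope G 0 d
    simp only [sub_zero, smul_eq_mul, hG0] at this
    exact this.symm
  have hp1 : (Q + C a * X ^ (k + 1)).eval d ^ p =
      Q.eval d ^ p + a * d ^ (k + 1) * (Q.eval d ^ p / Q.eval d *
        q (a * d ^ (k + 1) / Q.eval d)) := by
    have : (Q + C a * X ^ (k + 1)).eval d = Q.eval d * (1 + a * d ^ (k + 1) / Q.eval d) := by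
      simp
      field_simp
    rw [this, Real.mul_rpow h2.le (by linarith), hqm]
    field_simp
  rw [LL_add _ _ _ _ _ _ h4, hp1]
  have : d ^ (k + 2) * dslope G 0 d = d ^ (k + 1) * G d := by rw [hGd]; ring
  rw [this]
  simp only [hG]
  linear_combination h1

open Polynomial in
lemma formal_exists {α n p a0 : ℝ} (hα : 0 < α) (hαp : α * p = α + 2) (ha0 : 0 < a0)
    (ha : a0 ^ p = α * (α + 1) * a0) (k : ℕ) (hk : (k : ℝ) ≤ α) :
    ∃ Q : ℝ[X], Q.eval 0 = a0 ∧ Q.natDegree ≤ k ∧ ∃ g : ℝ → ℝ, AnalyticAt ℝ g 0 ∧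
      ∀ᶠ d in 𝓝 (0 : ℝ), LL α n Q d - Q.eval d ^ p = d ^ (k + 1) * g d := by
  induction k with
  | zero =>
    refine ⟨C a0, by simp, by simp, fun d => n * α * a0 / (1 - d), ?_, ?_⟩
    · exact analyticAt_const.div (analyticAt_const.sub analyticAt_id) (by simp)
    · have e3 : ∀ᶠ d in 𝓝 (0 : ℝ), d < 1 := gt_mem_nhds (by norm_num)
      filter_upwards [e3] with d hd
      have h1 : 1 - d ≠ 0 := by linarith
      simp [LL, ha]
      field_simp
  | succ k ih =>
    push_cast at hk
    obtain ⟨Q, hQ0, hdeg, g, hg, hQ⟩ := ih (by linarith)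
    obtain ⟨a, g1, hg1, h1⟩ := formal_step hα hαp ha0 ha k hk hQ0 hg hQ
    refine ⟨Q + C a * X ^ (k + 1), by simp [hQ0], ?_, g1, hg1, h1⟩
    refine (natDegree_add_le _ _).trans (max_le (by omega) ?_)
    exact natDegree_C_mul_X_pow_le a (k + 1)

open Polynomial in
/-- one-dimensional profile -/
noncomputable def FF (α δ B : ℝ) (Q : ℝ[X]) (d : ℝ) : ℝ := d ^ (-α) * Q.eval d + B * d ^ δ

open Polynomial in
lemma FF_lap {N : ℕ} (α δ B : ℝ) (Q : ℝ[X]) {x : EuclideanSpace ℝ (Fin N)} (hx : x ≠ 0)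
    (hx1 : ‖x‖ < 1) :
    ContDiffAt ℝ 2 (fun y : EuclideanSpace ℝ (Fin N) => FF α δ B Q (1 - ‖y‖)) x ∧
    lap (fun y : EuclideanSpace ℝ (Fin N) => FF α δ B Q (1 - ‖y‖)) x =
      (1 - ‖x‖) ^ (-α - 2) * LL α (N - 1) Q (1 - ‖x‖) + B * (1 - ‖x‖) ^ (δ - 2) *
        (δ * (δ - 1) - (N - 1) * δ * (1 - ‖x‖) / ‖x‖) := by
  have hr : 0 < ‖x‖ := norm_pos_iff.mpr hx
  have hd : 0 < 1 - ‖x‖ := by linarith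
  have hrp : ∀ (s d : ℝ), 0 < d → HasDerivAt (fun t : ℝ => t ^ s) (s * d ^ (s - 1)) d := by
    intro s d hd
    exact Real.hasDerivAt_rpow_const (Or.inl hd.ne')
  have h1 : ∀ d : ℝ, 0 < d → HasDerivAt (FF α δ B Q)
      (-α * d ^ (-α - 1) * Q.eval d + d ^ (-α) * Q.derivative.eval d
        + B * (δ * d ^ (δ - 1))) d := by
    intro d hd
    exact ((hrp (-α) d hd).fun_mul (Q.hasDerivAt d)).fun_add ((hrp δ d hd).const_mul B)
  have h2 : ∀ d : ℝ, 0 < d → HasDerivAt (fun d : ℝ =>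
      (-α * d ^ (-α - 1) * Q.eval d + d ^ (-α) * Q.derivative.eval d
        + B * (δ * d ^ (δ - 1))))
      ((-α * ((-α - 1) * d ^ (-α - 1 - 1)) * Q.eval d + -α * d ^ (-α - 1) * Q.derivative.eval d)
        + (-α * d ^ (-α - 1) * Q.derivative.eval d + d ^ (-α) * Q.derivative.derivative.eval d)
        + B * (δ * ((δ - 1) * d ^ (δ - 1 - 1)))) d := by
    intro d hd
    exact ((((hrp (-α - 1) d hd).const_mul (-α)).fun_mul (Q.hasDerivAt d)).fun_add
      ((hrp (-α) d hd).fun_mul (Q.derivative.hasDerivAt d))).fun_add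
      (((hrp (δ - 1) d hd).const_mul δ).const_mul B)
  have hcd : ContDiffAt ℝ 2 (FF α δ B Q) (1 - ‖x‖) := by
    have q : ContDiffAt ℝ 2 (fun d : ℝ => Q.eval d) (1 - ‖x‖) := (analyticAt_eval Q _).contDiffAt
    exact ((Real.contDiffAt_rpow_const_of_ne hd.ne').mul q).add
      (contDiffAt_const.mul (Real.contDiffAt_rpow_const_of_ne hd.ne'))
  obtain ⟨a1, a2⟩ := lap_radial hx hcd ((lt_mem_nhds hd).mono h1) (h2 _ hd)
  refine ⟨a1, a2.trans ?_⟩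
  set d := 1 - ‖x‖ with hdd
  have hrd : ‖x‖ = 1 - d := by rw [hdd]; ring
  rw [hrd] at hr ⊢
  have e1 : d ^ (-α - 1 - 1) = d ^ (-α - 2) := by congr 1; ring
  have e2 : d ^ (-α - 1) = d ^ (-α - 2) * d := by
    rw [← Real.rpow_add_one hd.ne']; congr 1; ring
  have e3 : d ^ (-α) = d ^ (-α - 2) * d * d := by
    rw [← Real.rpow_add_one hd.ne', ← Real.rpow_add_one hd.ne']; congr 1; ring
  have e4 : d ^ (δ - 1 - 1) = d ^ (δ - 2) := by congr 1; ring
  have e5 : d ^ (δ - 1) = d ^ (δ - 2) * d := by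
    rw [← Real.rpow_add_one hd.ne']; congr 1; ring
  rw [e1, e2, e3, e4, e5]
  unfold LL
  have : 1 - d ≠ 0 := hr.ne'
  field_simp
  ring

open Polynomial in
set_option maxHeartbeats 1000000 in
lemma barrier {N : ℕ} (hN : 1 ≤ N) {p : ℝ} (hp : 1 < p) {α δ : ℝ} {m : ℕ}
    (hαd : α = 2 / (p - 1)) (hm : (m : ℝ) ≤ α) (hδ : δ = m + 1 - α) (hδ0 : 0 < δ) (hδ1 : δ < 1) :
    ∃ Q : ℝ[X], Q.natDegree ≤ m ∧ 0 < Q.eval 0 ∧ ∃ d0 : ℝ, 0 < d0 ∧ d0 < 1 ∧ ∃ A0 : ℝ, 0 ≤ A0 ∧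
      ∀ A, A0 ≤ A → ∀ x : EuclideanSpace ℝ (Fin N), 0 < 1 - ‖x‖ → 1 - ‖x‖ ≤ d0 →
      0 < Q.eval (1 - ‖x‖) ∧
      ContDiffAt ℝ 2 (fun y : EuclideanSpace ℝ (Fin N) => FF α δ A Q (1 - ‖y‖)) x ∧
      ContDiffAt ℝ 2 (fun y : EuclideanSpace ℝ (Fin N) => FF α δ (-A) Q (1 - ‖y‖)) x ∧
      lap (fun y : EuclideanSpace ℝ (Fin N) => FF α δ A Q (1 - ‖y‖)) x
        < (FF α δ A Q (1 - ‖x‖)) ^ p ∧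
      (0 < FF α δ (-A) Q (1 - ‖x‖) → (FF α δ (-A) Q (1 - ‖x‖)) ^ p
        < lap (fun y : EuclideanSpace ℝ (Fin N) => FF α δ (-A) Q (1 - ‖y‖)) x) := by
  have hp1 : 0 < p - 1 := by linarith
  have hα : 0 < α := by rw [hαd]; positivity
  have hαp : α * p = α + 2 := by rw [hαd]; exact alpha_mul hp
  have hN' : (0 : ℝ) ≤ (N : ℝ) - 1 := by
    have : (1 : ℝ) ≤ N := by exact_mod_cast hN
    linarith
  set a0 : ℝ := (α * (α + 1)) ^ (1 / (p - 1)) with ha0d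
  have hb : 0 < α * (α + 1) := by positivity
  have ha0 : 0 < a0 := Real.rpow_pos_of_pos hb _
  have ha1 : a0 ^ (p - 1) = α * (α + 1) := by
    rw [ha0d, ← Real.rpow_mul hb.le, one_div_mul_cancel hp1.ne', Real.rpow_one]
  have hsplit : ∀ w : ℝ, 0 < w → w ^ p = w ^ (p - 1) * w := by
    intro w hw
    rw [← Real.rpow_add_one hw.ne']; congr 1; ring
  have ha : a0 ^ p = α * (α + 1) * a0 := by rw [hsplit _ ha0, ha1]
  obtain ⟨Q, hQ0, hdeg, g, hg, hQ⟩ := formal_exists (n := (N : ℝ) - 1) hα hαp ha0 ha m hm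
  set c : ℝ := α * (α + 1) / 2 with hc
  have hc0 : 0 < c := by positivity
  set K : ℝ := |g 0| + 1 with hK
  have hK0 : 0 < K := by positivity
  have hQc := (analyticAt_eval Q 0).continuousAt
  have e1 : ∀ᶠ d in 𝓝 (0 : ℝ), 0 < Q.eval d :=
    hQc.eventually (lt_mem_nhds (by simpa [hQ0] using ha0))
  have e2 : ∀ᶠ d in 𝓝 (0 : ℝ), |g d| < K :=
    hg.continuousAt.abs.eventually (gt_mem_nhds (by simp [hK]))
  have e3 : ∀ᶠ d in 𝓝 (0 : ℝ), c < Q.eval d ^ (p - 1) := by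
    have := (analyticAt_rpow_of_pos (p := p - 1) (analyticAt_eval Q 0)
      (by rw [hQ0]; exact ha0)).continuousAt
    refine this.eventually (lt_mem_nhds ?_)
    simp only [hQ0, ha1]
    rw [hc]; linarith
  obtain ⟨ε, hε, hball⟩ := Metric.eventually_nhds_iff.mp (((hQ.and e1).and e2).and e3)
  refine ⟨Q, hdeg, by rw [hQ0]; exact ha0, min (ε / 2) (1 / 2), by positivity,
    lt_of_le_of_lt (min_le_right _ _) (by norm_num), K / c + 1, by positivity, ?_⟩
  intro A hA x hd hdd0
  have hA0 : 0 < A := lt_of_lt_of_le (by positivity) hA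
  have hAc : K < A * c := by
    have : K / c < A := by linarith
    rwa [div_lt_iff₀ hc0] at this
  have hr : 0 < ‖x‖ := by
    have := hdd0.trans (min_le_right _ _)
    linarith
  have hx : x ≠ 0 := norm_pos_iff.mp hr
  obtain ⟨s1, s2⟩ := FF_lap α δ A Q hx (by linarith)
  obtain ⟨t1, t2⟩ := FF_lap α δ (-A) Q hx (by linarith)
  set d := 1 - ‖x‖ with hddef
  have hdist : dist d 0 < ε := by
    rw [Real.dist_eq, sub_zero, abs_of_pos hd]
    have := hdd0.trans (min_le_left _ _)
    linarith
  obtain ⟨⟨⟨b1, b2⟩, b3⟩, b4⟩ := hball hdist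
  refine ⟨b2, s1, t1, ?_⟩
  set w := d ^ (-α) * Q.eval d with hw
  have hdα : 0 < d ^ (-α) := Real.rpow_pos_of_pos hd _
  have hw0 : 0 < w := mul_pos hdα b2
  have hwp : w ^ p = d ^ (-α - 2) * Q.eval d ^ p := by
    rw [hw, Real.mul_rpow hdα.le b2.le, ← Real.rpow_mul hd.le]
    congr 2; linarith
  have hwp1 : w ^ (p - 1) = d ^ (-2 : ℝ) * Q.eval d ^ (p - 1) := by
    rw [hw, Real.mul_rpow hdα.le b2.le, ← Real.rpow_mul hd.le]
    congr 2; linarith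
  set h := A * d ^ δ with hh
  have hdδ : 0 < d ^ δ := Real.rpow_pos_of_pos hd _
  have hh0 : 0 < h := mul_pos hA0 hdδ
  set z := d ^ (δ - 2) with hz
  have hz0 : 0 < z := Real.rpow_pos_of_pos hd _
  have hwh : A * c * z ≤ w ^ (p - 1) * h := by
    have e : z = d ^ (-2 : ℝ) * d ^ δ := by
      rw [hz, ← Real.rpow_add hd]; congr 1; ring
    rw [hwp1, e, hh]
    have : 0 < d ^ (-2 : ℝ) := Real.rpow_pos_of_pos hd _
    have h3 : c * (A * d ^ (-2 : ℝ) * d ^ δ) ≤ Q.eval d ^ (p - 1) * (A * d ^ (-2 : ℝ) * d ^ δ) :=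
      mul_le_mul_of_nonneg_right b4.le (by positivity)
    linarith
  have hKz : K * z < A * c * z := mul_lt_mul_of_pos_right hAc hz0
  have herr : d ^ (-α - 2) * LL α (N - 1) Q d = w ^ p + z * g d := by
    have e : z = d ^ (-α - 2) * d ^ (m + 1) := by
      rw [hz, ← Real.rpow_natCast, ← Real.rpow_add hd]
      congr 1; rw [hδ]; push_cast; ring
    rw [hwp, e]
    linear_combination d ^ (-α - 2) * b1
  have hgz := abs_lt.mp b3
  have hz1 : z * g d ≤ K * z := by
    have := mul_le_mul_of_nonneg_left hgz.2.le hz0.le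
    linarith
  have hz2 : -(K * z) ≤ z * g d := by
    have := mul_le_mul_of_nonneg_left hgz.1.le hz0.le
    linarith
  have hneg : δ * (δ - 1) - (N - 1) * δ * d / ‖x‖ ≤ 0 := by
    have : 0 ≤ (N - 1) * δ * d / ‖x‖ := by positivity
    have h8 : δ * (δ - 1) ≤ 0 := mul_nonpos_of_nonneg_of_nonpos hδ0.le (by linarith)
    linarith
  have hAz : A * z * (δ * (δ - 1) - (N - 1) * δ * d / ‖x‖) ≤ 0 :=
    mul_nonpos_of_nonneg_of_nonpos (by positivity) hneg
  constructor
  · rw [s2, herr]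
    have : FF α δ A Q d = w + h := rfl
    rw [this]
    have h5 : w ^ (p - 1) * (w + h) ≤ (w + h) ^ p := by
      rw [hsplit (w + h) (by positivity)]
      exact mul_le_mul_of_nonneg_right
        (Real.rpow_le_rpow hw0.le (by linarith) hp1.le) (by positivity)
    have h6 := hsplit w hw0
    linarith
  · rw [t2, herr]
    have : FF α δ (-A) Q d = w - h := by
      simp only [FF, hw, hh]; ring
    rw [this]
    intro hpos
    have h5 : (w - h) ^ p ≤ w ^ (p - 1) * (w - h) := by
      rw [hsplit (w - h) hpos]
      exact mul_le_mul_of_nonneg_right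
        (Real.rpow_le_rpow hpos.le (by linarith) hp1.le) hpos.le
    have h6 := hsplit w hw0
    linarith

lemma isOpen_shell {N : ℕ} (a b : ℝ) :
    IsOpen {x : EuclideanSpace ℝ (Fin N) | a < ‖x‖ ∧ ‖x‖ < b} :=
  (isOpen_lt continuous_const continuous_norm).inter (isOpen_lt continuous_norm continuous_const)

lemma isBounded_shell {N : ℕ} (a b : ℝ) :
    Bornology.IsBounded {x : EuclideanSpace ℝ (Fin N) | a < ‖x‖ ∧ ‖x‖ < b} :=
  (isBounded_ball (x := (0 : EuclideanSpace ℝ (Fin N))) (r := b)).subset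
    (fun x hx => by simpa using hx.2)

lemma shell_bd {N : ℕ} {a b : ℝ} {y : EuclideanSpace ℝ (Fin N)}
    (hy : y ∈ closure {x : EuclideanSpace ℝ (Fin N) | a < ‖x‖ ∧ ‖x‖ < b})
    (hy' : y ∉ {x : EuclideanSpace ℝ (Fin N) | a < ‖x‖ ∧ ‖x‖ < b}) :
    a ≤ ‖y‖ ∧ ‖y‖ ≤ b ∧ (‖y‖ = a ∨ ‖y‖ = b) := by
  have hcl : IsClosed {x : EuclideanSpace ℝ (Fin N) | a ≤ ‖x‖ ∧ ‖x‖ ≤ b} :=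
    (isClosed_le continuous_const continuous_norm).inter
      (isClosed_le continuous_norm continuous_const)
  have hsub : {x : EuclideanSpace ℝ (Fin N) | a < ‖x‖ ∧ ‖x‖ < b} ⊆
      {x : EuclideanSpace ℝ (Fin N) | a ≤ ‖x‖ ∧ ‖x‖ ≤ b} := fun x hx => ⟨hx.1.le, hx.2.le⟩
  have h := closure_minimal hsub hcl hy
  refine ⟨h.1, h.2, ?_⟩
  by_contra hne
  push Not at hne
  exact hy' ⟨lt_of_le_of_ne h.1 (Ne.symm hne.1), lt_of_le_of_ne h.2 hne.2⟩

open Polynomial in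
lemma FF_atTop {α δ A : ℝ} (hα : 0 < α) (hδ : 0 < δ) (Q : ℝ[X]) (hQ : 0 < Q.eval 0) :
    Tendsto (FF α δ A Q) (𝓝[>] 0) atTop := by
  have h1 : Tendsto (fun d : ℝ => d ^ (-α)) (𝓝[>] 0) atTop := tendsto_rpow_neg_nhdsGT_zero (neg_lt_zero.mpr hα)
  have h2 : Tendsto (fun d : ℝ => Q.eval d) (𝓝[>] 0) (𝓝 (Q.eval 0)) :=
    (analyticAt_eval Q 0).continuousAt.tendsto.mono_left nhdsWithin_le_nhds
  have h3 : Tendsto (fun d : ℝ => A * d ^ δ) (𝓝[>] 0) (𝓝 (A * 0 ^ δ)) :=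
    (((Real.continuousAt_rpow_const 0 δ (Or.inr hδ.le)).tendsto).const_mul A).mono_left
      nhdsWithin_le_nhds
  exact (h1.atTop_mul_pos hQ h2).atTop_add h3

theorem statement12 {N : ℕ} (hN : 1 ≤ N) (p : ℝ) (hp : 1 < p)
    (hpnotnat : ∀ n : ℕ, (2 : ℝ) / (p - 1) ≠ n) :
    -- the coefficients a_k depend only on N and p
    ∃ a : ℕ → ℝ, ∀ u : EuclideanSpace ℝ (Fin N) → ℝ,
      -- u is a positive boundary blow-up solution of Δu = u^p in B
      (∀ x ∈ ball (0 : EuclideanSpace ℝ (Fin N)) 1, 0 < u x) →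
      IsBlowUp (fun t => t ^ p) u →
      -- u is radial
      (∀ x ∈ ball (0 : EuclideanSpace ℝ (Fin N)) 1,
        ∀ y ∈ ball (0 : EuclideanSpace ℝ (Fin N)) 1, ‖x‖ = ‖y‖ → u x = u y) ∧
      -- u = d^{−2/(p−1)} Σ_{k=0}^{⌊2/(p−1)⌋} a_k d^k + o(1) as r → 1⁻, d = 1 − r = 1 − |x|
      Tendsto (fun x : EuclideanSpace ℝ (Fin N) =>
          u x - (1 - ‖x‖) ^ (-(2 / (p - 1))) *
            ∑ k ∈ Finset.range (⌊(2 : ℝ) / (p - 1)⌋₊ + 1), a k * (1 - ‖x‖) ^ k)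
        (comap (fun x : EuclideanSpace ℝ (Fin N) => ‖x‖) (𝓝[<] (1 : ℝ)) ⊓
          𝓟 (ball (0 : EuclideanSpace ℝ (Fin N)) 1)) (𝓝 0) := by
  set α : ℝ := 2 / (p - 1) with hαd
  have hp1 : 0 < p - 1 := by linarith
  have hα : 0 < α := by rw [hαd]; positivity
  set m : ℕ := ⌊α⌋₊ with hm
  have hmle : (m : ℝ) ≤ α := Nat.floor_le hα.le
  have hmlt : (m : ℝ) < α := lt_of_le_of_ne hmle (hpnotnat m).symm
  have hmlt2 : α < m + 1 := Nat.lt_floor_add_one α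
  obtain ⟨δ, hδ⟩ : ∃ δ : ℝ, δ = m + 1 - α := ⟨_, rfl⟩
  have hδ0 : 0 < δ := by linarith
  have hδ1 : δ < 1 := by linarith
  obtain ⟨Q, hdeg, hQ0, d0, hd0, hd01, A0, hA0, hbar⟩ :=
    barrier hN hp hαd hmle hδ hδ0 hδ1
  refine ⟨fun k => Q.coeff k, ?_⟩
  intro u hpos hu
  refine ⟨sol_radial hp hpos hu, ?_⟩
  have hsum : ∀ d : ℝ, ∑ k ∈ Finset.range (m + 1), Q.coeff k * d ^ k = Q.eval d := by
    intro d
    rw [Polynomial.eval_eq_sum_range' (Nat.lt_succ_of_le hdeg)]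
  simp only [hsum]
  have hcu : ContinuousOn u (ball 0 1) := hu.1.continuousOn
  obtain ⟨M, hM⟩ : ∃ M : ℝ, ∀ x ∈ closedBall (0 : EuclideanSpace ℝ (Fin N)) (1 - d0), u x ≤ M := by
    have := (isCompact_closedBall (0 : EuclideanSpace ℝ (Fin N)) (1 - d0)).bddAbove_image
      (hcu.mono (closedBall_subset_ball (by linarith)))
    obtain ⟨M, hM⟩ := this
    exact ⟨M, fun x hx => hM ⟨x, hx, rfl⟩⟩
  have hd0δ : 0 < d0 ^ δ := Real.rpow_pos_of_pos hd0 _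
  set w0 : ℝ := d0 ^ (-α) * Q.eval d0 with hw0
  set A : ℝ := A0 + (|M| + 1 + |w0|) / d0 ^ δ with hA
  have hAA0 : A0 ≤ A := by
    rw [hA]; have : 0 ≤ (|M| + 1 + |w0|) / d0 ^ δ := by positivity
    linarith
  have hAd : |M| + 1 + |w0| ≤ A * d0 ^ δ := by
    rw [hA, add_mul, div_mul_cancel₀ _ hd0δ.ne']
    have : 0 ≤ A0 * d0 ^ δ := by positivity
    linarith
  have hb := hbar A hAA0
  have hApos : 0 ≤ A := hA0.trans hAA0
  -- upper bound
  have hup : ∀ x : EuclideanSpace ℝ (Fin N), 1 - d0 < ‖x‖ → ‖x‖ < 1 →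
      u x ≤ FF α δ A Q (1 - ‖x‖) := by
    intro x hx1 hx2
    have hxb : x ∈ ball (0 : EuclideanSpace ℝ (Fin N)) 1 := by simpa using hx2
    have h1 := (scaled_tendsto hu hxb).mono_left (nhdsWithin_le_nhds (s := Iio 1))
    refine le_of_tendsto h1 ?_
    filter_upwards [Ioo_mem_nhdsLT (show (0 : ℝ) < 1 by norm_num)] with l hl
    have hin : ∀ y : EuclideanSpace ℝ (Fin N), ‖y‖ ≤ 1 → l * ‖y‖ < 1 := by
      intro y hy
      nlinarith [norm_nonneg y, hl.1, hl.2]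
    refine comparison (f := fun y : EuclideanSpace ℝ (Fin N) => FF α δ A Q (1 - ‖y‖))
      (g := fun y => l ^ (2 / (p - 1)) * u (l • y)) (isOpen_shell (1 - d0) 1)
      (isBounded_shell (1 - d0) 1) ?_ ?_ ?_ ?_ x ⟨hx1, hx2⟩
    · intro y hy
      exact (hb y (by linarith [hy.2]) (by linarith [hy.1])).2.1.contDiffWithinAt
    · intro y hy
      exact (scaled_sol hp hpos hu hl.1 (hin y hy.2.le)).2.1.contDiffWithinAt
    · intro y hy hy'
      obtain ⟨ha, hb1, hor⟩ := shell_bd hy hy'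
      have hcl := (scaled_sol hp hpos hu hl.1 (hin y hb1)).2.1.continuousAt
      rcases hor with h | h
      · have hyd : 1 - ‖y‖ = d0 := by rw [h]; ring
        have hcF := (hb y (by linarith) (by linarith)).2.1.continuousAt
        have hlt : l ^ (2 / (p - 1)) * u (l • y) < FF α δ A Q (1 - ‖y‖) := by
          have hmem : l • y ∈ closedBall (0 : EuclideanSpace ℝ (Fin N)) (1 - d0) := by
            simp only [mem_closedBall, dist_zero_right, norm_smul, Real.norm_eq_abs,
              abs_of_pos hl.1, h]
            nlinarith [hl.1, hl.2]
          have hmem1 := closedBall_subset_ball (show 1 - d0 < 1 by linarith) hmem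
          have e1 := hM _ hmem
          have e2 : l ^ (2 / (p - 1)) ≤ 1 := Real.rpow_le_one hl.1.le hl.2.le (by positivity)
          have e3 : l ^ (2 / (p - 1)) * u (l • y) ≤ 1 * u (l • y) :=
            mul_le_mul_of_nonneg_right e2 (hpos _ hmem1).le
          have e4 : FF α δ A Q (1 - ‖y‖) = w0 + A * d0 ^ δ := by rw [hyd, FF]
          rw [e4]
          linarith [le_abs_self M, neg_abs_le w0]
        exact nhdsWithin_le_nhds ((hcl.eventually_lt hcF hlt).mono fun z hz => hz.le)
      · have ht : Tendsto (fun z : EuclideanSpace ℝ (Fin N) => 1 - ‖z‖)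
            (𝓝[{x | 1 - d0 < ‖x‖ ∧ ‖x‖ < 1}] y) (𝓝[>] 0) := by
          refine tendsto_nhdsWithin_of_tendsto_nhds_of_eventually_within _ ?_ ?_
          · have : Continuous (fun z : EuclideanSpace ℝ (Fin N) => 1 - ‖z‖) := by fun_prop
            have h2 := this.tendsto y
            rw [h, sub_self] at h2
            exact h2.mono_left nhdsWithin_le_nhds
          · filter_upwards [self_mem_nhdsWithin] with z hz
            have := hz.2
            simp only [mem_Ioi]; linarith
        have h3 := (FF_atTop (A := A) hα hδ0 Q hQ0).comp ht
        have h4 := hcl.eventually (gt_mem_nhds (lt_add_one _))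
        filter_upwards [h3.eventually_ge_atTop _, nhdsWithin_le_nhds h4] with z a b
        exact b.le.trans a
    · intro y hy hlt
      obtain ⟨q1, q2, q3, q4, q5⟩ := hb y (by linarith [hy.2]) (by linarith [hy.1])
      have hs := scaled_sol hp hpos hu hl.1 (hin y hy.2.le)
      rw [hs.2.2]
      refine q4.trans_le (Real.rpow_le_rpow ?_ hlt.le (by linarith))
      have hd : 0 < 1 - ‖y‖ := by linarith [hy.2]
      unfold FF
      positivity
  -- lower bound
  have hlow : ∀ x : EuclideanSpace ℝ (Fin N), 1 - d0 < ‖x‖ → ‖x‖ < 1 →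
      FF α δ (-A) Q (1 - ‖x‖) ≤ u x := by
    intro x hx1 hx2
    have hxb : x ∈ ball (0 : EuclideanSpace ℝ (Fin N)) 1 := by simpa using hx2
    have hx0 : 0 < ‖x‖ := by linarith
    have h1 := (scaled_tendsto hu hxb).mono_left (nhdsWithin_le_nhds (s := Ioi 1))
    refine ge_of_tendsto h1 ?_
    filter_upwards [Ioo_mem_nhdsGT ((one_lt_inv₀ hx0).mpr hx2)] with l hl
    have hl0 : 0 < l := by linarith [hl.1]
    have hli : l⁻¹ < 1 := inv_lt_one_of_one_lt₀ hl.1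
    have hin : ∀ y : EuclideanSpace ℝ (Fin N), ‖y‖ < l⁻¹ → l * ‖y‖ < 1 := by
      intro y hy
      have := mul_lt_mul_of_pos_left hy hl0
      rwa [mul_inv_cancel₀ hl0.ne'] at this
    have hxl : ‖x‖ < l⁻¹ := by
      rw [lt_inv_comm₀ hx0 hl0]; exact hl.2
    refine comparison (g := fun y : EuclideanSpace ℝ (Fin N) => FF α δ (-A) Q (1 - ‖y‖))
      (f := fun y => l ^ (2 / (p - 1)) * u (l • y)) (isOpen_shell (1 - d0) l⁻¹)
      (isBounded_shell (1 - d0) l⁻¹) ?_ ?_ ?_ ?_ x ⟨hx1, hxl⟩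
    · intro y hy
      exact (scaled_sol hp hpos hu hl0 (hin y hy.2)).2.1.contDiffWithinAt
    · intro y hy
      exact (hb y (by linarith [hy.2]) (by linarith [hy.1])).2.2.1.contDiffWithinAt
    · intro y hy hy'
      obtain ⟨ha, hb1, hor⟩ := shell_bd hy hy'
      have hcF := (hb y (by linarith) (by linarith)).2.2.1.continuousAt
      rcases hor with h | h
      · have hyd : 1 - ‖y‖ = d0 := by rw [h]; ring
        have hlt : FF α δ (-A) Q (1 - ‖y‖) < 0 := by
          have e4 : FF α δ (-A) Q (1 - ‖y‖) = w0 - A * d0 ^ δ := by rw [hyd, FF]; ring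
          rw [e4]
          linarith [le_abs_self w0, abs_nonneg M]
        filter_upwards [nhdsWithin_le_nhds (hcF.eventually (gt_mem_nhds hlt)),
          self_mem_nhdsWithin] with z a b
        exact a.le.trans (scaled_sol hp hpos hu hl0 (hin z b.2)).1.le
      · have hly : ‖l • y‖ = 1 := by
          rw [norm_smul, Real.norm_eq_abs, abs_of_pos hl0, h, mul_inv_cancel₀ hl0.ne']
        have ht : Tendsto (fun z : EuclideanSpace ℝ (Fin N) => l • z)
            (𝓝[{x | 1 - d0 < ‖x‖ ∧ ‖x‖ < l⁻¹}] y) (𝓝[ball 0 1] (l • y)) := by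
          refine tendsto_nhdsWithin_of_tendsto_nhds_of_eventually_within _ ?_ ?_
          · have : Continuous (fun z : EuclideanSpace ℝ (Fin N) => l • z) := by fun_prop
            exact (this.tendsto y).mono_left nhdsWithin_le_nhds
          · filter_upwards [self_mem_nhdsWithin] with z hz
            have := hin z hz.2
            simpa [norm_smul, abs_of_pos hl0] using this
        have h3 := ((hu.2.2 _ hly).comp ht).const_mul_atTop
          (Real.rpow_pos_of_pos hl0 (2 / (p - 1)))
        have h4 := hcF.eventually (gt_mem_nhds (lt_add_one _))
        filter_upwards [h3.eventually_ge_atTop _, nhdsWithin_le_nhds h4] with z a b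
        exact b.le.trans a
    · intro y hy hlt
      obtain ⟨q1, q2, q3, q4, q5⟩ := hb y (by linarith [hy.2]) (by linarith [hy.1])
      have hs := scaled_sol hp hpos hu hl0 (hin y hy.2)
      rw [hs.2.2]
      exact (Real.rpow_le_rpow hs.1.le hlt.le (by linarith)).trans_lt (q5 (hs.1.trans hlt))
  -- conclusion
  have hn : Tendsto (fun x : EuclideanSpace ℝ (Fin N) => ‖x‖)
      (comap (fun x : EuclideanSpace ℝ (Fin N) => ‖x‖) (𝓝[<] (1 : ℝ)) ⊓
          𝓟 (ball (0 : EuclideanSpace ℝ (Fin N)) 1)) (𝓝[<] 1) :=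
    tendsto_comap.mono_left inf_le_left
  have hlim : Tendsto (fun r : ℝ => A * (1 - r) ^ δ) (𝓝[<] 1) (𝓝 0) := by
    have h1 : Tendsto (fun r : ℝ => 1 - r) (𝓝[<] 1) (𝓝 0) := by
      have : Continuous (fun r : ℝ => 1 - r) := by fun_prop
      have h2 := this.tendsto 1
      rw [sub_self] at h2
      exact h2.mono_left nhdsWithin_le_nhds
    have h3 := (((Real.continuousAt_rpow_const 0 δ (Or.inr hδ0.le)).tendsto).comp h1).const_mul A
    simpa [Real.zero_rpow hδ0.ne'] using h3
  refine squeeze_zero_norm' ?_ (hlim.comp hn)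
  filter_upwards [hn.eventually (Ioo_mem_nhdsLT (show 1 - d0 < 1 by linarith))] with x hx
  have a1 := hup x hx.1 hx.2
  have a2 := hlow x hx.1 hx.2
  unfold FF at a1 a2
  simp only [Function.comp, Real.norm_eq_abs]
  rw [abs_le]
  constructor <;> linarith
end

section
/- Let N ≥ 1, let B be the open unit ball of ℝ^N, and let f ∈ C(ℝ) satisfy conditions (2) and (3). Let v̲ be continuous on the closure of B and satisfy Δv̲ ≥ f(v̲) in B (in the distributional or classical sense for v̲ ∈ C²(B)). Then there exists a radially symmetric boundary blow-up solution V of ΔV = f(V) in B with V ≥ v̲ throughout B. -/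
open MeasureTheory Filter Metric Set Topology

noncomputable def Phi (N : ℕ) (h : ℝ → ℝ) (s : ℝ) : ℝ :=
  ∫ τ in (0:ℝ)..1, τ ^ (N - 1) * h (s * τ)

noncomputable def AA (N : ℕ) (h : ℝ → ℝ) (r : ℝ) : ℝ :=
  ∫ s in (0:ℝ)..r, s * Phi N h s

lemma Phi_cont_param {X : Type*} [TopologicalSpace X] (N : ℕ) (h : X → ℝ → ℝ)
    (hh : Continuous (Function.uncurry h)) :
    Continuous (fun p : X × ℝ => Phi N (h p.1) p.2) := by
  unfold Phi
  apply intervalIntegral.continuous_parametric_intervalIntegral_of_continuous'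
  have : Continuous (fun q : (X × ℝ) × ℝ => q.2 ^ (N-1) * (Function.uncurry h) (q.1.1, q.1.2 * q.2)) := by
    fun_prop
  exact this

lemma AA_cont_param {X : Type*} [TopologicalSpace X] (N : ℕ) (h : X → ℝ → ℝ)
    (hh : Continuous (Function.uncurry h)) (s : X → ℝ) (hs : Continuous s) :
    Continuous (fun p : X => AA N (h p) (s p)) := by
  unfold AA
  apply intervalIntegral.continuous_parametric_intervalIntegral_of_continuous _ hs
  have := Phi_cont_param N h hh
  exact continuous_snd.mul this

lemma Phi_cont (N : ℕ) (h : ℝ → ℝ) (hh : Continuous h) : Continuous (Phi N h) := by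
  have := Phi_cont_param N (fun _ : Unit => h) (hh.comp continuous_snd)
  exact this.comp (by fun_prop : Continuous fun r : ℝ => ((), r))

lemma AA_hasDeriv (N : ℕ) (h : ℝ → ℝ) (hh : Continuous h) (r : ℝ) :
    HasDerivAt (AA N h) (r * Phi N h r) r := by
  have hc : Continuous fun s => s * Phi N h s := continuous_id.mul (Phi_cont N h hh)
  exact intervalIntegral.integral_hasDerivAt_right (hc.intervalIntegrable _ _)
    hc.aestronglyMeasurable.stronglyMeasurableAtFilter hc.continuousAt

lemma Phi_congr (N : ℕ) {h k : ℝ → ℝ} {s : ℝ} (hs : 0 ≤ s)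
    (e : ∀ σ ∈ Icc 0 s, h σ = k σ) : Phi N h s = Phi N k s := by
  unfold Phi
  apply intervalIntegral.integral_congr
  intro τ hτ
  rw [uIcc_of_le zero_le_one] at hτ
  simp only
  rw [e (s * τ) ⟨mul_nonneg hs hτ.1, mul_le_of_le_one_right hs hτ.2⟩]

lemma AA_congr (N : ℕ) {h k : ℝ → ℝ} {s : ℝ} (hs : 0 ≤ s)
    (e : ∀ σ ∈ Icc 0 s, h σ = k σ) : AA N h s = AA N k s := by
  unfold AA
  apply intervalIntegral.integral_congr
  intro τ hτ
  rw [uIcc_of_le hs] at hτ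
  simp only
  rw [Phi_congr N hτ.1 (fun σ hσ => e σ ⟨hσ.1, hσ.2.trans hτ.2⟩)]

lemma pow_Phi (N : ℕ) (hN : 1 ≤ N) (h : ℝ → ℝ) (s : ℝ) :
    s ^ N * Phi N h s = ∫ σ in (0:ℝ)..s, σ ^ (N - 1) * h σ := by
  obtain ⟨n, rfl⟩ : ∃ n, N = n + 1 := ⟨N - 1, by omega⟩
  have := intervalIntegral.smul_integral_comp_mul_left (a := 0) (b := 1)
    (fun σ => σ ^ n * h σ) s
  simp only [mul_zero, mul_one, smul_eq_mul] at this
  simp only [Nat.add_sub_cancel]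
  rw [← this]
  unfold Phi
  simp only [Nat.add_sub_cancel]
  rw [pow_succ', mul_assoc, ← intervalIntegral.integral_const_mul (s ^ n)]
  congr 2
  ext τ
  ring

lemma pow_Phi_hasDeriv (N : ℕ) (hN : 1 ≤ N) (h : ℝ → ℝ) (hh : Continuous h) (r : ℝ) :
    HasDerivAt (fun s => s ^ N * Phi N h s) (r ^ (N - 1) * h r) r := by
  have hc : Continuous fun s : ℝ => s ^ (N - 1) * h s := by fun_prop
  have e : (fun s => s ^ N * Phi N h s) = fun s => ∫ σ in (0:ℝ)..s, σ ^ (N - 1) * h σ := by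
    ext s; exact pow_Phi N hN h s
  rw [e]
  exact intervalIntegral.integral_hasDerivAt_right (hc.intervalIntegrable _ _)
    hc.aestronglyMeasurable.stronglyMeasurableAtFilter hc.continuousAt

lemma Phi_zero (N : ℕ) (hN : 1 ≤ N) (h : ℝ → ℝ) : N * Phi N h 0 = h 0 := by
  obtain ⟨n, rfl⟩ : ∃ n, N = n + 1 := ⟨N - 1, by omega⟩
  unfold Phi
  simp only [zero_mul, Nat.add_sub_cancel]
  rw [intervalIntegral.integral_mul_const, integral_pow]
  have : (n : ℝ) + 1 ≠ 0 := by positivity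
  simp
  field_simp

lemma Phi_bound (N : ℕ) {h : ℝ → ℝ} {s C : ℝ} (hs : 0 ≤ s)
    (e : ∀ σ ∈ Icc 0 s, |h σ| ≤ C) : |Phi N h s| ≤ C := by
  unfold Phi
  have := intervalIntegral.norm_integral_le_of_norm_le_const (a := 0) (b := 1) (C := C)
    (f := fun τ => τ ^ (N - 1) * h (s * τ)) (fun τ hτ => by
      rw [uIoc_of_le zero_le_one] at hτ
      have h1 := e (s * τ) ⟨mul_nonneg hs hτ.1.le, mul_le_of_le_one_right hs hτ.2⟩
      rw [Real.norm_eq_abs, abs_mul, abs_of_nonneg (pow_nonneg hτ.1.le _)]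
      calc τ ^ (N - 1) * |h (s * τ)| ≤ 1 * |h (s * τ)| := by
            gcongr
            exact pow_le_one₀ hτ.1.le hτ.2
        _ ≤ C := by linarith)
  simpa using this

lemma AA_lip (N : ℕ) {h : ℝ → ℝ} (hh : Continuous h) {ρ C r s : ℝ}
    (e : ∀ σ ∈ Icc 0 ρ, |h σ| ≤ C) (hr : r ∈ Icc 0 ρ) (hs : s ∈ Icc 0 ρ) :
    |AA N h r - AA N h s| ≤ ρ * C * |r - s| := by
  have hc : Continuous fun s => s * Phi N h s := continuous_id.mul (Phi_cont N h hh)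
  have e1 : AA N h r - AA N h s = ∫ t in s..r, t * Phi N h t := by
    unfold AA
    rw [intervalIntegral.integral_interval_sub_left (hc.intervalIntegrable _ _)
      (hc.intervalIntegrable _ _)]
  rw [e1, ← Real.norm_eq_abs]
  apply intervalIntegral.norm_integral_le_of_norm_le_const
  intro t ht
  have ht' : t ∈ Icc 0 ρ := by
    have := uIoc_subset_uIcc ht
    exact (uIcc_subset_Icc hs hr) this
  rw [Real.norm_eq_abs, abs_mul, abs_of_nonneg ht'.1]
  have := Phi_bound N ht'.1 (fun σ hσ => e σ ⟨hσ.1, hσ.2.trans ht'.2⟩)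
  have h0 := abs_nonneg (Phi N h t)
  exact mul_le_mul ht'.2 this h0 (ht'.1.trans ht'.2)

structure Sol (N : ℕ) (R : ℝ) (u φ h : ℝ → ℝ) : Prop where
  hc : ContinuousOn h (Ico 0 R)
  φc : ContinuousOn φ (Ico 0 R)
  uc : ContinuousOn u (Ico 0 R)
  du : ∀ r ∈ Ico 0 R, HasDerivWithinAt u (r * φ r) (Ici 0) r
  dφ : ∀ r ∈ Ioo 0 R, HasDerivAt (fun s => s ^ N * φ s) (r ^ (N - 1) * h r) r
  φ0 : N * φ 0 = h 0

lemma sol_of_AA (N : ℕ) (hN : 1 ≤ N) {R α : ℝ} {u h : ℝ → ℝ} (hR : 0 < R)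
    (hh : ContinuousOn h (Ico 0 R))
    (hu : ∀ r ∈ Ico 0 R, u r = α + AA N h r) : Sol N R u (Phi N h) h := by
  have key : ∀ r ∈ Ico 0 R, ContinuousWithinAt (Phi N h) (Ico 0 R) r ∧
      HasDerivWithinAt u (r * Phi N h r) (Ici 0) r ∧
      (0 < r → HasDerivAt (fun s => s ^ N * Phi N h s) (r ^ (N - 1) * h r) r) := by
    intro r hr
    set ρ := (r + R) / 2 with hρ
    have h1 : r < ρ := by rw [hρ]; linarith [hr.2]
    have h2 : ρ < R := by rw [hρ]; linarith [hr.2]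
    have h0 : 0 ≤ ρ := hr.1.trans h1.le
    set k : ℝ → ℝ := fun s => h (max 0 (min s ρ)) with hk
    have kc : Continuous k := by
      apply hh.comp_continuous (by fun_prop)
      intro x
      exact ⟨le_max_left _ _, max_lt hR ((min_le_right _ _).trans_lt h2)⟩
    have ek : ∀ s ∈ Icc 0 ρ, h s = k s := by
      intro s hs
      simp only [hk]
      rw [min_eq_left hs.2, max_eq_right hs.1]
    have eP : ∀ s ∈ Icc 0 ρ, Phi N h s = Phi N k s := fun s hs =>
      Phi_congr N hs.1 (fun σ hσ => ek σ ⟨hσ.1, hσ.2.trans hs.2⟩)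
    have eA : ∀ s ∈ Icc 0 ρ, AA N h s = AA N k s := fun s hs =>
      AA_congr N hs.1 (fun σ hσ => ek σ ⟨hσ.1, hσ.2.trans hs.2⟩)
    have hrI : r ∈ Icc 0 ρ := ⟨hr.1, h1.le⟩
    have hnh : Icc 0 ρ ∈ 𝓝[Ici 0] r := by
      have : Iic ρ ∈ 𝓝 r := Iic_mem_nhds h1
      exact mem_nhdsWithin_iff_exists_mem_nhds_inter.2 ⟨_, this, fun x hx => ⟨hx.2, hx.1⟩⟩
    refine ⟨?_, ?_, ?_⟩
    · have c1 : ContinuousWithinAt (Phi N k) (Ici 0) r := (Phi_cont N k kc).continuousWithinAt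
      have c2 : ContinuousWithinAt (Phi N h) (Ici 0) r := by
        refine c1.congr_of_eventuallyEq ?_ (eP r hrI)
        filter_upwards [hnh] with s hs using eP s hs
      exact c2.mono (fun x hx => hx.1)
    · have d1 : HasDerivWithinAt (fun s => α + AA N k s) (r * Phi N k r) (Ici 0) r :=
        ((AA_hasDeriv N k kc r).const_add α).hasDerivWithinAt
      rw [eP r hrI]
      refine d1.congr_of_eventuallyEq ?_ ?_
      · filter_upwards [hnh] with s hs
        rw [hu s ⟨hs.1, hs.2.trans_lt h2⟩, eA s hs]
      · rw [hu r hr, eA r hrI]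
    · intro hr0
      have d1 := pow_Phi_hasDeriv N hN k kc r
      rw [ek r hrI]
      refine d1.congr_of_eventuallyEq ?_
      filter_upwards [Icc_mem_nhds hr0 h1] with s hs
      rw [eP s hs]
  exact ⟨hh, fun r hr => (key r hr).1,
    fun r hr => (key r hr).2.1.continuousWithinAt.mono (fun x hx => hx.1),
    fun r hr => (key r hr).2.1, fun r hr => (key r ⟨hr.1.le, hr.2⟩).2.2 hr.1, Phi_zero N hN h⟩


lemma Phi_tendsto (N : ℕ) (h : ℕ → ℝ → ℝ) (k : ℝ → ℝ) (hh : ∀ j, Continuous (h j)) {s L : ℝ}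
    (hs : 0 ≤ s) (hb : ∀ᶠ j in atTop, ∀ r ∈ Icc 0 s, |h j r| ≤ L)
    (hk : ∀ r ∈ Icc 0 s, Tendsto (fun j => h j r) atTop (𝓝 (k r))) :
    Tendsto (fun j => Phi N (h j) s) atTop (𝓝 (Phi N k s)) := by
  unfold Phi
  have hm : ∀ τ : ℝ, τ ∈ uIoc (0:ℝ) 1 → s * τ ∈ Icc 0 s := by
    intro τ hτ
    rw [uIoc_of_le zero_le_one] at hτ
    exact ⟨mul_nonneg hs hτ.1.le, mul_le_of_le_one_right hs hτ.2⟩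
  apply intervalIntegral.tendsto_integral_filter_of_dominated_convergence (fun _ => L)
  · refine Eventually.of_forall fun j => ?_
    have : Continuous fun τ : ℝ => τ ^ (N - 1) * h j (s * τ) := by
      have := hh j
      fun_prop
    exact this.aestronglyMeasurable
  · filter_upwards [hb] with j hj
    refine Eventually.of_forall fun τ hτ => ?_
    have h1 := hj _ (hm τ hτ)
    rw [uIoc_of_le zero_le_one] at hτ
    rw [Real.norm_eq_abs, abs_mul, abs_of_nonneg (pow_nonneg hτ.1.le _)]
    calc τ ^ (N - 1) * |h j (s * τ)| ≤ 1 * |h j (s * τ)| := by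
          gcongr
          exact pow_le_one₀ hτ.1.le hτ.2
      _ ≤ L := by linarith
  · exact intervalIntegrable_const
  · exact Eventually.of_forall fun τ hτ => (hk _ (hm τ hτ)).const_mul _

lemma AA_tendsto (N : ℕ) (h : ℕ → ℝ → ℝ) (k : ℝ → ℝ) (hh : ∀ j, Continuous (h j)) {s L : ℝ}
    (hs : 0 ≤ s) (hb : ∀ᶠ j in atTop, ∀ r ∈ Icc 0 s, |h j r| ≤ L)
    (hk : ∀ r ∈ Icc 0 s, Tendsto (fun j => h j r) atTop (𝓝 (k r))) :
    Tendsto (fun j => AA N (h j) s) atTop (𝓝 (AA N k s)) := by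
  unfold AA
  apply intervalIntegral.tendsto_integral_filter_of_dominated_convergence (fun _ => s * L)
  · refine Eventually.of_forall fun j => ?_
    exact (continuous_id.mul (Phi_cont N (h j) (hh j))).aestronglyMeasurable
  · filter_upwards [hb] with j hj
    refine Eventually.of_forall fun τ hτ => ?_
    rw [uIoc_of_le hs] at hτ
    have := Phi_bound N hτ.1.le (fun σ hσ => hj σ ⟨hσ.1, hσ.2.trans hτ.2⟩)
    rw [Real.norm_eq_abs, abs_mul, abs_of_nonneg hτ.1.le]
    exact mul_le_mul hτ.2 this (abs_nonneg _) hs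
  · exact intervalIntegrable_const
  · refine Eventually.of_forall fun τ hτ => ?_
    rw [uIoc_of_le hs] at hτ
    refine (Phi_tendsto (L := L) N h k hh hτ.1.le ?_
      (fun r hr => hk r ⟨hr.1, hr.2.trans hτ.2⟩)).const_mul _
    · filter_upwards [hb] with j hj using fun r hr => hj r ⟨hr.1, hr.2.trans hτ.2⟩

lemma limit_lemma (N : ℕ) {R : ℝ} (hR : 0 < R) (u h : ℕ → ℝ → ℝ) (α : ℕ → ℝ)
    (hh : ∀ j, Continuous (h j))
    (heq : ∀ j, ∀ r ∈ Ico 0 R, u j r = α j + AA N (h j) r)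
    (hb : ∀ ρ, 0 ≤ ρ → ρ < R → ∃ L, ∀ᶠ j in atTop, ∀ r ∈ Icc 0 ρ, |u j r| ≤ L ∧ |h j r| ≤ L) :
    ∃ φ : ℕ → ℕ, StrictMono φ ∧ ∃ v : ℝ → ℝ, ContinuousOn v (Ico 0 R) ∧
      (∀ r ∈ Ico 0 R, Tendsto (fun j => u (φ j) r) atTop (𝓝 (v r))) ∧
      ∀ k : ℝ → ℝ, (∀ r ∈ Ico 0 R, Tendsto (fun j => h (φ j) r) atTop (𝓝 (k r))) →
        ∀ r ∈ Ico 0 R, v r = v 0 + AA N k r := by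
  have hlip : ∀ ρ, 0 ≤ ρ → ρ < R → ∃ L, 0 ≤ L ∧ ∀ᶠ j in atTop, ∀ r ∈ Icc 0 ρ, ∀ s ∈ Icc 0 ρ,
      |u j r - u j s| ≤ L * |r - s| := by
    intro ρ h0 h1
    obtain ⟨L, hL⟩ := hb ρ h0 h1
    have hL0 : 0 ≤ L := by
      obtain ⟨j, hj⟩ := hL.exists
      exact (abs_nonneg _).trans (hj 0 ⟨le_rfl, h0⟩).1
    refine ⟨ρ * L, mul_nonneg h0 hL0, ?_⟩
    filter_upwards [hL] with j hj r hr s hs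
    rw [heq j r ⟨hr.1, hr.2.trans_lt h1⟩, heq j s ⟨hs.1, hs.2.trans_lt h1⟩, add_sub_add_left_eq_sub]
    exact AA_lip N (hh j) (fun σ hσ => (hj σ hσ).2) hr hs
  let ι := {q : ℚ // (q : ℝ) ∈ Ico 0 R}
  have hbd : ∀ i : ι, ∃ B, ∀ j, |u j (i.1 : ℝ)| ≤ B := by
    intro i
    obtain ⟨L, hL⟩ := hb i.1 i.2.1 i.2.2
    have : IsBoundedUnder (· ≤ ·) atTop (fun j => |u j (i.1 : ℝ)|) :=
      ⟨L, by
        rw [eventually_map]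
        filter_upwards [hL] with j hj using (hj _ ⟨i.2.1, le_rfl⟩).1⟩
    obtain ⟨B, hB⟩ := this.bddAbove_range
    exact ⟨B, fun j => hB ⟨j, rfl⟩⟩
  choose B hB using hbd
  have hcomp : IsCompact (univ.pi fun i : ι => Icc (-(B i)) (B i)) :=
    isCompact_univ_pi fun i => isCompact_Icc
  obtain ⟨z, -, φ, hφ, hz⟩ := hcomp.tendsto_subseq (x := fun j => fun i : ι => u j (i.1 : ℝ))
    (fun j i _ => abs_le.1 (hB i j))
  rw [tendsto_pi_nhds] at hz
  have hcs : ∀ r ∈ Ico 0 R, ∃ y, Tendsto (fun j => u (φ j) r) atTop (𝓝 y) := by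
    intro r hr
    apply cauchySeq_tendsto_of_complete
    rw [Metric.cauchySeq_iff']
    intro ε hε
    set ρ := (r + R) / 2 with hρ
    have h1 : r < ρ := by rw [hρ]; linarith [hr.2]
    have h2 : ρ < R := by rw [hρ]; linarith [hr.2]
    obtain ⟨L, hL0, hL⟩ := hlip ρ (hr.1.trans h1.le) h2
    have hd : 0 < ε / (4 * (L + 1)) := by positivity
    obtain ⟨q, hq1, hq2⟩ := exists_rat_btwn (show r < min ρ (r + ε / (4 * (L + 1))) from
      lt_min h1 (by linarith))
    have hqρ := hq2.trans_le (min_le_left _ _)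
    have hqe := hq2.trans_le (min_le_right _ _)
    have hqI : (q : ℝ) ∈ Ico 0 R := ⟨hr.1.trans hq1.le, hqρ.trans h2⟩
    have hqc := (hz ⟨q, hqI⟩).cauchySeq
    rw [Metric.cauchySeq_iff'] at hqc
    obtain ⟨n1, hn1⟩ := hqc (ε / 4) (by positivity)
    obtain ⟨n2, hn2⟩ := eventually_atTop.1 (hφ.tendsto_atTop.eventually hL)
    refine ⟨max n1 n2, fun n hn => ?_⟩
    have a1 := hn1 n ((le_max_left _ _).trans hn)
    have a2 := hn1 (max n1 n2) (le_max_left _ _)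
    have b1 := hn2 n ((le_max_right _ _).trans hn) r ⟨hr.1, h1.le⟩ q ⟨hqI.1, hqρ.le⟩
    have b2 := hn2 (max n1 n2) (le_max_right _ _) r ⟨hr.1, h1.le⟩ q ⟨hqI.1, hqρ.le⟩
    have hLq : L * |r - q| ≤ ε / 4 := by
      rw [abs_sub_comm, abs_of_pos (by linarith)]
      calc L * (q - r) ≤ (L + 1) * (ε / (4 * (L + 1))) := by
            apply mul_le_mul <;> linarith
        _ = ε / 4 := by field_simp
    simp only [Function.comp, Real.dist_eq] at a1 a2 ⊢
    rw [abs_lt] at a1 a2 ⊢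
    have b1' := abs_le.1 (b1.trans hLq)
    have b2' := abs_le.1 (b2.trans hLq)
    constructor <;> linarith [a1.1, a1.2, a2.1, a2.2, b1'.1, b1'.2, b2'.1, b2'.2]
  choose! v hv using hcs
  refine ⟨φ, hφ, v, ?_, hv, ?_⟩
  · intro r hr
    set ρ := (r + R) / 2 with hρ
    have h1 : r < ρ := by rw [hρ]; linarith [hr.2]
    have h2 : ρ < R := by rw [hρ]; linarith [hr.2]
    obtain ⟨L, hL0, hL⟩ := hlip ρ (hr.1.trans h1.le) h2
    have hvl : ∀ s ∈ Icc 0 ρ, |v s - v r| ≤ L * |s - r| := by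
      intro s hs
      have t := ((hv s ⟨hs.1, hs.2.trans_lt h2⟩).sub (hv r hr)).abs
      refine le_of_tendsto t ?_
      filter_upwards [hφ.tendsto_atTop.eventually hL] with j hj using hj s hs r ⟨hr.1, h1.le⟩
    have t0 : Tendsto (fun s => L * |s - r|) (𝓝[Ico 0 R] r) (𝓝 0) := by
      have : Continuous fun s : ℝ => L * |s - r| := by fun_prop
      have := (this.tendsto r).mono_left (nhdsWithin_le_nhds (s := Ico 0 R))
      simpa using this
    refine tendsto_iff_dist_tendsto_zero.2 (squeeze_zero' (Eventually.of_forall fun _ => dist_nonneg) ?_ t0)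
    have : Iio ρ ∈ 𝓝[Ico 0 R] r := mem_nhdsWithin_of_mem_nhds (Iio_mem_nhds h1)
    filter_upwards [this, self_mem_nhdsWithin] with s hs hs'
    exact hvl s ⟨hs'.1, hs.le⟩
  · intro k hk r hr
    obtain ⟨L, hL⟩ := hb r hr.1 hr.2
    have t1 : Tendsto (fun j => AA N (h (φ j)) r) atTop (𝓝 (AA N k r)) := by
      refine AA_tendsto N (fun j => h (φ j)) k (fun j => hh _) hr.1 (L := L) ?_
        (fun s hs => hk s ⟨hs.1, hs.2.trans_lt hr.2⟩)
      filter_upwards [hφ.tendsto_atTop.eventually hL] with j hj s hs using (hj s hs).2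
    have t2 := (hv 0 ⟨le_rfl, hR⟩).add t1
    refine tendsto_nhds_unique (hv r hr) (t2.congr fun j => ?_)
    rw [heq _ r hr, heq _ 0 ⟨le_rfl, hR⟩]
    simp [AA]


noncomputable def Ton (N : ℕ) (g : ℝ → ℝ → ℝ) (δ α : ℝ) : ℕ → ℝ → ℝ
  | 0, _ => α
  | k + 1, r => α + AA N (fun σ => g σ (Ton N g δ α k (σ - δ))) (max r 0)

lemma Ton_cont (N : ℕ) (g : ℝ → ℝ → ℝ) (hg : Continuous (Function.uncurry g)) (δ : ℝ) (k : ℕ) :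
    Continuous fun p : ℝ × ℝ => Ton N g δ p.1 k p.2 := by
  induction k with
  | zero => simp only [Ton]; exact continuous_fst
  | succ k ih =>
    simp only [Ton]
    refine continuous_fst.add ?_
    refine AA_cont_param N (fun (p : ℝ × ℝ) σ => g σ (Ton N g δ p.1 k (σ - δ))) ?_
      (fun p => max p.2 0) (by fun_prop)
    have h1 : Continuous fun q : (ℝ × ℝ) × ℝ => Ton N g δ q.1.1 k (q.2 - δ) :=
      ih.comp (by fun_prop : Continuous fun q : (ℝ × ℝ) × ℝ => (q.1.1, q.2 - δ))
    exact hg.comp (continuous_snd.prodMk h1)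

lemma Ton_stab (N : ℕ) (g : ℝ → ℝ → ℝ) {δ : ℝ} (hδ : 0 < δ) (α : ℝ) (k : ℕ) :
    ∀ r ≤ k * δ, Ton N g δ α (k + 1) r = Ton N g δ α k r := by
  induction k with
  | zero =>
    intro r hr
    simp only [Nat.cast_zero, zero_mul] at hr
    simp [Ton, max_eq_right hr, AA]
  | succ k ih =>
    intro r hr
    rw [Ton, Ton]
    congr 1
    apply AA_congr N (le_max_right _ _)
    intro σ hσ
    rw [ih]
    have h1 : σ ≤ max r 0 := hσ.2
    have h2 : max r 0 ≤ ((k + 1 : ℕ) : ℝ) * δ := max_le hr (by positivity)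
    push_cast at h2
    linarith

lemma exists_shoot (N : ℕ) (g : ℝ → ℝ → ℝ) (hg : Continuous (Function.uncurry g)) (C : ℝ)
    (hC : ∀ r t, |g r t| ≤ C) (n K : ℝ) :
    ∃ (α : ℝ) (u : ℝ → ℝ), Continuous u ∧
      (∀ r ∈ Icc (0:ℝ) (3/2), u r = α + AA N (fun σ => g σ (u σ)) r) ∧
      max (u 1 - n) (u (1/2) - K) = 0 := by
  have hC0 : 0 ≤ C := (abs_nonneg _).trans (hC 0 0)
  have gc : ∀ (w : ℝ → ℝ), Continuous w → Continuous fun σ => g σ (w σ) := fun w hw =>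
    hg.comp (continuous_id.prodMk hw)
  have Tc : ∀ δ α k, Continuous fun r => Ton N g δ α k r := fun δ α k =>
    (Ton_cont N g hg δ k).comp (by fun_prop : Continuous fun r : ℝ => (α, r))
  let δ : ℕ → ℝ := fun j => 1 / ((j : ℝ) + 1)
  have hδ : ∀ j, 0 < δ j := fun j => by positivity
  let U : ℕ → ℝ → ℝ → ℝ := fun j α => Ton N g (δ j) α (2 * (j + 1))
  let Hh : ℕ → ℝ → ℝ → ℝ := fun j α σ => g σ (U j α (σ - δ j))
  have Uc : ∀ j α, Continuous (U j α) := fun j α => Tc _ _ _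
  have Hc : ∀ j α, Continuous (Hh j α) := fun j α =>
    gc _ ((Uc j α).comp (by fun_prop))
  have Ueq : ∀ j α, ∀ r ≤ 2, U j α r = α + AA N (Hh j α) (max r 0) := by
    intro j α r hr
    have := Ton_stab N g (hδ j) α (2 * (j + 1)) r (by
      refine hr.trans (le_of_eq ?_)
      simp only [δ]
      push_cast
      field_simp)
    simp only [U]
    rw [← this]
    rfl
  have Ulip : ∀ j α, ∀ r ≤ 2, ∀ s ≤ 2, |U j α r - U j α s| ≤ 2 * C * |r - s| := by
    intro j α r hr s hs
    rw [Ueq j α r hr, Ueq j α s hs, add_sub_add_left_eq_sub]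
    have h1 := AA_lip N (Hc j α) (ρ := 2) (C := C) (r := max r 0) (s := max s 0)
      (fun σ _ => hC _ _) ⟨le_max_right _ _, max_le hr (by norm_num)⟩
      ⟨le_max_right _ _, max_le hs (by norm_num)⟩
    refine h1.trans ?_
    exact mul_le_mul_of_nonneg_left (abs_max_sub_max_le_abs r s 0) (by positivity)
  have U0 : ∀ j α, U j α 0 = α := by
    intro j α
    rw [Ueq j α 0 (by norm_num)]
    simp [AA]
  have Ub : ∀ j α, ∀ r ∈ Icc (0:ℝ) 2, |U j α r - α| ≤ 4 * C := by
    intro j α r hr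
    have := Ulip j α r hr.2 0 (by norm_num)
    rw [U0, sub_zero, abs_of_nonneg hr.1] at this
    nlinarith [hr.2]
  have shoot : ∀ j, ∃ α ∈ Icc (min n K - 4 * C) (max n K + 4 * C),
      max (U j α 1 - n) (U j α (1/2) - K) = 0 := by
    intro j
    have hle : min n K - 4 * C ≤ max n K + 4 * C := by
      have := min_le_max (a := n) (b := K)
      linarith
    have cont : Continuous fun α => max (U j α 1 - n) (U j α (1/2) - K) := by
      have c1 : ∀ r, Continuous fun α => U j α r := fun r =>
        (Ton_cont N g hg (δ j) (2 * (j + 1))).comp (by fun_prop : Continuous fun α : ℝ => (α, r))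
      exact ((c1 1).sub continuous_const).max ((c1 (1/2)).sub continuous_const)
    have := intermediate_value_Icc hle cont.continuousOn
    apply this
    constructor
    · have a1 := abs_le.1 (Ub j (min n K - 4 * C) 1 (by norm_num))
      have a2 := abs_le.1 (Ub j (min n K - 4 * C) (1/2) (by norm_num))
      apply max_le
      · linarith [min_le_left n K, a1.2]
      · linarith [min_le_right n K, a2.2]
    · have a1 := abs_le.1 (Ub j (max n K + 4 * C) 1 (by norm_num))
      apply le_max_of_le_left
      linarith [le_max_left n K, a1.1]
  choose α hα hα0 using shoot
  obtain ⟨φ, hφ, v, vc, hv, hveq⟩ := limit_lemma N (R := 2) (by norm_num)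
    (fun j => U j (α j)) (fun j => Hh j (α j)) α (fun j => Hc _ _)
    (fun j r hr => by rw [Ueq j _ r hr.2.le, max_eq_left hr.1])
    (fun ρ h0 h1 => ⟨|min n K - 4 * C| + |max n K + 4 * C| + 4 * C + C, Eventually.of_forall fun j r hr => by
      have a1 := Ub j (α j) r ⟨hr.1, hr.2.trans h1.le⟩
      have a2 := abs_le_max_abs_abs (hα j).1 (hα j).2
      have a3 : max |min n K - 4 * C| |max n K + 4 * C| ≤ |min n K - 4 * C| + |max n K + 4 * C| :=
        max_le_add_of_nonneg (abs_nonneg _) (abs_nonneg _)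
      have a4 := abs_add_le (U j (α j) r - α j) (α j)
      rw [sub_add_cancel] at a4
      have a5 : |Hh j (α j) r| ≤ C := hC _ _
      have := abs_nonneg (min n K - 4 * C)
      have := abs_nonneg (max n K + 4 * C)
      constructor <;> linarith⟩)
  have hδ0 : Tendsto (fun j => 2 * C * δ (φ j)) atTop (𝓝 0) := by
    have : Tendsto δ atTop (𝓝 0) := tendsto_one_div_add_atTop_nhds_zero_nat
    simpa using (this.comp hφ.tendsto_atTop).const_mul (2 * C)
  have hk : ∀ r ∈ Ico (0:ℝ) 2, Tendsto (fun j => Hh (φ j) (α (φ j)) r) atTop (𝓝 (g r (v r))) := by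
    intro r hr
    have t1 : Tendsto (fun j => U (φ j) (α (φ j)) (r - δ (φ j)) - U (φ j) (α (φ j)) r) atTop (𝓝 0) := by
      refine squeeze_zero_norm (fun j => ?_) hδ0
      have := Ulip (φ j) (α (φ j)) (r - δ (φ j)) (by linarith [hδ (φ j), hr.2]) r hr.2.le
      rw [Real.norm_eq_abs]
      refine this.trans (le_of_eq ?_)
      rw [sub_sub_cancel_left, abs_neg, abs_of_pos (hδ _)]
    have t2 : Tendsto (fun j => U (φ j) (α (φ j)) (r - δ (φ j))) atTop (𝓝 (v r)) := by
      have := t1.add (hv r hr)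
      simpa using this
    have c : Continuous (g r) := hg.comp (by fun_prop : Continuous fun t : ℝ => (r, t))
    exact (c.tendsto (v r)).comp t2
  have heq := hveq _ hk
  refine ⟨v 0, fun r => v (max 0 (min r (3/2))), ?_, ?_, ?_⟩
  · apply vc.comp_continuous (by fun_prop)
    intro x
    exact ⟨le_max_left _ _, max_lt (by norm_num) ((min_le_right _ _).trans_lt (by norm_num))⟩
  · intro r hr
    simp only
    rw [min_eq_left hr.2, max_eq_right hr.1, heq r ⟨hr.1, hr.2.trans_lt (by norm_num)⟩]
    congr 1
    apply AA_congr N hr.1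
    intro σ hσ
    rw [min_eq_left (hσ.2.trans hr.2), max_eq_right hσ.1]
  · have e1 : max (0:ℝ) (min 1 (3/2)) = 1 := by norm_num
    have e2 : max (0:ℝ) (min (1/2) (3/2)) = 1/2 := by norm_num
    simp only [e1, e2]
    have t := ((hv 1 (by norm_num)).sub_const n).max ((hv (1/2) (by norm_num)).sub_const K)
    refine tendsto_nhds_unique t ?_
    simp only [hα0]
    exact tendsto_const_nhds


lemma Sol.du' {N : ℕ} {R : ℝ} {u φ h : ℝ → ℝ} (S : Sol N R u φ h) {r : ℝ} (hr : r ∈ Ioo 0 R) :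
    HasDerivAt u (r * φ r) r :=
  (S.du r ⟨hr.1.le, hr.2⟩).hasDerivAt (Ici_mem_nhds hr.1)

lemma Sol.dφ' {N : ℕ} (hN : 1 ≤ N) {R : ℝ} {u φ h : ℝ → ℝ} (S : Sol N R u φ h) {r : ℝ}
    (hr : r ∈ Ioo 0 R) : HasDerivAt φ ((h r - N * φ r) / r) r := by
  have h1 := S.dφ r hr
  have hr0 : r ≠ 0 := hr.1.ne'
  have h2 : HasDerivAt (fun s : ℝ => s ^ N) (N * r ^ (N - 1)) r := hasDerivAt_pow N r
  have h3 := h1.div h2 (pow_ne_zero _ hr0)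
  have h4 := h3.congr_of_eventuallyEq (f₁ := φ) (by
    filter_upwards [Ioi_mem_nhds hr.1] with s hs
    have : s ^ N ≠ 0 := pow_ne_zero _ (ne_of_gt hs)
    simp only [Pi.div_apply]
    field_simp)
  refine h4.congr_deriv ?_
  obtain ⟨n, rfl⟩ : ∃ n, N = n + 1 := ⟨N - 1, by omega⟩
  simp only [Nat.add_sub_cancel]
  field_simp
  ring

lemma hasFDerivAt_norm' {E : Type*} [NormedAddCommGroup E] [InnerProductSpace ℝ E] {x : E}
    (hx : x ≠ 0) : HasFDerivAt (fun y : E => ‖y‖) (‖x‖⁻¹ • innerSL ℝ x) x := by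
  have h1 : HasFDerivAt (fun y : E => ‖y‖ ^ 2) (2 • innerSL ℝ x) x :=
    (hasStrictFDerivAt_norm_sq x).hasFDerivAt
  have hn : 0 < ‖x‖ := norm_pos_iff.2 hx
  have h2 := (Real.hasDerivAt_sqrt (x := ‖x‖ ^ 2) (by positivity)).comp_hasFDerivAt x h1
  have h3 : (Real.sqrt ∘ fun y : E => ‖y‖ ^ 2) = fun y : E => ‖y‖ := by
    ext y; simp [Real.sqrt_sq]
  rw [h3] at h2
  refine h2.congr_fderiv ?_
  ext y
  simp [Real.sqrt_sq]
  field_simp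

section
variable {N : ℕ} {R : ℝ} {u φ h : ℝ → ℝ}

lemma Sol.fderivV (S : Sol N R u φ h) (hR : 0 < R) {x : (EuclideanSpace ℝ (Fin N))} (hx : x ∈ ball (0 : (EuclideanSpace ℝ (Fin N))) R) :
    HasFDerivAt (fun y : (EuclideanSpace ℝ (Fin N)) => u ‖y‖) (innerSL ℝ (φ ‖x‖ • x)) x := by
  rw [mem_ball_zero_iff] at hx
  by_cases h0 : x = 0
  · subst h0
    have d := S.du 0 ⟨le_rfl, hR⟩
    simp only [smul_zero, map_zero]
    rw [zero_mul, hasDerivWithinAt_iff_isLittleO] at d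
    rw [hasFDerivAt_iff_isLittleO]
    have t : Tendsto (fun y : (EuclideanSpace ℝ (Fin N)) => ‖y‖) (𝓝 0) (𝓝[Ici 0] 0) := by
      apply tendsto_nhdsWithin_of_tendsto_nhds_of_eventually_within
      · simpa using (continuous_norm (E := (EuclideanSpace ℝ (Fin N)))).tendsto 0
      · exact Eventually.of_forall fun y => norm_nonneg y
    have := d.comp_tendsto t
    simp only [Function.comp_def, sub_zero, smul_zero] at this
    simp only [norm_zero, sub_zero, _root_.zero_apply]
    exact this.of_norm_right
  · have hn : 0 < ‖x‖ := norm_pos_iff.2 h0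
    have := (S.du' ⟨hn, hx⟩).comp_hasFDerivAt x (hasFDerivAt_norm' h0)
    refine this.congr_fderiv ?_
    ext y
    simp
    field_simp

noncomputable def DG (N : ℕ) (φ h : ℝ → ℝ) (x : EuclideanSpace ℝ (Fin N)) :
    EuclideanSpace ℝ (Fin N) →L[ℝ] EuclideanSpace ℝ (Fin N) :=
  φ ‖x‖ • ContinuousLinearMap.id ℝ _ +
    (innerSL ℝ x).smulRight (((h ‖x‖ - N * φ ‖x‖) / ‖x‖ ^ 2) • x)

lemma tendsto_norm_Ico (hR : 0 < R) :
    Tendsto (fun y : (EuclideanSpace ℝ (Fin N)) => ‖y‖) (𝓝 0) (𝓝[Ico 0 R] 0) := by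
  apply tendsto_nhdsWithin_of_tendsto_nhds_of_eventually_within
  · simpa using (continuous_norm (E := (EuclideanSpace ℝ (Fin N)))).tendsto 0
  · filter_upwards [ball_mem_nhds (0 : (EuclideanSpace ℝ (Fin N))) hR] with y hy
    exact ⟨norm_nonneg y, mem_ball_zero_iff.1 hy⟩

lemma Sol.fderivG (hN : 1 ≤ N) (S : Sol N R u φ h) (hR : 0 < R) {x : (EuclideanSpace ℝ (Fin N))} (hx : x ∈ ball (0 : (EuclideanSpace ℝ (Fin N))) R) :
    HasFDerivAt (fun y : (EuclideanSpace ℝ (Fin N)) => φ ‖y‖ • y) (DG N φ h x) x := by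
  rw [mem_ball_zero_iff] at hx
  by_cases h0 : x = 0
  · subst h0
    rw [hasFDerivAt_iff_isLittleO]
    have t : Tendsto (fun y : (EuclideanSpace ℝ (Fin N)) => φ ‖y‖ - φ 0) (𝓝 0) (𝓝 0) := by
      have := (S.φc 0 ⟨le_rfl, hR⟩).tendsto.comp (tendsto_norm_Ico (N := N) hR)
      simpa [Function.comp_def] using this.sub_const (φ 0)
    have o : (fun y : (EuclideanSpace ℝ (Fin N)) => φ ‖y‖ - φ 0) =o[𝓝 0] (fun _ => (1:ℝ)) :=
      (Asymptotics.isLittleO_one_iff ℝ).2 t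
    have := o.smul_isBigO (Asymptotics.isBigO_refl (fun y : (EuclideanSpace ℝ (Fin N)) => y) (𝓝 0))
    simp only [one_smul] at this
    refine this.congr (fun y => ?_) (fun y => by simp)
    simp [DG, sub_smul]
  · have hn : 0 < ‖x‖ := norm_pos_iff.2 h0
    have h1 := (S.dφ' hN ⟨hn, hx⟩).comp_hasFDerivAt x (hasFDerivAt_norm' h0)
    have := h1.smul (hasFDerivAt_id x)
    refine this.congr_fderiv ?_
    ext1 y
    simp only [DG, Function.comp_apply, id_eq, add_apply,
      smul_apply, ContinuousLinearMap.smulRight_apply, ContinuousLinearMap.id_apply,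
      smul_smul, smul_eq_mul]
    congr 2
    field_simp

lemma Sol.DGc (S : Sol N R u φ h) (hR : 0 < R) :
    ContinuousOn (DG N φ h) (ball (0 : (EuclideanSpace ℝ (Fin N))) R) := by
  have hIc : ∀ y ∈ ball (0 : (EuclideanSpace ℝ (Fin N))) R, ‖y‖ ∈ Ico 0 R := fun y hy =>
    ⟨norm_nonneg y, mem_ball_zero_iff.1 hy⟩
  have c1 : ContinuousOn (fun y : (EuclideanSpace ℝ (Fin N)) => φ ‖y‖) (ball 0 R) :=
    S.φc.comp continuous_norm.continuousOn hIc
  have c2 : ContinuousOn (fun y : (EuclideanSpace ℝ (Fin N)) => h ‖y‖) (ball 0 R) :=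
    S.hc.comp continuous_norm.continuousOn hIc
  unfold DG
  refine (c1.smul continuousOn_const).add ?_
  intro x hx
  by_cases h0 : x = 0
  · subst h0
    have t : Tendsto (fun y : (EuclideanSpace ℝ (Fin N)) => |h ‖y‖ - N * φ ‖y‖|) (𝓝[ball (0 : (EuclideanSpace ℝ (Fin N))) R] 0) (𝓝 0) := by
      have := ((c2 0 hx).sub ((c1 0 hx).const_smul (N : ℝ))).abs.tendsto
      simpa [S.φ0] using this
    refine tendsto_iff_norm_sub_tendsto_zero.2 (squeeze_zero (fun _ => norm_nonneg _) (fun y => ?_) t)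
    simp only [smul_zero, map_zero, ContinuousLinearMap.smulRight_zero, sub_zero]
    rw [ContinuousLinearMap.norm_smulRight_apply, innerSL_apply_norm, norm_smul, Real.norm_eq_abs, abs_div,
      abs_of_nonneg (sq_nonneg ‖y‖)]
    by_cases hy : y = 0
    · simp [hy]
    · have : 0 < ‖y‖ := norm_pos_iff.2 hy
      apply le_of_eq
      field_simp
  · have hn : 0 < ‖x‖ := norm_pos_iff.2 h0
    have a1 : ContinuousWithinAt (fun y : (EuclideanSpace ℝ (Fin N)) => ((h ‖y‖ - N * φ ‖y‖) / ‖y‖ ^ 2) • y) (ball 0 R) x := by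
      have b1 : ContinuousWithinAt (fun y : (EuclideanSpace ℝ (Fin N)) => h ‖y‖ - N * φ ‖y‖) (ball 0 R) x :=
        (c2 x hx).sub ((c1 x hx).const_smul (N : ℝ))
      have b2 : ContinuousWithinAt (fun y : (EuclideanSpace ℝ (Fin N)) => ‖y‖ ^ 2) (ball 0 R) x :=
        (by fun_prop : Continuous fun y : (EuclideanSpace ℝ (Fin N)) => ‖y‖ ^ 2).continuousWithinAt
      exact (b1.div b2 (pow_ne_zero 2 hn.ne')).smul continuousWithinAt_id
    have a2 : ContinuousWithinAt (fun y : (EuclideanSpace ℝ (Fin N)) => innerSL ℝ y) (ball 0 R) x :=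
      (innerSL ℝ).continuous.continuousWithinAt
    have a3 := ((ContinuousLinearMap.smulRightL ℝ (EuclideanSpace ℝ (Fin N)) (EuclideanSpace ℝ (Fin N))).continuous₂).continuousAt.comp_continuousWithinAt
      (a2.prodMk a1)
    exact a3

lemma Sol.radial (hN : 1 ≤ N) (S : Sol N R u φ h) (hR : 0 < R) :
    ContDiffOn ℝ 2 (fun y : (EuclideanSpace ℝ (Fin N)) => u ‖y‖) (ball 0 R) ∧
    ∀ x ∈ ball (0 : (EuclideanSpace ℝ (Fin N))) R, lap (fun y : (EuclideanSpace ℝ (Fin N)) => u ‖y‖) x = h ‖x‖ := by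
  have hf : ∀ x ∈ ball (0 : (EuclideanSpace ℝ (Fin N))) R, fderiv ℝ (fun y : (EuclideanSpace ℝ (Fin N)) => u ‖y‖) x = innerSL ℝ (φ ‖x‖ • x) :=
    fun x hx => (S.fderivV hR hx).fderiv
  have hG1 : ContDiffOn ℝ 1 (fun y : (EuclideanSpace ℝ (Fin N)) => φ ‖y‖ • y) (ball 0 R) := by
    have := (contDiffOn_succ_iff_fderiv_of_isOpen (𝕜 := ℝ) (n := 0) (f := fun y : (EuclideanSpace ℝ (Fin N)) => φ ‖y‖ • y)
      (isOpen_ball (x := (0 : (EuclideanSpace ℝ (Fin N)))) (ε := R))).2 ⟨fun x hx =>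
        (S.fderivG hN hR hx).differentiableAt.differentiableWithinAt, by simp, by
        rw [contDiffOn_zero]
        exact (S.DGc hR).congr fun x hx => (S.fderivG hN hR hx).fderiv⟩
    simpa using this
  constructor
  · have := (contDiffOn_succ_iff_fderiv_of_isOpen (𝕜 := ℝ) (n := 1) (f := fun y : (EuclideanSpace ℝ (Fin N)) => u ‖y‖)
      (isOpen_ball (x := (0 : (EuclideanSpace ℝ (Fin N)))) (ε := R))).2 ⟨fun x hx =>
        (S.fderivV hR hx).differentiableAt.differentiableWithinAt, by simp, by
        rw [contDiffOn_clm_apply]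
        intro y
        refine (hG1.inner ℝ contDiffOn_const (g := fun _ => y)).congr fun x hx => ?_
        rw [hf x hx]
        rfl⟩
    simpa [one_add_one_eq_two] using this
  · intro x hx
    unfold lap
    have key : ∀ i : Fin N, fderiv ℝ (fun y => fderiv ℝ (fun y : (EuclideanSpace ℝ (Fin N)) => u ‖y‖) y
        (EuclideanSpace.single i 1)) x (EuclideanSpace.single i 1)
        = φ ‖x‖ + ((h ‖x‖ - N * φ ‖x‖) / ‖x‖ ^ 2) * (x i) ^ 2 := by
      intro i
      have e : (fun y => fderiv ℝ (fun y : (EuclideanSpace ℝ (Fin N)) => u ‖y‖) y (EuclideanSpace.single i 1))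
          =ᶠ[𝓝 x] fun y => inner ℝ (φ ‖y‖ • y) (EuclideanSpace.single i (1:ℝ)) := by
        filter_upwards [isOpen_ball.mem_nhds hx] with y hy
        rw [hf y hy]
        rfl
      rw [e.fderiv_eq]
      have d := (S.fderivG hN hR hx).inner ℝ (hasFDerivAt_const (EuclideanSpace.single i (1:ℝ)) x)
      rw [d.fderiv]
      simp [DG, fderivInnerCLM_apply, EuclideanSpace.inner_single_right]
      ring
    simp only [key]
    rw [Finset.sum_add_distrib, ← Finset.mul_sum]
    have hs : ∑ i, (x i) ^ 2 = ‖x‖ ^ 2 := by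
      rw [EuclideanSpace.norm_sq_eq]
      simp
    rw [hs]
    simp only [Finset.sum_const, Finset.card_univ, Fintype.card_fin, nsmul_eq_mul]
    by_cases h0 : x = 0
    · simp [h0, S.φ0]
    · have hn : 0 < ‖x‖ := norm_pos_iff.2 h0
      field_simp
      ring
end


lemma second_deriv_nonpos {E : Type*} [NormedAddCommGroup E] [NormedSpace ℝ E] (d : E → ℝ) (x e : E)
    (hd : ContDiffAt ℝ 2 d x) (hm : IsLocalMax d x) :
    fderiv ℝ (fun y => fderiv ℝ d y e) x e ≤ 0 := by
  by_contra hpos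
  push Not at hpos
  let l : ℝ → E := fun t => x + t • e
  have l0 : l 0 = x := by simp [l]
  have hl : ∀ t, HasDerivAt l e t := by
    intro t
    simpa [l] using ((hasDerivAt_id t).smul_const e).const_add x
  have lc : Tendsto l (𝓝 0) (𝓝 x) := by
    have := (hl 0).continuousAt.tendsto
    rwa [l0] at this
  have ev : ∀ᶠ y in 𝓝 x, DifferentiableAt ℝ d y := by
    filter_upwards [hd.eventually (by simp)] with y hy using hy.differentiableAt (by simp)
  have h1 : ∀ᶠ t in 𝓝 (0:ℝ), deriv (fun t => d (l t)) t = fderiv ℝ d (l t) e := by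
    filter_upwards [lc.eventually ev] with t ht
    exact (ht.hasFDerivAt.comp_hasDerivAt t (hl t)).deriv
  have hfd : DifferentiableAt ℝ (fun y => fderiv ℝ d y e) x := by
    have := (hd.fderiv_right (m := 1) (by norm_num)).differentiableAt (by simp)
    exact this.clm_apply (differentiableAt_const e)
  have h2 : deriv (deriv (fun t => d (l t))) 0 = fderiv ℝ (fun y => fderiv ℝ d y e) x e := by
    rw [EventuallyEq.deriv_eq h1]
    have hx : HasFDerivAt (fun y => fderiv ℝ d y e) (fderiv ℝ (fun y => fderiv ℝ d y e) x) (l 0) := by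
      rw [l0]; exact hfd.hasFDerivAt
    exact (hx.comp_hasDerivAt 0 (hl 0)).deriv
  have hmax : IsLocalMax (fun t => d (l t)) 0 := by
    have : ∀ᶠ y in 𝓝 x, d y ≤ d x := hm
    have h3 := lc.eventually this
    filter_upwards [h3] with t ht
    rw [l0]; exact ht
  have hmin : IsLocalMin (fun t => d (l t)) 0 := by
    apply isLocalMin_of_deriv_deriv_pos
    · rw [h2]; exact hpos
    · exact hmax.deriv_eq_zero
    · have hdx : ContinuousAt d (l 0) := by rw [l0]; exact hd.continuousAt
      exact ContinuousAt.comp (f := l) (g := d) hdx (hl 0).continuousAt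
  have hconst : (fun t => d (l t)) =ᶠ[𝓝 0] fun _ => d (l 0) := by
    filter_upwards [hmax, hmin] with t a b using le_antisymm a b
  have h4 : deriv (deriv (fun t => d (l t))) 0 = 0 := by
    rw [hconst.deriv.deriv_eq]
    simp
  linarith

lemma lap_le_of_localMax {N : ℕ} (p q : EuclideanSpace ℝ (Fin N) → ℝ) (x : EuclideanSpace ℝ (Fin N))
    (hp : ContDiffAt ℝ 2 p x) (hq : ContDiffAt ℝ 2 q x)
    (hm : IsLocalMax (fun y => p y - q y) x) : lap p x ≤ lap q x := by
  unfold lap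
  apply Finset.sum_le_sum
  intro i _
  set e : EuclideanSpace ℝ (Fin N) := EuclideanSpace.single i 1
  have h1 := second_deriv_nonpos (fun y => p y - q y) x e (hp.sub hq) hm
  have fd : ∀ r : EuclideanSpace ℝ (Fin N) → ℝ, ContDiffAt ℝ 2 r x →
      DifferentiableAt ℝ (fun y => fderiv ℝ r y e) x := by
    intro r hr
    have := (hr.fderiv_right (m := 1) (by norm_num)).differentiableAt (by simp)
    exact this.clm_apply (differentiableAt_const e)
  have ev : (fun y => fderiv ℝ (fun y => p y - q y) y e) =ᶠ[𝓝 x]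
      fun y => fderiv ℝ p y e - fderiv ℝ q y e := by
    filter_upwards [hp.eventually (by simp), hq.eventually (by simp)] with y hy1 hy2
    rw [fderiv_fun_sub (hy1.differentiableAt (by simp)) (hy2.differentiableAt (by simp))]
    rfl
  rw [ev.fderiv_eq, fderiv_fun_sub (fd p hp) (fd q hq)] at h1
  have h2 : fderiv ℝ (fun y => fderiv ℝ p y e) x e - fderiv ℝ (fun y => fderiv ℝ q y e) x e ≤ 0 := h1
  linarith

lemma exists_w {N : ℕ} (hN : 1 ≤ N) (vlow : EuclideanSpace ℝ (Fin N) → ℝ)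
    (hvcont : ContinuousOn vlow (closedBall 0 1)) :
    ∃ w : ℝ → ℝ, Continuous w ∧ (∀ x ∈ closedBall (0 : EuclideanSpace ℝ (Fin N)) 1, vlow x ≤ w ‖x‖) ∧
      (∀ r ∈ Icc (0:ℝ) 1, ∃ y : EuclideanSpace ℝ (Fin N), ‖y‖ = r ∧ vlow y = w r) ∧
      ∃ m M, ∀ r, w r ∈ Icc m M := by
  let E := EuclideanSpace ℝ (Fin N)
  let S := sphere (0 : E) 1
  have : Nonempty (Fin N) := ⟨⟨0, by omega⟩⟩
  have : Nonempty S := ⟨⟨EuclideanSpace.single (⟨0, by omega⟩ : Fin N) (1 : ℝ), by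
    rw [mem_sphere_zero_iff_norm]
    exact (EuclideanSpace.norm_single _ _).trans (by simp)⟩⟩
  let F : ℝ → S → ℝ := fun r θ => vlow ((max 0 (min r 1)) • (θ : E))
  have hnorm : ∀ r (θ : S), ‖(max 0 (min r 1)) • (θ : E)‖ = max 0 (min r 1) := by
    intro r θ
    have : ‖(θ : E)‖ = 1 := by simp
    rw [norm_smul, this, mul_one, Real.norm_eq_abs, abs_of_nonneg (le_max_left _ _)]
  have hFc : Continuous (fun p : ℝ × S => F p.1 p.2) := by
    apply hvcont.comp_continuous
    · fun_prop
    · intro p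
      rw [mem_closedBall_zero_iff, hnorm]
      exact max_le zero_le_one (min_le_right _ _)
  have hFr : ∀ r, Continuous (F r) := fun r => hFc.comp (by fun_prop : Continuous fun θ : S => (r, θ))
  have hcomp : ∀ r, IsCompact (F r '' univ) := fun r => isCompact_univ.image (hFr r)
  have hne : ∀ r, (F r '' univ).Nonempty := fun r => (univ_nonempty).image _
  let w : ℝ → ℝ := fun r => sSup (F r '' univ)
  have hwc : Continuous w := (isCompact_univ : IsCompact (univ : Set S)).continuous_sSup hFc
  have hat : ∀ r, ∃ θ : S, F r θ = w r := by
    intro r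
    obtain ⟨θ, -, h⟩ := (hcomp r).sSup_mem (hne r)
    exact ⟨θ, h⟩
  refine ⟨w, hwc, ?_, ?_, ?_⟩
  · intro x hx
    rw [mem_closedBall_zero_iff] at hx
    have hcl : max 0 (min ‖x‖ 1) = ‖x‖ := by rw [min_eq_left hx, max_eq_right (norm_nonneg x)]
    have : ∃ θ : S, ‖x‖ • (θ : E) = x := by
      by_cases h0 : x = 0
      · exact ⟨Classical.arbitrary S, by simp [h0]⟩
      · have hn : ‖x‖ ≠ 0 := norm_ne_zero_iff.2 h0
        refine ⟨⟨‖x‖⁻¹ • x, ?_⟩, ?_⟩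
        · simp [S, norm_smul, hn]
        · simp [smul_smul, hn]
    obtain ⟨θ, hθ⟩ := this
    have h2 : F ‖x‖ θ ≤ w ‖x‖ := le_csSup (hcomp _).bddAbove ⟨θ, trivial, rfl⟩
    simp only [F] at h2
    rwa [hcl, hθ] at h2
  · intro r hr
    obtain ⟨θ, hθ⟩ := hat r
    refine ⟨(max 0 (min r 1)) • (θ : E), ?_, hθ⟩
    rw [hnorm, min_eq_left hr.2, max_eq_right hr.1]
  · obtain ⟨m, hm⟩ := ((isCompact_closedBall (0 : E) 1).image_of_continuousOn hvcont).bddBelow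
    obtain ⟨M, hM⟩ := ((isCompact_closedBall (0 : E) 1).image_of_continuousOn hvcont).bddAbove
    refine ⟨m, M, fun r => ?_⟩
    obtain ⟨θ, hθ⟩ := hat r
    have : w r ∈ vlow '' closedBall (0 : E) 1 := by
      refine ⟨_, ?_, hθ⟩
      rw [mem_closedBall_zero_iff, hnorm]
      exact max_le zero_le_one (min_le_right _ _)
    exact ⟨hm this, hM this⟩

lemma comparison_s14 {N : ℕ} (hN : 1 ≤ N) (f : ℝ → ℝ) (vlow : EuclideanSpace ℝ (Fin N) → ℝ)
    (hvcont : ContinuousOn vlow (closedBall 0 1))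
    (hvreg : ContDiffOn ℝ 2 vlow (ball 0 1))
    (hvsub : ∀ x ∈ ball (0 : EuclideanSpace ℝ (Fin N)) 1, f (vlow x) ≤ lap vlow x)
    (w : ℝ → ℝ) (hw1 : ∀ x ∈ closedBall (0 : EuclideanSpace ℝ (Fin N)) 1, vlow x ≤ w ‖x‖)
    (hw2 : ∀ r ∈ Icc (0:ℝ) 1, ∃ y : EuclideanSpace ℝ (Fin N), ‖y‖ = r ∧ vlow y = w r)
    {R : ℝ} (hR : 1 < R) {u φ h : ℝ → ℝ} (S : Sol N R u φ h)
    (hlt : ∀ r ∈ Ico (0:ℝ) 1, u r < w r → h r < f (w r)) (hu1 : w 1 ≤ u 1) :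
    ∀ r ∈ Icc (0:ℝ) 1, w r ≤ u r := by
  intro r hr
  by_contra hcon
  push Not at hcon
  let E := EuclideanSpace ℝ (Fin N)
  let d : E → ℝ := fun x => vlow x - u ‖x‖
  have dc : ContinuousOn d (closedBall (0 : E) 1) := by
    refine hvcont.sub (S.uc.comp continuous_norm.continuousOn fun x hx => ?_)
    exact ⟨norm_nonneg x, (mem_closedBall_zero_iff.1 hx).trans_lt hR⟩
  obtain ⟨x0, hx0, hmax⟩ := (isCompact_closedBall (0 : E) 1).exists_isMaxOn
    ⟨0, by simp⟩ dc
  obtain ⟨y, hyr, hyw⟩ := hw2 r hr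
  have hdy : 0 < d y := by
    simp only [d]; rw [hyr, hyw]; linarith
  have hy : y ∈ closedBall (0 : E) 1 := by rw [mem_closedBall_zero_iff, hyr]; exact hr.2
  have hd0 : 0 < d x0 := hdy.trans_le (hmax hy)
  have hx0n : ‖x0‖ ≤ 1 := mem_closedBall_zero_iff.1 hx0
  have hx01 : ‖x0‖ < 1 := by
    rcases hx0n.lt_or_eq with h1 | h1
    · exact h1
    · exfalso
      have := hw1 x0 hx0
      simp only [d] at hd0
      rw [h1] at this hd0
      linarith
  obtain ⟨z, hzn, hzw⟩ := hw2 ‖x0‖ ⟨norm_nonneg _, hx0n⟩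
  have hdz : d x0 ≤ d z := by
    simp only [d]; rw [hzn, hzw]; linarith [hw1 x0 hx0]
  have hzb : z ∈ ball (0 : E) 1 := by rw [mem_ball_zero_iff, hzn]; exact hx01
  have hloc : IsLocalMax d z := by
    filter_upwards [isOpen_ball.mem_nhds hzb] with t ht
    exact (hmax (ball_subset_closedBall ht)).trans hdz
  obtain ⟨V1, V2⟩ := S.radial hN (by linarith)
  have hzR : z ∈ ball (0 : E) R := ball_subset_ball hR.le hzb
  have h1 := lap_le_of_localMax vlow (fun y : E => u ‖y‖) z
    (hvreg.contDiffAt (isOpen_ball.mem_nhds hzb)) (V1.contDiffAt (isOpen_ball.mem_nhds hzR)) hloc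
  rw [V2 z hzR] at h1
  have h2 := hvsub z hzb
  have h3 : u ‖z‖ < w ‖z‖ := by
    have : 0 < d z := hd0.trans_le hdz
    simp only [d] at this
    rw [hzw] at this
    rw [hzn] at this ⊢
    linarith
  have h4 := hlt ‖z‖ ⟨norm_nonneg _, mem_ball_zero_iff.1 hzb⟩ h3
  rw [hzn] at h4 h1
  rw [hzw] at h2
  linarith


lemma mvt_le {f f' : ℝ → ℝ} {a b C : ℝ} (hab : a ≤ b) (hc : ContinuousOn f (Icc a b))
    (hd : ∀ x ∈ Ioo a b, HasDerivAt f (f' x) x) (hC : ∀ x ∈ Ioo a b, C ≤ f' x) :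
    C * (b - a) ≤ f b - f a := by
  apply Convex.mul_sub_le_image_sub_of_le_deriv (convex_Icc a b) hc _ _ a ⟨le_rfl, hab⟩ b ⟨hab, le_rfl⟩ hab
  · rw [interior_Icc]
    exact fun x hx => (hd x hx).differentiableAt.differentiableWithinAt
  · rw [interior_Icc]
    intro x hx
    rw [(hd x hx).deriv]
    exact hC x hx

structure KOdata (f F : ℝ → ℝ) (a T ε K t' μ : ℝ) : Prop where
  aK : a ≤ K
  TK : T ≤ K
  Kt : K ≤ t'
  μ0 : 0 < μ
  lin : ∀ t ≥ K, μ * (t - K) ≤ F t - F K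
  fK : 0 < f K
  sq : Real.sqrt (t' - K) ≤ ε * Real.sqrt μ
  half : ∀ t ≥ t', F t / 2 ≤ F t - F K
  tail : ∀ t ≥ t', ∫ s in t'..t, (Real.sqrt (F s))⁻¹ ≤ ε

lemma exists_KO {f F : ℝ → ℝ} {a T : ℝ} (hFd : ∀ t, HasDerivAt F (f t) t)
    (hFm : MonotoneOn F (Ici a)) (hFp : ∀ t ≥ T, 0 < F t)
    (hI : IntegrableOn (fun t => (Real.sqrt (F t))⁻¹) (Ici T)) {ε : ℝ} (hε : 0 < ε) (B : ℝ) :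
    ∃ K t' μ, B ≤ K ∧ KOdata f F a T ε K t' μ := by
  have hFc : Continuous F := continuous_iff_continuousAt.2 fun t => (hFd t).continuousAt
  set e := min (1/2) (min ε (ε ^ 2 / 2)) with he
  have e0 : 0 < e := by rw [he]; positivity
  have e1 : e ≤ 1/2 := min_le_left _ _
  have e2 : e ≤ ε := (min_le_right _ _).trans (min_le_left _ _)
  have e3 : e ≤ ε ^ 2 / 2 := (min_le_right _ _).trans (min_le_right _ _)
  have hii : ∀ s t, T ≤ s → T ≤ t → IntervalIntegrable (fun t => (Real.sqrt (F t))⁻¹) volume s t := by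
    intro s t hs ht
    apply IntegrableOn.intervalIntegrable
    apply hI.mono_set
    intro x hx
    exact (le_inf hs ht).trans hx.1
  obtain ⟨A0, hA0⟩ : ∃ A0, ∀ s ≥ A0, ∀ t ≥ A0, T ≤ s → T ≤ t →
      ∫ x in s..t, (Real.sqrt (F x))⁻¹ ≤ e := by
    have ht := intervalIntegral_tendsto_integral_Ioi T (hI.mono_set Ioi_subset_Ici_self)
      (tendsto_id (α := ℝ) (x := atTop))
    have hc := ht.cauchy_map
    rw [Metric.cauchy_iff] at hc
    obtain ⟨s, hs, hse⟩ := hc.2 e e0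
    obtain ⟨A0, hA⟩ := mem_atTop_sets.1 (mem_map.1 hs)
    refine ⟨A0, fun s1 hs1 t1 ht1 hT1 hT2 => ?_⟩
    have := hse _ (hA t1 ht1) _ (hA s1 hs1)
    rw [Real.dist_eq] at this
    simp only [id] at this
    rw [intervalIntegral.integral_interval_sub_left (hii _ _ le_rfl hT2) (hii _ _ le_rfl hT1)] at this
    exact (le_abs_self _).trans this.le
  set A := max (max A0 B) (max a T) with hA
  have AA0 : A0 ≤ A := (le_max_left _ _).trans (le_max_left _ _)
  have AB : B ≤ A := (le_max_right _ _).trans (le_max_left _ _)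
  have Aa : a ≤ A := (le_max_left _ _).trans (le_max_right _ _)
  have AT : T ≤ A := (le_max_right _ _).trans (le_max_right _ _)
  have star : ∀ s t, A ≤ s → s ≤ t → t - s ≤ e * Real.sqrt (F t) := by
    intro s t hs hst
    have hFt : 0 < Real.sqrt (F t) := Real.sqrt_pos.2 (hFp t (AT.trans (hs.trans hst)))
    have h1 : ∫ x in s..t, (Real.sqrt (F t))⁻¹ ≤ ∫ x in s..t, (Real.sqrt (F x))⁻¹ := by
      apply intervalIntegral.integral_mono_on hst intervalIntegrable_const
        (hii _ _ (AT.trans hs) (AT.trans (hs.trans hst)))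
      intro x hx
      have hFx : 0 < Real.sqrt (F x) := Real.sqrt_pos.2 (hFp x (AT.trans (hs.trans hx.1)))
      apply inv_anti₀ hFx
      apply Real.sqrt_le_sqrt
      exact hFm (Aa.trans (hs.trans hx.1)) (Aa.trans (hs.trans hst)) hx.2
    have h2 := hA0 s (AA0.trans hs) t (AA0.trans (hs.trans hst)) (AT.trans hs) (AT.trans (hs.trans hst))
    rw [intervalIntegral.integral_const, smul_eq_mul] at h1
    have h3 := h1.trans h2
    rwa [← div_eq_mul_inv, div_le_iff₀ hFt] at h3
  set μ := Real.sqrt (F A) with hμ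
  have μ0 : 0 < μ := Real.sqrt_pos.2 (hFp A AT)
  have μsq : μ ^ 2 = F A := Real.sq_sqrt (hFp A AT).le
  obtain ⟨K, hK, hKmin⟩ := (isCompact_Icc (a := A) (b := A + μ)).exists_isMinOn
    ⟨A, le_rfl, by linarith⟩ (f := fun t => F t - μ * t) (by fun_prop)
  have hKA : F K - μ * K ≤ F A - μ * A := hKmin (show A ∈ Icc A (A + μ) from ⟨le_rfl, by linarith⟩)
  have lin : ∀ t ≥ K, μ * (t - K) ≤ F t - F K := by
    intro t ht
    by_cases h : t ≤ A + μ
    · have : F K - μ * K ≤ F t - μ * t := hKmin (show t ∈ Icc A (A + μ) from ⟨hK.1.trans ht, h⟩)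
      linarith
    · push Not at h
      have h1 := star A t le_rfl (by linarith)
      have hFt := hFp t (AT.trans (hK.1.trans ht))
      have h2 : 2 * (t - A) ≤ Real.sqrt (F t) := by
        have := Real.sqrt_nonneg (F t)
        nlinarith
      have h3 : (2 * (t - A)) ^ 2 ≤ F t := by
        have := Real.sq_sqrt hFt.le
        rw [← this]
        exact pow_le_pow_left₀ (by linarith) h2 2
      nlinarith
  have hFK : F K ≤ 2 * μ ^ 2 := by nlinarith [hK.2]
  have hF4 : 4 * μ ^ 2 ≤ F (K + ε ^ 2 * μ) := by
    have hp : 0 < ε ^ 2 * μ := by positivity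
    have h1 := star K (K + ε ^ 2 * μ) hK.1 (by linarith)
    have hFt := hFp (K + ε ^ 2 * μ) (AT.trans (hK.1.trans (by linarith)))
    have h2 : 2 * μ ≤ Real.sqrt (F (K + ε ^ 2 * μ)) := by
      have h4 := Real.sqrt_nonneg (F (K + ε ^ 2 * μ))
      have h5 : ε ^ 2 * μ ≤ ε ^ 2 / 2 * Real.sqrt (F (K + ε ^ 2 * μ)) := by
        refine le_trans ?_ (mul_le_mul_of_nonneg_right e3 h4)
        linarith
      have h6 : 0 < ε ^ 2 := by positivity
      nlinarith
    rw [← Real.sq_sqrt hFt.le]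
    calc 4 * μ ^ 2 = (2 * μ) ^ 2 := by ring
      _ ≤ _ := pow_le_pow_left₀ (by linarith) h2 2
  have hKt : K ≤ K + ε ^ 2 * μ := by linarith [mul_pos (pow_pos hε 2) μ0]
  refine ⟨K, K + ε ^ 2 * μ, μ, AB.trans hK.1, Aa.trans hK.1, AT.trans hK.1, hKt, μ0, lin, ?_, ?_, ?_, ?_⟩
  · have hs : Tendsto (slope F K) (𝓝[>] K) (𝓝 (f K)) :=
      (hasDerivAt_iff_tendsto_slope.1 (hFd K)).mono_left
      (nhdsWithin_mono K (fun x hx => ne_of_gt (mem_Ioi.1 hx)))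
    refine μ0.trans_le (ge_of_tendsto hs ?_)
    filter_upwards [self_mem_nhdsWithin] with t ht
    have ht' : 0 < t - K := sub_pos.2 ht
    rw [slope_def_field, le_div_iff₀ ht']
    exact lin t (le_of_lt ht)
  · rw [add_sub_cancel_left, Real.sqrt_mul (sq_nonneg ε), Real.sqrt_sq hε.le]
  · intro t ht
    have := hFm (Aa.trans (hK.1.trans hKt)) (Aa.trans (hK.1.trans (hKt.trans ht))) ht
    linarith
  · intro t ht
    exact (hA0 _ (AA0.trans (hK.1.trans hKt)) t (AA0.trans (hK.1.trans (hKt.trans ht)))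
      (AT.trans (hK.1.trans hKt)) (AT.trans (hK.1.trans (hKt.trans ht)))).trans e2


lemma Sol.Pc {N : ℕ} {R : ℝ} {u φ h : ℝ → ℝ} (S : Sol N R u φ h) {s t : ℝ} (hs : 0 ≤ s) (ht : t < R) :
    ContinuousOn (fun x => x ^ N * φ x) (Icc s t) :=
  (continuous_pow N).continuousOn.mul (S.φc.mono fun _ hx => ⟨hs.trans hx.1, hx.2.trans_lt ht⟩)

lemma Sol.uc' {N : ℕ} {R : ℝ} {u φ h : ℝ → ℝ} (S : Sol N R u φ h) {s t : ℝ} (hs : 0 ≤ s) (ht : t < R) :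
    ContinuousOn u (Icc s t) :=
  S.uc.mono fun _ hx => ⟨hs.trans hx.1, hx.2.trans_lt ht⟩

lemma maxp {N : ℕ} (hN : 1 ≤ N) {R : ℝ} {u φ h : ℝ → ℝ} (S : Sol N R u φ h) {b r : ℝ}
    (hr0 : 0 ≤ r) (hrR : r < R) (hb : ∀ s ∈ Icc 0 r, b < u s → 0 ≤ h s) :
    ∀ s ∈ Icc 0 r, u s ≤ max b (u r) := by
  have huc := S.uc' le_rfl hrR
  obtain ⟨s, hs, hmax⟩ := isCompact_Icc.exists_isMaxOn ⟨r, hr0, le_rfl⟩ huc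
  suffices H : u s ≤ max b (u r) from fun x hx => (hmax hx).trans H
  by_contra hcon
  push Not at hcon
  obtain ⟨c, hc1, hc2⟩ := exists_between hcon
  have hbc : b < c := (le_max_left _ _).trans_lt hc1
  have hrc : u r < c := (le_max_right _ _).trans_lt hc1
  have hsr : s < r := lt_of_le_of_ne hs.2 (by rintro rfl; linarith)
  have huc2 := S.uc' hs.1 hrR
  have hcl : IsCompact (Icc s r ∩ u ⁻¹' Iic c) :=
    isCompact_Icc.of_isClosed_subset (huc2.preimage_isClosed_of_isClosed isClosed_Icc isClosed_Iic)
      inter_subset_left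
  obtain ⟨t, ⟨ht, htc⟩, htmin⟩ := hcl.exists_isLeast ⟨r, ⟨hsr.le, le_rfl⟩, hrc.le⟩
  have htc' : u t ≤ c := htc
  have hab : ∀ x ∈ Ico s t, c < u x := by
    intro x hx
    by_contra hh
    push Not at hh
    exact absurd (htmin ⟨⟨hx.1, hx.2.le.trans ht.2⟩, hh⟩) (not_le.2 hx.2)
  have hPs : 0 ≤ s ^ N * φ s := by
    rcases hs.1.eq_or_lt with h | h
    · rw [← h, zero_pow (by omega)]; simp
    · have hl : IsLocalMax u s := hmax.isLocalMax (Icc_mem_nhds h hsr)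
      have := hl.hasDerivAt_eq_zero (S.du' ⟨h, hsr.trans hrR⟩)
      have hφ : φ s = 0 := by
        rcases mul_eq_zero.1 this with h' | h'
        · exact absurd h' h.ne'
        · exact h'
      rw [hφ]; simp
  have hP : ∀ x ∈ Ioo s t, 0 ≤ x * φ x := by
    intro x hx
    have h0x : 0 < x := hs.1.trans_lt hx.1
    have hxR : x < R := (hx.2.trans_le ht.2).trans hrR
    have := mvt_le (C := 0) hx.1.le (S.Pc hs.1 hxR)
      (fun y hy => S.dφ y ⟨hs.1.trans_lt hy.1, hy.2.trans hxR⟩) (fun y hy => by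
        have h0y : 0 < y := hs.1.trans_lt hy.1
        have := hb y ⟨h0y.le, (hy.2.trans (hx.2.trans_le ht.2)).le⟩
          (hbc.trans (hab y ⟨hy.1.le, hy.2.trans hx.2⟩))
        positivity)
    have h1 : 0 ≤ x ^ N * φ x := by linarith
    have h2 : 0 ≤ φ x := nonneg_of_mul_nonneg_right h1 (pow_pos h0x N)
    positivity
  have := mvt_le (C := 0) ht.1 (S.uc' hs.1 (ht.2.trans_lt hrR))
    (fun y hy => S.du' ⟨hs.1.trans_lt hy.1, hy.2.trans (ht.2.trans_lt hrR)⟩) hP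
  linarith

lemma travel {N : ℕ} (hN : 1 ≤ N) {R : ℝ} {u φ h f F : ℝ → ℝ} (S : Sol N R u φ h)
    {a T ε K t' μ r0 r1 : ℝ} (hR : 1 < R) (h0 : 1/2 ≤ r0) (h1 : r0 ≤ r1) (h2 : r1 ≤ 1)
    (hu0 : u r0 = K) (hm : MonotoneOn u (Icc r0 r1)) (hh : ∀ r ∈ Icc r0 r1, h r = f (u r))
    (hfn : ∀ t ≥ a, 0 ≤ f t) (hFd : ∀ t, HasDerivAt F (f t) t)
    (hFp : ∀ t ≥ T, 0 < F t) (hε : 0 < ε) (k : KOdata f F a T ε K t' μ) :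
    (1/2) ^ (N - 1) * (r1 - r0) ≤ 5 * ε := by
  have hFc : Continuous F := continuous_iff_continuousAt.2 fun t => (hFd t).continuousAt
  set c : ℝ := (1/2) ^ (N - 1) with hcdef
  have c0 : 0 < c := by positivity
  by_contra hcon
  push Not at hcon
  have hlt : r0 < r1 := by
    by_contra hh
    have : r1 = r0 := by linarith
    rw [this] at hcon; simp at hcon; linarith
  have huK : ∀ r ∈ Icc r0 r1, K ≤ u r := fun r hr => hu0 ▸ hm ⟨le_rfl, h1⟩ hr hr.1
  have pos : ∀ r ∈ Icc r0 r1, 0 < r := fun r hr => by linarith [hr.1]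
  have hRR : ∀ r ∈ Icc r0 r1, r < R := fun r hr => by linarith [hr.2]
  have hp0 : ∀ r ∈ Ioo r0 r1, 0 ≤ r * φ r := by
    intro r hr
    have hr' := Ioo_subset_Icc_self hr
    have := hm.derivWithin_nonneg (x := r)
    rwa [derivWithin_of_mem_nhds (Icc_mem_nhds hr.1 hr.2), (S.du' ⟨pos r hr', hRR r hr'⟩).deriv] at this
  have hφ0 : ∀ r ∈ Ioo r0 r1, 0 ≤ φ r := fun r hr =>
    nonneg_of_mul_nonneg_right (hp0 r hr) (pos r (Ioo_subset_Icc_self hr))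
  have hcr : ∀ r ∈ Icc r0 r1, c ≤ r ^ (N - 1) := fun r hr =>
    pow_le_pow_left₀ (by norm_num) (h0.trans hr.1) _
  have hsub : ∀ {x y}, x ∈ Icc r0 r1 → y ∈ Ioo r0 x → y ∈ Ioo r0 r1 := fun hx hy => ⟨hy.1, hy.2.trans_le hx.2⟩
  have main : ∀ r ∈ Ioo r0 r1, 2 * c ^ 2 * (F (u r) - F K) ≤ (r * φ r) ^ 2 := by
    intro r hr
    have hr' := Ioo_subset_Icc_self hr
    have hP := S.Pc (by linarith : 0 ≤ r0) (hRR r hr')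
    have hU := S.uc' (by linarith : 0 ≤ r0) (hRR r hr')
    have := mvt_le (C := 0) (f := fun r => (r ^ N * φ r) ^ 2 - 2 * c ^ 2 * F (u r))
      (f' := fun r => 2 * (r ^ N * φ r) * (r ^ (N-1) * h r) - 2 * c ^ 2 * (f (u r) * (r * φ r)))
      hr.1.le ((hP.pow 2).sub (continuousOn_const.mul (hFc.comp_continuousOn hU))) ?_ ?_
    · have e1 : r ^ N * φ r ≤ r * φ r := by
        apply mul_le_mul_of_nonneg_right _ (hφ0 r hr)
        exact pow_le_of_le_one (pos r hr').le (hr.2.le.trans h2) (by omega)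
      have e2 : 0 ≤ r ^ N * φ r := mul_nonneg (pow_nonneg (pos r hr').le _) (hφ0 r hr)
      have e3 := pow_le_pow_left₀ e2 e1 2
      simp only [hu0] at this
      nlinarith [sq_nonneg (r0 ^ N * φ r0)]
    · intro x hx
      have hx' := Ioo_subset_Icc_self (hsub hr' hx)
      have a1 := S.dφ x ⟨pos x hx', hRR x hx'⟩
      have a2 := (hFd (u x)).comp x (S.du' ⟨pos x hx', hRR x hx'⟩)
      have := (a1.pow 2).sub (a2.const_mul (2 * c ^ 2))
      refine this.congr_deriv ?_
      push_cast
      ring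
    · intro x hx
      have hx1 := hsub hr' hx
      have hx' := Ioo_subset_Icc_self hx1
      rw [hh x hx']
      have b1 : 0 ≤ f (u x) := hfn _ (k.aK.trans (huK x hx'))
      have b2 : c ^ 2 ≤ (x ^ (N-1)) ^ 2 := pow_le_pow_left₀ c0.le (hcr x hx') 2
      have b3 : x ^ N = x ^ (N-1) * x := by rw [← pow_succ]; congr 1; omega
      have b4 : 0 ≤ f (u x) * (x * φ x) := mul_nonneg b1 (hp0 x hx1)
      rw [b3]
      nlinarith
  have huK' : ∀ r ∈ Ioo r0 r1, K < u r := by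
    intro r hr
    by_contra hc
    push Not at hc
    have hr' := Ioo_subset_Icc_self hr
    have hK : ∀ x ∈ Icc r0 r, u x = K := fun x hx =>
      le_antisymm ((hm ⟨hx.1, hx.2.trans hr.2.le⟩ hr' hx.2).trans hc) (huK x ⟨hx.1, hx.2.trans hr.2.le⟩)
    obtain ⟨x, hx0, hxr⟩ := exists_between hr.1
    obtain ⟨y, hxy, hyr⟩ := exists_between hxr
    have hx1 : x ∈ Ioo r0 r1 := ⟨hx0, hxr.trans hr.2⟩
    have hy1 : y ∈ Ioo r0 r1 := ⟨hx0.trans hxy, hyr.trans hr.2⟩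
    have hyI := Ioo_subset_Icc_self hy1
    have := mvt_le (C := c * f K) hxy.le (S.Pc (pos x (Ioo_subset_Icc_self hx1)).le (hRR y hyI))
      (fun z hz => S.dφ z ⟨(pos x (Ioo_subset_Icc_self hx1)).trans hz.1, hz.2.trans (hRR y hyI)⟩) (by
        intro z hz
        have hzI : z ∈ Icc r0 r1 := ⟨(hx0.trans hz.1).le, (hz.2.trans hy1.2).le⟩
        rw [hh z hzI, hK z ⟨(hx0.trans hz.1).le, (hz.2.trans hyr).le⟩]
        exact mul_le_mul_of_nonneg_right (hcr z hzI) k.fK.le)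
    have hd := S.du' ⟨pos y hyI, hRR y hyI⟩
    have hd2 : HasDerivAt u 0 y := by
      refine (hasDerivAt_const y K).congr_of_eventuallyEq ?_
      filter_upwards [Icc_mem_nhds hy1.1 hyr] with z hz using hK z hz
    have hz := hd.unique hd2
    have hφy : φ y = 0 := by
      rcases mul_eq_zero.1 hz with h' | h'
      · exact absurd h' (pos y hyI).ne'
      · exact h'
    rw [hφy] at this
    have e1 : 0 ≤ x ^ N * φ x := mul_nonneg (pow_nonneg (pos x (Ioo_subset_Icc_self hx1)).le _) (hφ0 x hx1)
    have e2 : 0 < c * f K * (y - x) := mul_pos (mul_pos c0 k.fK) (sub_pos.2 hxy)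
    simp at this
    linarith
  set x0 := r0 + 3 * ε / c with hx0
  have hcx : c * (x0 - r0) = 3 * ε := by rw [hx0]; field_simp; ring
  have hx0I : x0 ∈ Ioo r0 r1 := by
    constructor
    · rw [hx0]; have : 0 < 3 * ε / c := by positivity
      linarith
    · by_contra hc
      push Not at hc
      nlinarith
  have hx0' := Ioo_subset_Icc_self hx0I
  have hsμ : 0 < Real.sqrt μ := Real.sqrt_pos.2 k.μ0
  have ut : t' ≤ u x0 := by
    by_contra hc
    push Not at hc
    have := mvt_le (C := c * Real.sqrt μ / 2) (f := fun r => Real.sqrt (u r - K))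
      (f' := fun r => (r * φ r) / (2 * Real.sqrt (u r - K))) hx0I.1.le
      (((S.uc' (by linarith : 0 ≤ r0) (hRR x0 hx0')).sub continuousOn_const).sqrt) ?_ ?_
    · simp only [hu0, sub_self, Real.sqrt_zero, sub_zero] at this
      have e1 : Real.sqrt (u x0 - K) ≤ Real.sqrt (t' - K) := Real.sqrt_le_sqrt (by linarith)
      have e2 := k.sq
      nlinarith
    · intro r hr
      have hr1 := hsub hx0' hr
      have hr' := Ioo_subset_Icc_self hr1
      exact ((S.du' ⟨pos r hr', hRR r hr'⟩).sub_const K).sqrt (sub_pos.2 (huK' r hr1)).ne'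
    · intro r hr
      have hr1 := hsub hx0' hr
      have hq : 0 < Real.sqrt (u r - K) := Real.sqrt_pos.2 (sub_pos.2 (huK' r hr1))
      have hl := k.lin (u r) (huK' r hr1).le
      have : c * Real.sqrt μ * Real.sqrt (u r - K) ≤ r * φ r := by
        apply le_of_sq_le_sq _ (hp0 r hr1)
        rw [mul_pow, mul_pow, Real.sq_sqrt k.μ0.le, Real.sq_sqrt (sub_pos.2 (huK' r hr1)).le]
        have := main r hr1
        have c2 : 0 < c ^ 2 := by positivity
        have : 0 ≤ μ * (u r - K) := mul_nonneg k.μ0.le (sub_pos.2 (huK' r hr1)).le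
        nlinarith
      rw [le_div_iff₀ (by positivity)]
      linarith
  have utt : ∀ r ∈ Icc x0 r1, t' ≤ u r := fun r hr => ut.trans (hm hx0' ⟨hx0I.1.le.trans hr.1, hr.2⟩ hr.1)
  have hTt : T ≤ t' := k.TK.trans k.Kt
  have hGd : ∀ t ≥ t', HasDerivAt (fun t => ∫ s in t'..t, (Real.sqrt (F s))⁻¹) (Real.sqrt (F t))⁻¹ t := by
    intro t ht
    apply intervalIntegral.integral_hasDerivAt_right
    · apply ContinuousOn.intervalIntegrable
      rw [uIcc_of_le ht]
      refine hFc.sqrt.continuousOn.inv₀ fun x hx => (Real.sqrt_pos.2 (hFp x (hTt.trans hx.1))).ne'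
    · exact (hFc.sqrt.measurable.inv).stronglyMeasurable.stronglyMeasurableAtFilter
    · exact hFc.sqrt.continuousAt.inv₀ (Real.sqrt_pos.2 (hFp t (hTt.trans ht))).ne'
  have hfin := mvt_le (C := c) (f := fun r => ∫ s in t'..(u r), (Real.sqrt (F s))⁻¹)
      (f' := fun r => (Real.sqrt (F (u r)))⁻¹ * (r * φ r)) hx0I.2.le ?_ ?_ ?_
  · have e1 := k.tail (u r1) (utt r1 ⟨hx0I.2.le, le_rfl⟩)
    have e2 : 0 ≤ ∫ s in t'..(u x0), (Real.sqrt (F s))⁻¹ :=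
      intervalIntegral.integral_nonneg ut fun s _ => inv_nonneg.2 (Real.sqrt_nonneg _)
    have e3 : c * (r1 - x0) ≤ ε := by linarith
    nlinarith
  · intro r hr
    exact ((hGd (u r) (utt r hr)).continuousAt.comp_continuousWithinAt
      (f := u) (S.uc' (pos x0 hx0').le (hRR r1 ⟨h1, le_rfl⟩) r hr))
  · intro r hr
    have hr' : r ∈ Icc r0 r1 := ⟨(hx0I.1.trans hr.1).le, hr.2.le⟩
    exact (hGd (u r) (utt r (Ioo_subset_Icc_self hr))).comp r (S.du' ⟨pos r hr', hRR r hr'⟩)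
  · intro r hr
    have hr1 : r ∈ Ioo r0 r1 := ⟨hx0I.1.trans hr.1, hr.2⟩
    have hut := utt r (Ioo_subset_Icc_self hr)
    have hFu := hFp (u r) (hTt.trans hut)
    have hs := Real.sqrt_pos.2 hFu
    have : c * Real.sqrt (F (u r)) ≤ r * φ r := by
      apply le_of_sq_le_sq _ (hp0 r hr1)
      rw [mul_pow, Real.sq_sqrt hFu.le]
      have e1 := main r hr1
      have e2 := k.half (u r) hut
      have c2 : 0 < c ^ 2 := by positivity
      nlinarith
    rw [inv_mul_eq_div, le_div_iff₀ hs]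
    exact this


lemma mono_after {N : ℕ} (hN : 1 ≤ N) {R : ℝ} {u φ h : ℝ → ℝ} (S : Sol N R u φ h) {b r0 : ℝ}
    (hR : 1 < R) (hb : ∀ s ∈ Icc 0 1, b < u s → 0 ≤ h s) (h0 : 0 ≤ r0) (hbu : b < u r0) :
    MonotoneOn u (Icc r0 1) := by
  have key : ∀ x y, 0 ≤ x → x ≤ y → y ≤ 1 → b < u x → u x ≤ u y := by
    intro x y hx hxy hy hbx
    have := maxp hN S (hx.trans hxy) (hy.trans_lt hR)
      (fun s hs => hb s ⟨hs.1, hs.2.trans hy⟩) x ⟨hx, hxy⟩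
    rcases le_max_iff.1 this with h' | h'
    · linarith
    · exact h'
  intro x hx y hy hxy
  exact key x y (h0.trans hx.1) hxy hy.2 (hbu.trans_le (key r0 x h0 hx.1 hx.2 hbu))

structure Ap (N : ℕ) (f w u : ℝ → ℝ) (n K : ℝ) : Prop where
  uc : Continuous u
  S : ∃ φ h, Sol N (3/2) u φ h ∧ ∀ r ∈ Icc (0:ℝ) 1, h r = f (u r)
  AAe : ∃ α, ∀ r ∈ Icc (0:ℝ) 1, u r = α + AA N (fun σ => f (u σ)) r
  u1 : u 1 = n
  wu : ∀ r ∈ Icc (0:ℝ) 1, w r ≤ u r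
  uK : u (1/2) ≤ K

lemma exists_approx {N : ℕ} (hN : 1 ≤ N) {f F : ℝ → ℝ} (hf : Continuous f)
    (vlow : EuclideanSpace ℝ (Fin N) → ℝ)
    (hvcont : ContinuousOn vlow (closedBall 0 1))
    (hvreg : ContDiffOn ℝ 2 vlow (ball 0 1))
    (hvsub : ∀ x ∈ ball (0 : EuclideanSpace ℝ (Fin N)) 1, f (vlow x) ≤ lap vlow x)
    {w : ℝ → ℝ} (hwc : Continuous w)
    (hw1 : ∀ x ∈ closedBall (0 : EuclideanSpace ℝ (Fin N)) 1, vlow x ≤ w ‖x‖)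
    (hw2 : ∀ r ∈ Icc (0:ℝ) 1, ∃ y : EuclideanSpace ℝ (Fin N), ‖y‖ = r ∧ vlow y = w r)
    {m b a T ε K t' μ n : ℝ} (hm : ∀ r, m ≤ w r) (hM : ∀ r, w r ≤ b)
    (hfn : ∀ t ≥ a, 0 ≤ f t) (hFd : ∀ t, HasDerivAt F (f t) t) (hab : a ≤ b)
    (hFp : ∀ t ≥ T, 0 < F t) (hε : 0 < ε) (k : KOdata f F a T ε K t' μ) (hbK : b < K)
    (hε2 : 5 * ε < (1/2) ^ (N-1) * (1/2)) (hKn : K < n) :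
    ∃ u, Ap N f w u n K := by
  have hmb : m ≤ b := (hm 0).trans (hM 0)
  set g : ℝ → ℝ → ℝ := fun r t => f (min (max t (w r)) n) - min 1 (max (w r - t) 0) with hg
  have hgc : Continuous (Function.uncurry g) := by
    simp only [hg, Function.uncurry_def]; fun_prop
  obtain ⟨C, hC⟩ := (isCompact_Icc (a := m) (b := n)).exists_bound_of_continuousOn hf.continuousOn
  have hgC : ∀ r t, |g r t| ≤ C + 1 := by
    intro r t
    have h1 := hC (min (max t (w r)) n)
      ⟨le_min ((hm r).trans (le_max_right _ _)) (by linarith), min_le_right _ _⟩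
    rw [Real.norm_eq_abs, abs_le] at h1
    have h2 : 0 ≤ min 1 (max (w r - t) 0) := le_min zero_le_one (le_max_right _ _)
    have h3 : min 1 (max (w r - t) 0) ≤ 1 := min_le_left _ _
    simp only [hg]
    rw [abs_le]
    constructor <;> linarith [h1.1, h1.2]
  have gbig : ∀ r t, w r ≤ t → t ≤ n → g r t = f t := by
    intro r t h1 h2
    simp only [hg]
    rw [max_eq_left h1, min_eq_left h2, max_eq_right (by linarith), min_eq_right zero_le_one, sub_zero]
  have gnn : ∀ r t, b < t → 0 ≤ g r t := by
    intro r t ht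
    simp only [hg]
    rw [max_eq_left ((hM r).trans ht.le), max_eq_right (by linarith [hM r]), min_eq_right zero_le_one, sub_zero]
    exact hfn _ (le_min (by linarith) (by linarith))
  obtain ⟨α, u, huc, hAA, hmax⟩ := exists_shoot N g hgc (C + 1) hgC n K
  have hhc : Continuous (fun σ => g σ (u σ)) := hgc.comp (continuous_id.prodMk huc)
  have S : Sol N (3/2) u (Phi N (fun σ => g σ (u σ))) (fun σ => g σ (u σ)) :=
    sol_of_AA N hN (by norm_num) hhc.continuousOn (fun r hr => hAA r ⟨hr.1, hr.2.le⟩)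
  have hR : (1:ℝ) < 3/2 := by norm_num
  have hb : ∀ s ∈ Icc (0:ℝ) 1, b < u s → 0 ≤ g s (u s) := fun s _ => gnn s (u s)
  have hA : u 1 - n ≤ 0 := hmax ▸ le_max_left _ _
  have hB : u (1/2) - K ≤ 0 := hmax ▸ le_max_right _ _
  have hu1 : u 1 = n := by
    rcases max_choice (u 1 - n) (u (1/2) - K) with h | h
    · linarith
    · exfalso
      have hK : u (1/2) = K := by linarith
      have hmono := mono_after hN S hR hb (by norm_num : (0:ℝ) ≤ 1/2) (by linarith)
      have := travel hN S hR le_rfl (by norm_num) le_rfl hK hmono (f := f) (fun r hr => by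
        have h1 := hmono ⟨le_rfl, by norm_num⟩ hr hr.1
        have h2 := hmono hr ⟨by norm_num, le_rfl⟩ hr.2
        exact gbig r (u r) (by linarith [hM r]) (by linarith)) hfn hFd hFp hε k
      norm_num at this hε2
      linarith
  have hun : ∀ r ∈ Icc (0:ℝ) 1, u r ≤ n := by
    intro r hr
    have := maxp hN S zero_le_one hR hb r hr
    rwa [hu1, max_eq_right (by linarith)] at this
  have hwu := comparison_s14 hN f vlow hvcont hvreg hvsub w hw1 hw2 hR S (by
    intro r hr hlt
    simp only [hg]
    rw [max_eq_right hlt.le, min_eq_left (by linarith [hM r])]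
    have : 0 < min 1 (max (w r - u r) 0) := lt_min zero_lt_one (lt_max_of_lt_left (by linarith))
    linarith) (by linarith [hM 1])
  have hgf : ∀ r ∈ Icc (0:ℝ) 1, g r (u r) = f (u r) := fun r hr => gbig r (u r) (hwu r hr) (hun r hr)
  refine ⟨u, huc, ⟨_, _, S, hgf⟩, ⟨α, fun r hr => ?_⟩, hu1, hwu, by linarith⟩
  rw [hAA r ⟨hr.1, hr.2.trans (by norm_num)⟩]
  congr 1
  exact AA_congr N hr.1 fun σ hσ => hgf σ ⟨hσ.1, hσ.2.trans hr.2⟩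

lemma Ap.upper {N : ℕ} (hN : 1 ≤ N) {f F w u : ℝ → ℝ} {n K : ℝ} (A : Ap N f w u n K)
    {b a T ε K' t' μ ρ : ℝ} (hfn : ∀ t ≥ a, 0 ≤ f t) (hFd : ∀ t, HasDerivAt F (f t) t) (hab : a ≤ b)
    (hFp : ∀ t ≥ T, 0 < F t) (hε : 0 < ε) (k : KOdata f F a T ε K' t' μ) (hbK : b < K') (hKK : K ≤ K')
    (hρ : 1/2 ≤ ρ) (hρ1 : ρ < 1)
    (hε2 : 5 * ε < (1/2) ^ (N-1) * (1 - ρ)) : ∀ r ∈ Icc 0 ρ, u r ≤ K' := by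
  obtain ⟨φ, h, S, hh⟩ := A.S
  have hR : (1:ℝ) < 3/2 := by norm_num
  have hb : ∀ s ∈ Icc (0:ℝ) 1, b < u s → 0 ≤ h s := fun s hs hbs => by
    rw [hh s hs]; exact hfn _ (by linarith)
  have hc0 : (0:ℝ) < (1/2) ^ (N-1) := by positivity
  have h1 : u ρ ≤ K' := by
    by_contra hcon
    push Not at hcon
    obtain ⟨r, hr, hrK⟩ := intermediate_value_Icc hρ A.uc.continuousOn ⟨A.uK.trans hKK, hcon.le⟩
    have hmono := mono_after hN S hR hb (by linarith [hr.1] : (0:ℝ) ≤ r) (by linarith)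
    have := travel hN S hR hr.1 (hr.2.trans hρ1.le) le_rfl hrK hmono (f := f)
      (fun x hx => hh x ⟨by linarith [hr.1, hx.1], hx.2⟩) hfn hFd hFp hε k
    nlinarith [hr.2]
  intro r hr
  have := maxp hN S (by linarith) (by linarith) (fun s hs => hb s ⟨hs.1, hs.2.trans hρ1.le⟩) r hr
  exact this.trans (max_le hbK.le h1)

lemma Ap.lower {N : ℕ} (hN : 1 ≤ N) {f w u : ℝ → ℝ} {n K : ℝ} (A : Ap N f w u n K)
    {b a m K0 C r : ℝ} (hfn : ∀ t ≥ a, 0 ≤ f t) (hab : a ≤ b) (hm : ∀ r, m ≤ w r) (hmb : m ≤ b)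
    (hbK : b ≤ K0) (hn : K0 + 1 ≤ n) (hC : ∀ t ∈ Icc m (K0+1), |f t| ≤ C) (hr : 1/2 ≤ r) (hr1 : r ≤ 1)
    (hD : (2 * C + 2 * (K0 - m) + 1) * (1 - r) < (1/2) ^ (N-1)) : K0 < u r := by
  obtain ⟨φ, h, S, hh⟩ := A.S
  have hC0 : 0 ≤ C := (abs_nonneg _).trans (hC m ⟨le_rfl, by linarith⟩)
  have hb : ∀ s ∈ Icc (0:ℝ) 1, b < u s → 0 ≤ h s := fun s hs hbs => by
    rw [hh s hs]; exact hfn _ (by linarith)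
  by_contra hcon
  push Not at hcon
  obtain ⟨r', hr', hrK⟩ := intermediate_value_Icc hr1 A.uc.continuousOn
    (⟨hcon, by rw [A.u1]; linarith⟩ : K0 ∈ Icc (u r) (u 1))
  obtain ⟨t, ht, htK⟩ := intermediate_value_Icc hr'.2 A.uc.continuousOn
    (⟨by rw [hrK]; linarith, by rw [A.u1]; linarith⟩ : K0 + 1 ∈ Icc (u r') (u 1))
  have hr'0 : 0 < r' := by linarith [hr'.1]
  have hut : ∀ s ∈ Icc 0 t, |h s| ≤ C := by
    intro s hs
    have hs1 : s ∈ Icc (0:ℝ) 1 := ⟨hs.1, hs.2.trans ht.2⟩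
    have := maxp hN S (hs.1.trans hs.2) (by linarith [ht.2])
      (fun x hx => hb x ⟨hx.1, hx.2.trans ht.2⟩) s hs
    rw [htK, max_eq_right (by linarith)] at this
    rw [hh s hs1]
    exact hC _ ⟨(hm s).trans (A.wu s hs1), this⟩
  have hPd : ∀ s ∈ Ioo 0 t, |s ^ (N-1) * h s| ≤ C := by
    intro s hs
    rw [abs_mul, abs_of_nonneg (pow_nonneg hs.1.le _)]
    have h1 : s ^ (N-1) ≤ 1 := pow_le_one₀ hs.1.le (hs.2.le.trans ht.2)
    have h2 := hut s ⟨hs.1.le, hs.2.le⟩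
    nlinarith [abs_nonneg (h s), pow_nonneg hs.1.le (N-1)]
  have hlip : ∀ x y, 0 < x → x ≤ y → y ≤ t → y ^ N * φ y ≤ x ^ N * φ x + C := by
    intro x y hx hxy hyt
    have hyR : y < 3/2 := by linarith [ht.2]
    have := mvt_le (C := -C) hxy (S.Pc hx.le hyR).neg
      (fun z hz => (S.dφ z ⟨hx.trans hz.1, hz.2.trans hyR⟩).neg) (fun z hz => by
        have := hPd z ⟨hx.trans hz.1, hz.2.trans_le hyt⟩
        linarith [(abs_le.1 this).2])
    simp only [Pi.neg_apply] at this
    have : C * (y - x) ≤ C := by nlinarith [ht.2]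
    linarith
  have hP0 : r' ^ N * φ r' ≤ C + 2 * (K0 - m) := by
    by_contra hc
    push Not at hc
    have := mvt_le (C := r' ^ N * φ r' - C) hr'0.le (S.uc' le_rfl (by linarith [hr'.2]))
      (fun z hz => S.du' ⟨hz.1, by linarith [hr'.2, hz.2]⟩) (fun z hz => by
        have h1 := hlip z r' hz.1 hz.2.le ht.1
        have h2 : 0 < z ^ N * φ z := by linarith
        have h3 : 0 < φ z := pos_of_mul_pos_right h2 (pow_nonneg hz.1.le N)
        have h4 : z ^ N ≤ z := pow_le_of_le_one hz.1.le (hz.2.le.trans hr'.2) (by omega)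
        nlinarith)
    have h0 := (hm 0).trans (A.wu 0 ⟨le_rfl, zero_le_one⟩)
    rw [hrK] at this
    nlinarith [hr'.1]
  have c0 : (0:ℝ) < (1/2) ^ (N-1) := by positivity
  set c : ℝ := (1/2) ^ (N-1) with hc
  set D := 2 * C + 2 * (K0 - m) + 1 with hDd
  have D0 : 0 < D := by rw [hDd]; linarith
  have := mvt_le (C := -(D / c)) ht.1 (S.uc' hr'0.le (by linarith [ht.2])).neg
      (fun z hz => (S.du' ⟨hr'0.trans hz.1, by linarith [ht.2, hz.2]⟩).neg) (fun z hz => by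
        have hz0 : 0 < z := hr'0.trans hz.1
        have h1 := hlip r' z hr'0 hz.1.le hz.2.le
        have h2 : z ^ N * φ z ≤ D := by linarith
        have b3 : z ^ N = z ^ (N-1) * z := by rw [← pow_succ]; congr 1; omega
        have h3 : c ≤ z ^ (N-1) := pow_le_pow_left₀ (by norm_num) (by linarith [hr'.1, hz.1]) _
        apply neg_le_neg
        rw [le_div_iff₀ c0]
        rcases le_total 0 (z * φ z) with h4 | h4
        · rw [b3] at h2; nlinarith
        · nlinarith)
  simp only [Pi.neg_apply, hrK, htK] at this
  have h5 : 1 ≤ D / c * (t - r') := by linarith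
  have h6 : D / c * (t - r') ≤ D / c * (1 - r) :=
    mul_le_mul_of_nonneg_left (by linarith [ht.2, hr'.1]) (by positivity)
  have h7 : D / c * (1 - r) < 1 := by rw [div_mul_eq_mul_div, div_lt_one c0]; exact hD
  linarith

theorem statement14 {N : ℕ} (hN : 1 ≤ N) (f : ℝ → ℝ) (hf : Continuous f)
    -- condition (2)
    (a : ℝ) (ha : 0 < f a) (hf0 : ∀ t > a, 0 ≤ f t)
    (F : ℝ → ℝ) (hF : ∀ t, F t = ∫ s in a..t, f s)
    -- condition (3): Keller-Osserman
    (hKO : ∃ T, (∀ t ≥ T, 0 < F t) ∧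
      IntegrableOn (fun t => (Real.sqrt (F t))⁻¹) (Ici T))
    -- v̲ is a continuous (classical C²) subsolution: Δv̲ ≥ f(v̲) in B
    (vlow : EuclideanSpace ℝ (Fin N) → ℝ)
    (hvcont : ContinuousOn vlow (closedBall 0 1))
    (hvreg : ContDiffOn ℝ 2 vlow (ball 0 1))
    (hvsub : ∀ x ∈ ball (0 : EuclideanSpace ℝ (Fin N)) 1, f (vlow x) ≤ lap vlow x) :
    -- there is a radial blow-up solution V ≥ v̲
    ∃ V : EuclideanSpace ℝ (Fin N) → ℝ, IsBlowUp f V ∧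
      (∀ x ∈ ball (0 : EuclideanSpace ℝ (Fin N)) 1,
        ∀ y ∈ ball (0 : EuclideanSpace ℝ (Fin N)) 1, ‖x‖ = ‖y‖ → V x = V y) ∧
      ∀ x ∈ ball (0 : EuclideanSpace ℝ (Fin N)) 1, vlow x ≤ V x := by
  obtain ⟨T, hFp, hI⟩ := hKO
  have hFd : ∀ t, HasDerivAt F (f t) t := by
    intro t
    have : F = fun t => ∫ s in a..t, f s := funext hF
    rw [this]
    exact intervalIntegral.integral_hasDerivAt_right (hf.intervalIntegrable _ _)
      hf.aestronglyMeasurable.stronglyMeasurableAtFilter hf.continuousAt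
  have hfn : ∀ t ≥ a, 0 ≤ f t := by
    intro t ht
    rcases eq_or_lt_of_le ht with h | h
    · rw [← h]; exact ha.le
    · exact hf0 t h
  have hFc : Continuous F := continuous_iff_continuousAt.2 fun t => (hFd t).continuousAt
  have hFm : MonotoneOn F (Ici a) := by
    intro x hx y hy hxy
    have := mvt_le (C := 0) hxy hFc.continuousOn (fun z _ => hFd z)
      (fun z hz => hfn z ((mem_Ici.1 hx).trans hz.1.le))
    linarith
  obtain ⟨w, hwc, hw1, hw2, m, M, hmM⟩ := exists_w hN vlow hvcont
  set b := max a M with hbdef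
  have hm : ∀ r, m ≤ w r := fun r => (hmM r).1
  have hM : ∀ r, w r ≤ b := fun r => (hmM r).2.trans (le_max_right _ _)
  have hab : a ≤ b := le_max_left _ _
  have hmb : m ≤ b := (hm 0).trans (hM 0)
  have c0 : (0:ℝ) < (1/2) ^ (N-1) := by positivity
  set c : ℝ := (1/2) ^ (N-1) with hc
  obtain ⟨K, t', μ, hbK1, k⟩ := exists_KO (f := f) hFd hFm hFp hI (ε := c / 20) (by positivity) (b + 1)
  have hbK : b < K := by linarith
  have hex : ∀ j : ℕ, ∃ u, Ap N f w u (K + 1 + j) K := fun j =>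
    exists_approx hN hf vlow hvcont hvreg hvsub hwc hw1 hw2 hm hM hfn hFd hab hFp
      (by positivity) k hbK (by rw [← hc]; linarith) (by
        have : (0:ℝ) ≤ j := Nat.cast_nonneg j
        linarith)
  choose u hu using hex
  choose α hα using fun j => (hu j).AAe
  have hup : ∀ ρ, 0 ≤ ρ → ρ < 1 → ∃ K', ∀ j, ∀ r ∈ Icc 0 ρ, u j r ≤ K' := by
    intro ρ _ hρ1
    set ρ' := max (1/2) ρ with hρ'
    have hρ'1 : ρ' < 1 := max_lt (by norm_num) hρ1
    have hd : 0 < 1 - ρ' := by linarith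
    obtain ⟨K', t1, μ1, hK1, k1⟩ := exists_KO (f := f) hFd hFm hFp hI (ε := c * (1 - ρ') / 6)
      (by positivity) K
    refine ⟨K', fun j r hr => ?_⟩
    refine (hu j).upper hN hfn hFd hab hFp (by positivity) k1 (by linarith) hK1 (le_max_left _ _) hρ'1 ?_ r
      ⟨hr.1, hr.2.trans (le_max_right _ _)⟩
    rw [← hc]
    nlinarith [mul_pos c0 hd]
  obtain ⟨ψ, hψ, v, hvc, hlim, hk⟩ := limit_lemma N one_pos u (fun j r => f (u j r)) α
    (fun j => hf.comp (hu j).uc) (fun j r hr => hα j r ⟨hr.1, hr.2.le⟩) (by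
      intro ρ h0 h1
      obtain ⟨K', hK'⟩ := hup ρ h0 h1
      obtain ⟨C, hC⟩ := (isCompact_Icc (a := m) (b := K')).exists_bound_of_continuousOn hf.continuousOn
      refine ⟨max (max |m| |K'|) C, Eventually.of_forall fun j r hr => ?_⟩
      have hl : m ≤ u j r := (hm r).trans ((hu j).wu r ⟨hr.1, hr.2.trans h1.le⟩)
      exact ⟨(abs_le_max_abs_abs hl (hK' j r hr)).trans (le_max_left _ _),
        (hC _ ⟨hl, hK' j r hr⟩).trans (le_max_right _ _)⟩)
  have hvAA := hk (fun r => f (v r)) (fun r hr => (hf.tendsto _).comp (hlim r hr))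
  have S : Sol N 1 v _ (fun r => f (v r)) :=
    sol_of_AA N hN one_pos (hf.comp_continuousOn hvc) hvAA
  obtain ⟨hC2, hlap⟩ := S.radial hN one_pos
  have hwv : ∀ r ∈ Ico (0:ℝ) 1, w r ≤ v r := fun r hr =>
    ge_of_tendsto (hlim r hr) (Eventually.of_forall fun j => (hu (ψ j)).wu r ⟨hr.1, hr.2.le⟩)
  refine ⟨fun x => v ‖x‖, ⟨hC2, hlap, ?_⟩, ?_, ?_⟩
  · intro x₀ hx₀
    rw [Filter.tendsto_atTop]
    intro B
    set K0 := max B b with hK0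
    obtain ⟨C, hC⟩ := (isCompact_Icc (a := m) (b := K0 + 1)).exists_bound_of_continuousOn hf.continuousOn
    have hev : ∀ᶠ x in 𝓝 x₀, 1/2 < ‖x‖ ∧ (2 * C + 2 * (K0 - m) + 1) * (1 - ‖x‖) < c := by
      apply Filter.Eventually.and
      · exact continuous_norm.continuousAt.eventually_const_lt (by simp only [hx₀]; norm_num)
      · have hcc : Continuous fun x : EuclideanSpace ℝ (Fin N) =>
          (2 * C + 2 * (K0 - m) + 1) * (1 - ‖x‖) := by fun_prop
        exact hcc.continuousAt.eventually_lt_const (by simp [hx₀, c0])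
    filter_upwards [nhdsWithin_le_nhds hev, self_mem_nhdsWithin] with x hx hxb
    have hx1 : ‖x‖ < 1 := mem_ball_zero_iff.1 hxb
    refine (le_max_left B b).trans (ge_of_tendsto (hlim ‖x‖ ⟨norm_nonneg _, hx1⟩) ?_)
    have hj : ∀ᶠ j : ℕ in atTop, K0 + 1 ≤ K + 1 + (ψ j : ℝ) := by
      have := (tendsto_natCast_atTop_atTop (R := ℝ)).comp hψ.tendsto_atTop
      filter_upwards [this.eventually_ge_atTop (K0 - K)] with j hj
      simp only [Function.comp] at hj
      linarith
    filter_upwards [hj] with j hj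
    exact ((hu (ψ j)).lower hN hfn hab hm hmb (le_max_right _ _) hj hC hx.1.le hx1.le hx.2).le
  · intro x _ y _ hxy
    simp only [hxy]
  · intro x hx
    have hx1 : ‖x‖ < 1 := mem_ball_zero_iff.1 hx
    exact (hw1 x (ball_subset_closedBall hx)).trans (hwv _ ⟨norm_nonneg _, hx1⟩)
end

section
/- Let N ≥ 1 and let f ∈ C¹(ℝ) satisfy conditions (2) and (3). Let u : (r₀,1) → ℝ be a strictly increasing C² solution of u'' + ((N−1)/r) u' = f(u) with u(r) → +∞ as r → 1⁻. Set v = u' and define g as a function of the variable u (via the change of variables u = u(r)) by g = −v²/2 + F(u). Then g(u)/F(u) → 0 as u → +∞, and g(u)/((N−1) G(u)) → 1 as u → +∞, where G is any antiderivative of √(2F) with G(u) → +∞ (for N = 1 the second statement reads g is bounded relative to G after multiplying by N−1, i.e. g → a constant). -/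
open MeasureTheory Filter Metric Set Topology


lemma aux_lhop (φ ψ ψ' q : ℝ → ℝ)
    (h1 : ∀ᶠ r in 𝓝[<] (1 : ℝ), HasDerivAt φ (q r * ψ' r) r)
    (h2 : ∀ᶠ r in 𝓝[<] (1 : ℝ), HasDerivAt ψ (ψ' r) r)
    (h3 : ∀ᶠ r in 𝓝[<] (1 : ℝ), 0 ≤ ψ' r)
    (hq : Tendsto q (𝓝[<] (1 : ℝ)) (𝓝 1)) (hψ : Tendsto ψ (𝓝[<] (1 : ℝ)) atTop) :
    Tendsto (fun r => φ r / ψ r) (𝓝[<] (1 : ℝ)) (𝓝 1) := by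
  rw [Metric.tendsto_nhds]
  intro ε hε
  have h4 := (Metric.tendsto_nhds.1 hq) (ε / 2) (by positivity)
  have hall := h1.and (h2.and (h3.and h4))
  obtain ⟨r₁, hr₁, H⟩ := (mem_nhdsLT_iff_exists_Ioo_subset).1 hall
  have hr₁' : r₁ < 1 := hr₁
  obtain ⟨s, hs1, hs2⟩ := exists_between hr₁'
  set C := |φ s - ψ s| + ε / 2 * |ψ s| with hC
  have hmem : Ioo s 1 ∈ 𝓝[<] (1 : ℝ) := Ioo_mem_nhdsLT hs2
  filter_upwards [hmem, hψ.eventually_gt_atTop (2 * C / ε), hψ.eventually_gt_atTop 0]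
    with r hr hr2 hr3
  have key : ∀ x ∈ Icc s r, HasDerivAt φ (q x * ψ' x) x ∧ HasDerivAt ψ (ψ' x) x ∧ 0 ≤ ψ' x ∧
      dist (q x) 1 < ε / 2 := fun x hx => H ⟨by linarith [hx.1], by linarith [hx.2, hr.2]⟩
  have A : MonotoneOn (fun x => ε / 2 * ψ x - (φ x - ψ x)) (Icc s r) := by
    apply monotoneOn_of_hasDerivWithinAt_nonneg (convex_Icc s r)
      (f' := fun x => ε / 2 * ψ' x - (q x * ψ' x - ψ' x))
    · intro x hx
      obtain ⟨k1, k2, -, -⟩ := key x hx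
      exact ((k2.const_mul _).sub (k1.sub k2)).continuousAt.continuousWithinAt
    · intro x hx
      obtain ⟨k1, k2, -, -⟩ := key x (interior_subset hx)
      exact ((k2.const_mul _).sub (k1.sub k2)).hasDerivWithinAt
    · intro x hx
      obtain ⟨-, -, k3, k4⟩ := key x (interior_subset hx)
      rw [Real.dist_eq, abs_lt] at k4
      nlinarith
  have B : MonotoneOn (fun x => ε / 2 * ψ x + (φ x - ψ x)) (Icc s r) := by
    apply monotoneOn_of_hasDerivWithinAt_nonneg (convex_Icc s r)
      (f' := fun x => ε / 2 * ψ' x + (q x * ψ' x - ψ' x))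
    · intro x hx
      obtain ⟨k1, k2, -, -⟩ := key x hx
      exact ((k2.const_mul _).add (k1.sub k2)).continuousAt.continuousWithinAt
    · intro x hx
      obtain ⟨k1, k2, -, -⟩ := key x (interior_subset hx)
      exact ((k2.const_mul _).add (k1.sub k2)).hasDerivWithinAt
    · intro x hx
      obtain ⟨-, -, k3, k4⟩ := key x (interior_subset hx)
      rw [Real.dist_eq, abs_lt] at k4
      nlinarith
  have hsr : s ≤ r := hr.1.le
  have A' := A (left_mem_Icc.2 hsr) (right_mem_Icc.2 hsr) hsr
  have B' := B (left_mem_Icc.2 hsr) (right_mem_Icc.2 hsr) hsr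
  simp only at A' B'
  have hCψ : C < ε / 2 * ψ r := by
    rw [div_lt_iff₀ hε] at hr2
    linarith
  have e1 : φ r / ψ r - 1 = (φ r - ψ r) / ψ r := by field_simp
  rw [Real.dist_eq, e1, abs_div, abs_of_pos hr3, div_lt_iff₀ hr3, abs_lt]
  have a1 := neg_abs_le (φ s - ψ s)
  have a2 := le_abs_self (φ s - ψ s)
  have a3 : ε / 2 * -|ψ s| ≤ ε / 2 * ψ s :=
    mul_le_mul_of_nonneg_left (neg_abs_le _) (by positivity)
  constructor <;> linarith

lemma aux_KO (F : ℝ → ℝ) (a T : ℝ) (hm : MonotoneOn F (Ici a)) (hp : ∀ t ≥ T, 0 < F t)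
    (hI : IntegrableOn (fun t => (Real.sqrt (F t))⁻¹) (Ici T)) :
    Tendsto (fun t => t / Real.sqrt (F t)) atTop (𝓝 0) := by
  set h := fun t => (Real.sqrt (F t))⁻¹ with hh
  have hI' : IntegrableOn h (Ioi T) := hI.mono_set Ioi_subset_Ici_self
  have l1 : Tendsto (fun t : ℝ => ∫ x in T..t, h x) atTop (𝓝 (∫ x in Ioi T, h x)) :=
    intervalIntegral_tendsto_integral_Ioi T hI' tendsto_id
  have hhalf : Tendsto (fun t : ℝ => t / 2) atTop atTop := tendsto_id.atTop_div_const (by norm_num)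
  have l2 := l1.comp hhalf
  have l3 := (l1.sub l2).const_mul 2
  rw [sub_self, mul_zero] at l3
  refine tendsto_of_tendsto_of_tendsto_of_le_of_le' tendsto_const_nhds l3 ?_ ?_
  · filter_upwards [eventually_ge_atTop 0] with t ht
    positivity
  · filter_upwards [eventually_ge_atTop 0, hhalf.eventually_ge_atTop T,
      hhalf.eventually_ge_atTop a] with t h0 hT ha
    have ii : ∀ x y, T ≤ x → T ≤ y → IntervalIntegrable h volume x y := by
      intro x y hx hy
      apply IntegrableOn.intervalIntegrable
      apply hI.mono_set
      intro z hz
      exact (le_min hx hy).trans hz.1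
    have e : (∫ x in T..t, h x) - ∫ x in T..(t/2), h x = ∫ x in (t/2)..t, h x :=
      intervalIntegral.integral_interval_sub_left (ii _ _ le_rfl (by linarith)) (ii _ _ le_rfl hT)
    simp only [Function.comp]
    rw [e]
    have : (∫ x in (t/2)..t, h t) ≤ ∫ x in (t/2)..t, h x := by
      apply intervalIntegral.integral_mono_on (by linarith) (by simp) (ii _ _ hT (by linarith))
      intro x hx
      simp only [hh]
      have hpx := hp x (by linarith [hx.1])
      have := hm (show x ∈ Ici a from by simp only [mem_Ici]; linarith [hx.1])
        (show t ∈ Ici a from by simp only [mem_Ici]; linarith) hx.2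
      gcongr
    rw [intervalIntegral.integral_const, smul_eq_mul] at this
    rw [div_eq_mul_inv]
    change t * h t ≤ _
    linarith

theorem statement17 {N : ℕ} (hN : 1 ≤ N) (f : ℝ → ℝ) (hf : ContDiff ℝ 1 f)
    -- condition (2)
    (a : ℝ) (ha : 0 < f a) (hf0 : ∀ t > a, 0 ≤ f t)
    (F : ℝ → ℝ) (hF : ∀ t, F t = ∫ s in a..t, f s)
    -- condition (3): Keller-Osserman
    (hKO : ∃ T, (∀ t ≥ T, 0 < F t) ∧
      IntegrableOn (fun t => (Real.sqrt (F t))⁻¹) (Ici T))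
    (r₀ : ℝ) (hr₀ : r₀ ∈ Ico (0 : ℝ) 1)
    -- u : (r₀,1) → ℝ strictly increasing C² solution of u'' + ((N−1)/r) u' = f(u),
    -- blowing up at r = 1 (d = u')
    (u d : ℝ → ℝ)
    (hmono : StrictMonoOn u (Ioo r₀ 1))
    (hd : ∀ r ∈ Ioo r₀ (1 : ℝ), HasDerivAt u (d r) r)
    (heq : ∀ r ∈ Ioo r₀ (1 : ℝ), HasDerivAt d (f (u r) - (N - 1 : ℝ) / r * d r) r)
    (hblow : Tendsto u (𝓝[<] (1 : ℝ)) atTop)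
    -- G is an antiderivative of √(2F) with G → +∞
    (G : ℝ → ℝ) (hG : ∀ t, HasDerivAt G (Real.sqrt (2 * F t)) t)
    (hGtop : Tendsto G atTop atTop) :
    -- with g = −v²/2 + F(u) (as a function of u via the change of variables u = u(r)):
    -- g(u)/F(u) → 0 as u → +∞
    Tendsto (fun r => (-(d r) ^ 2 / 2 + F (u r)) / F (u r)) (𝓝[<] (1 : ℝ)) (𝓝 0) ∧
    -- g(u)/((N−1) G(u)) → 1 as u → +∞ (for N ≥ 2)
    (2 ≤ N →
      Tendsto (fun r => (-(d r) ^ 2 / 2 + F (u r)) / ((N - 1 : ℝ) * G (u r)))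
        (𝓝[<] (1 : ℝ)) (𝓝 1)) ∧
    -- for N = 1, g tends to a constant
    (N = 1 → ∃ c : ℝ, Tendsto (fun r => -(d r) ^ 2 / 2 + F (u r)) (𝓝[<] (1 : ℝ)) (𝓝 c)) := by
  have hfc : Continuous f := hf.continuous
  have hFd : ∀ t, HasDerivAt F (f t) t := by
    intro t
    have : F = fun t => ∫ s in a..t, f s := funext hF
    rw [this]
    exact intervalIntegral.integral_hasDerivAt_right (hfc.intervalIntegrable _ _)
      (hfc.stronglyMeasurableAtFilter _ _) hfc.continuousAt
  have hFm : MonotoneOn F (Ici a) := by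
    apply monotoneOn_of_hasDerivWithinAt_nonneg (convex_Ici a) (f' := f)
    · intro x _
      exact (hFd x).continuousAt.continuousWithinAt
    · intro x _
      exact (hFd x).hasDerivWithinAt
    · intro x hx
      rw [interior_Ici] at hx
      exact hf0 x hx
  obtain ⟨T, hTpos, hTint⟩ := hKO
  have hKOl := aux_KO F a T hFm hTpos hTint
  have hsq : Tendsto (fun t => Real.sqrt (F t)) atTop atTop := by
    refine tendsto_atTop_mono' _ ?_ tendsto_id
    filter_upwards [hKOl.eventually_lt_const one_pos, eventually_ge_atTop T] with t h1 h2
    have := Real.sqrt_pos.2 (hTpos t h2)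
    rw [div_lt_one this] at h1
    exact h1.le
  have hFtop : Tendsto F atTop atTop := by
    refine tendsto_atTop.2 fun b => ?_
    filter_upwards [hsq.eventually_ge_atTop (max b 1), eventually_ge_atTop T] with t h1 h2
    have h3 := Real.sq_sqrt (hTpos t h2).le
    have h4 := le_max_left b 1
    have h5 := le_max_right b 1
    nlinarith
  obtain ⟨hr0, hr01⟩ := hr₀
  have hM : (0 : ℝ) ≤ (N : ℝ) - 1 := by
    have : (1 : ℝ) ≤ N := by exact_mod_cast hN
    linarith
  have hdn : ∀ r ∈ Ioo r₀ (1 : ℝ), 0 ≤ d r := by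
    intro r hr
    have h1 : derivWithin u (Ioo r₀ 1) r = d r :=
      ((hd r hr).hasDerivWithinAt).derivWithin (isOpen_Ioo.uniqueDiffWithinAt hr)
    rw [← h1]
    exact hmono.monotoneOn.derivWithin_nonneg
  set g : ℝ → ℝ := fun r => -(d r) ^ 2 / 2 + F (u r) with hg
  have hgd : ∀ r ∈ Ioo r₀ (1 : ℝ), HasDerivAt g (((N : ℝ) - 1) / r * d r ^ 2) r := by
    intro r hr
    have h1 := (((heq r hr).pow 2).neg.div_const 2).add ((hFd (u r)).comp r (hd r hr))
    refine h1.congr_deriv ?_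
    simp
    ring
  have hmem : Ioo r₀ 1 ∈ 𝓝[<] (1 : ℝ) := Ioo_mem_nhdsLT hr01
  have hgF : Tendsto (fun r => g r / F (u r)) (𝓝[<] (1 : ℝ)) (𝓝 0) := by
    obtain ⟨r₁, hr₁, hua⟩ := ((eventually_of_mem hmem fun _ h => h).and
      (hblow.eventually_ge_atTop a)).exists
    have hr₁0 : 0 < r₁ := lt_of_le_of_lt hr0 hr₁.1
    have hgm : MonotoneOn g (Ico r₁ 1) := by
      have hsub : ∀ x ∈ Ico r₁ 1, x ∈ Ioo r₀ 1 := fun x hx => ⟨hr₁.1.trans_le hx.1, hx.2⟩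
      apply monotoneOn_of_hasDerivWithinAt_nonneg (convex_Ico r₁ 1)
        (f' := fun r => ((N : ℝ) - 1) / r * d r ^ 2)
      · intro x hx
        exact (hgd x (hsub x hx)).continuousAt.continuousWithinAt
      · intro x hx
        exact (hgd x (hsub x (interior_subset hx))).hasDerivWithinAt
      · intro x hx
        have := (interior_subset hx).1
        have : 0 < x := by linarith
        positivity
    set K := ((N : ℝ) - 1) / r₁ with hK
    have hK0 : 0 ≤ K := by positivity
    have hinv : Tendsto (fun r => (F (u r))⁻¹) (𝓝[<] (1 : ℝ)) (𝓝 0) :=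
      tendsto_inv_atTop_zero.comp (hFtop.comp hblow)
    have hinvs : Tendsto (fun r => (Real.sqrt (F (u r)))⁻¹) (𝓝[<] (1 : ℝ)) (𝓝 0) :=
      tendsto_inv_atTop_zero.comp (hsq.comp hblow)
    have hlow : Tendsto (fun r => g r₁ * (F (u r))⁻¹) (𝓝[<] (1 : ℝ)) (𝓝 0) := by
      simpa using hinv.const_mul (g r₁)
    have hup : Tendsto (fun r => g r₁ * (F (u r))⁻¹ + 2 * K * (u r / Real.sqrt (F (u r))
        - u r₁ * (Real.sqrt (F (u r)))⁻¹)) (𝓝[<] (1 : ℝ)) (𝓝 0) := by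
      have := hlow.add (((hKOl.comp hblow).sub (hinvs.const_mul (u r₁))).const_mul (2 * K))
      simpa [Function.comp_def] using this
    refine tendsto_of_tendsto_of_tendsto_of_le_of_le' hlow hup ?_ ?_
    · filter_upwards [Ioo_mem_nhdsLT hr₁.2, (hFtop.comp hblow).eventually_gt_atTop 0] with r hr hp
      simp only [Function.comp] at hp
      rw [div_eq_mul_inv]
      have := hgm (left_mem_Ico.2 hr₁.2) ⟨hr.1.le, hr.2⟩ hr.1.le
      gcongr
    · filter_upwards [Ioo_mem_nhdsLT hr₁.2, (hFtop.comp hblow).eventually_gt_atTop |g r₁|]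
        with r hr hp
      simp only [Function.comp] at hp
      have hFp : 0 < F (u r) := lt_of_le_of_lt (abs_nonneg _) hp
      set B := Real.sqrt (F (u r)) with hB
      have hBp : 0 < B := Real.sqrt_pos.2 hFp
      have hB2 : B ^ 2 = F (u r) := Real.sq_sqrt hFp.le
      have hsub : ∀ x ∈ Icc r₁ r, x ∈ Ioo r₀ 1 :=
        fun x hx => ⟨hr₁.1.trans_le hx.1, hx.2.trans_lt hr.2⟩
      have hrm : r ∈ Ioo r₀ 1 := hsub r ⟨hr.1.le, le_rfl⟩
      have hmon : MonotoneOn (fun x => 2 * K * B * u x - g x) (Icc r₁ r) := by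
        apply monotoneOn_of_hasDerivWithinAt_nonneg (convex_Icc r₁ r)
          (f' := fun x => 2 * K * B * d x - ((N : ℝ) - 1) / x * d x ^ 2)
        · intro x hx
          exact (((hd x (hsub x hx)).const_mul _).sub
            (hgd x (hsub x hx))).continuousAt.continuousWithinAt
        · intro x hx
          have hx' := hsub x (interior_subset hx)
          exact (((hd x hx').const_mul _).sub (hgd x hx')).hasDerivWithinAt
        · intro x hx
          have hxI := interior_subset hx
          have hx' := hsub x hxI
          have hd0 := hdn x hx'
          have u1 : u r₁ ≤ u x := hmono.monotoneOn hr₁ hx' hxI.1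
          have u2 : u x ≤ u r := hmono.monotoneOn hx' hrm hxI.2
          have F1 : F (u x) ≤ F (u r) :=
            hFm (show a ≤ u x by linarith) (show a ≤ u r by linarith) u2
          have g1 : g r₁ ≤ g x := hgm (left_mem_Ico.2 hr₁.2) ⟨hxI.1, hx'.2⟩ hxI.1
          have g2 := neg_abs_le (g r₁)
          have hgx : g x = -(d x) ^ 2 / 2 + F (u x) := rfl
          have hdB : d x ≤ 2 * B := by
            refine abs_le_of_sq_le_sq' ?_ (by positivity) |>.2
            nlinarith
          have hKx : ((N : ℝ) - 1) / x ≤ K := by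
            rw [hK]
            have := hxI.1
            gcongr
          have : ((N : ℝ) - 1) / x * d x ^ 2 ≤ K * (2 * B * d x) := by
            apply mul_le_mul hKx _ (by positivity) hK0
            nlinarith
          linarith
      have h1 := hmon (left_mem_Icc.2 hr.1.le) (right_mem_Icc.2 hr.1.le) hr.1.le
      simp only at h1
      have e : g r₁ * (F (u r))⁻¹ + 2 * K * (u r / B - u r₁ * B⁻¹)
          = (g r₁ + 2 * K * B * (u r - u r₁)) / F (u r) := by
        rw [← hB2]
        field_simp
      rw [e]
      apply div_le_div_of_nonneg_right _ hFp.le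
      linarith
  refine ⟨hgF, ?_, ?_⟩
  · intro hN2
    have hM2 : (0 : ℝ) < (N : ℝ) - 1 := by
      have : (2 : ℝ) ≤ N := by exact_mod_cast hN2
      linarith
    have hFpos : ∀ᶠ r in 𝓝[<] (1 : ℝ), 0 < F (u r) :=
      (hFtop.comp hblow).eventually_gt_atTop 0
    apply aux_lhop g (fun r => ((N : ℝ) - 1) * G (u r))
      (fun r => ((N : ℝ) - 1) * (Real.sqrt (2 * F (u r)) * d r))
      (fun r => r⁻¹ * (d r / Real.sqrt (2 * F (u r))))
    · filter_upwards [hmem, hFpos] with r hr hp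
      refine (hgd r hr).congr_deriv ?_
      have hs : 0 < Real.sqrt (2 * F (u r)) := Real.sqrt_pos.2 (by positivity)
      have hrp : 0 < r := lt_of_le_of_lt hr0 hr.1
      field_simp
    · filter_upwards [hmem] with r hr
      exact ((hG (u r)).comp r (hd r hr)).const_mul _
    · filter_upwards [hmem] with r hr
      have := hdn r hr
      positivity
    · have h1 : Tendsto (fun r : ℝ => r⁻¹) (𝓝[<] (1 : ℝ)) (𝓝 1) := by
        have : Tendsto (fun r : ℝ => r⁻¹) (𝓝 1) (𝓝 (1 : ℝ)⁻¹) := tendsto_inv₀ one_ne_zero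
        rw [inv_one] at this
        exact this.mono_left nhdsWithin_le_nhds
      have h2 : Tendsto (fun r => Real.sqrt (1 - g r / F (u r))) (𝓝[<] (1 : ℝ)) (𝓝 1) := by
        have := (Real.continuous_sqrt.tendsto (1 - 0)).comp (hgF.const_sub 1)
        simpa [Function.comp_def] using this
      have h3 := h1.mul h2
      rw [mul_one] at h3
      refine h3.congr' ?_
      filter_upwards [hmem, hFpos] with r hr hp
      have : 1 - g r / F (u r) = d r ^ 2 / (2 * F (u r)) := by
        simp only [hg]
        field_simp
        ring
      rw [this, Real.sqrt_div (sq_nonneg _), Real.sqrt_sq (hdn r hr)]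
    · exact (hGtop.comp hblow).const_mul_atTop hM2
  · intro hN1
    subst hN1
    have hmid : (r₀ + 1) / 2 ∈ Ioo r₀ 1 := ⟨by linarith, by linarith⟩
    refine ⟨g ((r₀ + 1) / 2), ?_⟩
    refine tendsto_const_nhds.congr' ?_
    filter_upwards [hmem] with r hr
    refine isOpen_Ioo.is_const_of_deriv_eq_zero isPreconnected_Ioo
      (fun x hx => (hgd x hx).differentiableAt.differentiableWithinAt) ?_ hmid hr
    intro x hx
    rw [(hgd x hx).deriv]
    simp
end
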